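/- Let n ≥ 2, α = 1, 0 < γ < 1, and let f : ℝⁿ → ℂ be a Schwartz function. For each ε ∈ (0,1] let u^ε be a solution of (H) with datum f. For each t ∈ [0,π] and each ε, let a^ε(t) := v^{ε,t}(0,·), where v^{ε,t} : ℝ × ℝⁿ → ℂ is a solution (in the same regularity class) of the linear equation iε∂_s v + (ε²/2)Δv = (|x|²/2)v satisfying v^{ε,t}(t,·) = u^ε(t,·); set b^ε(t,x) := a^ε(t)(x) e^{−ig(t,x)}. Then for every δ > 0 there exists a constant C_δ such that for all ε ∈ (0,1]: sup_{0 ≤ t ≤ π} ‖ b^ε(t,·) − f ‖_Σ ≤ C_δ ε^{1−γ−δ}, where ‖φ‖_Σ := ‖φ‖_{L²} + ‖|x|φ‖_{L²} + ‖∇φ‖_{L²}. -/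

import Mathlib

open MeasureTheory Real Filter Topology
open scoped ENNReal NNReal ComplexConjugate

noncomputable section

/-- Euclidean space ℝⁿ. -/
abbrev Rn (n : ℕ) := EuclideanSpace ℝ (Fin n)

/-- The gradient of a complex-valued function on ℝⁿ, as a ℂⁿ-valued function. -/
def grad {n : ℕ} (φ : Rn n → ℂ) (x : Rn n) : Fin n → ℂ :=
  fun j => fderiv ℝ φ x (EuclideanSpace.single j 1)

/-- The gradient, valued in the Euclidean space ℂⁿ (so that its pointwise norm is the
Euclidean norm). -/
def gradE {n : ℕ} (φ : Rn n → ℂ) (x : Rn n) : EuclideanSpace ℂ (Fin n) :=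
  (WithLp.equiv 2 (Fin n → ℂ)).symm (grad φ x)

/-- The Laplacian of a complex-valued function on ℝⁿ. -/
def lap {n : ℕ} (φ : Rn n → ℂ) (x : Rn n) : ℂ :=
  ∑ j, fderiv ℝ (fun y => fderiv ℝ φ y (EuclideanSpace.single j 1)) x (EuclideanSpace.single j 1)

/-- The operator J^ε(t) = (x/ε) sin t − i cos t ∇ₓ. -/
def Jop {n : ℕ} (ε t : ℝ) (φ : Rn n → ℂ) (x : Rn n) : Fin n → ℂ :=
  fun j => ((x j / ε : ℝ) : ℂ) * ((Real.sin t : ℝ) : ℂ) * φ x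
    - Complex.I * ((Real.cos t : ℝ) : ℂ) * grad φ x j

/-- The operator H^ε(t) = x cos t + iε sin t ∇ₓ. -/
def Hop {n : ℕ} (ε t : ℝ) (φ : Rn n → ℂ) (x : Rn n) : Fin n → ℂ :=
  fun j => ((x j : ℝ) : ℂ) * ((Real.cos t : ℝ) : ℂ) * φ x
    + Complex.I * (ε : ℂ) * ((Real.sin t : ℝ) : ℂ) * grad φ x j

/-- J^ε(t)φ viewed as valued in Euclidean ℂⁿ. -/
def JopE {n : ℕ} (ε t : ℝ) (φ : Rn n → ℂ) (x : Rn n) : EuclideanSpace ℂ (Fin n) :=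
  (WithLp.equiv 2 (Fin n → ℂ)).symm (Jop ε t φ x)

/-- H^ε(t)φ viewed as valued in Euclidean ℂⁿ. -/
def HopE {n : ℕ} (ε t : ℝ) (φ : Rn n → ℂ) (x : Rn n) : EuclideanSpace ℂ (Fin n) :=
  (WithLp.equiv 2 (Fin n → ℂ)).symm (Hop ε t φ x)

/-- Convolution (|x|^{−γ} ∗ ψ)(x) of a real-valued ψ with the kernel |x|^{−γ}. -/
def conv {n : ℕ} (γ : ℝ) (ψ : Rn n → ℝ) (x : Rn n) : ℝ :=
  ∫ y : Rn n, ‖x - y‖ ^ (-γ) * ψ y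

/-- Convolution (|x|^{−γ} ∗ ψ)(x) of a complex-valued ψ with the kernel |x|^{−γ}. -/
def convC {n : ℕ} (γ : ℝ) (ψ : Rn n → ℂ) (x : Rn n) : ℂ :=
  ∫ y : Rn n, ((‖x - y‖ ^ (-γ) : ℝ) : ℂ) * ψ y

/-- The Hartree potential |x|^{−γ} ∗ |u|². -/
def hartree {n : ℕ} (γ : ℝ) (u : Rn n → ℂ) (x : Rn n) : ℝ :=
  conv γ (fun y => Complex.normSq (u y)) x

/-- `u` is a (smooth, Schwartz-in-x) solution of the semiclassical Hartree equation with
harmonic potential: iε∂ₜu + (ε²/2)Δu = (|x|²/2)u + ε^α(|x|^{−γ}∗|u|²)u, u(0) = f. -/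
structure IsSolutionH (n : ℕ) (α γ ε : ℝ) (f : Rn n → ℂ) (u : ℝ → Rn n → ℂ) : Prop where
  smooth : ContDiff ℝ (⊤ : ℕ∞) (fun p : ℝ × Rn n => u p.1 p.2)
  schwartz : ∀ t, ∃ φ : SchwartzMap (Rn n) ℂ, u t = ⇑φ
  init : u 0 = f
  eq : ∀ t x, Complex.I * (ε : ℂ) * deriv (fun s => u s x) t
      + ((ε ^ 2 / 2 : ℝ) : ℂ) * lap (u t) x
    = ((‖x‖ ^ 2 / 2 : ℝ) : ℂ) * u t x
      + ((ε ^ α : ℝ) : ℂ) * ((hartree γ (u t) x : ℝ) : ℂ) * u t x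

/-- `u` is a (smooth, Schwartz-in-x) solution of the linear equation
iε∂ₜu + (ε²/2)Δu = (|x|²/2)u. -/
structure IsLinSol (n : ℕ) (ε : ℝ) (u : ℝ → Rn n → ℂ) : Prop where
  smooth : ContDiff ℝ (⊤ : ℕ∞) (fun p : ℝ × Rn n => u p.1 p.2)
  schwartz : ∀ t, ∃ φ : SchwartzMap (Rn n) ℂ, u t = ⇑φ
  eq : ∀ t x, Complex.I * (ε : ℂ) * deriv (fun s => u s x) t
      + ((ε ^ 2 / 2 : ℝ) : ℂ) * lap (u t) x
    = ((‖x‖ ^ 2 / 2 : ℝ) : ℂ) * u t x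

/-- The semiclassical harmonic-oscillator propagator U^ε(t), via Mehler's formula
(for 0 < t < π). -/
def Uprop (n : ℕ) (ε t : ℝ) (φ : Rn n → ℂ) (x : Rn n) : ℂ :=
  Complex.exp (-Complex.I * (n : ℂ) * (π : ℂ) / 4) *
    ((2 * π * ε * Real.sin t : ℝ) : ℂ) ^ (-(n : ℂ) / 2) *
    ∫ y : Rn n, Complex.exp ((Complex.I / ((ε * Real.sin t : ℝ) : ℂ)) *
      (((‖x‖ ^ 2 + ‖y‖ ^ 2) / 2 * Real.cos t - ∑ j, x j * y j : ℝ) : ℂ)) * φ y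

/-- The WKB approximation operator V^ε(t) (for t ∈ (0,π/2) ∪ (π/2,π)). -/
def Vprop (n : ℕ) (ε t : ℝ) (φ : Rn n → ℂ) (x : Rn n) : ℂ :=
  if t < π / 2 then
    ((Real.cos t ^ (-(n : ℝ) / 2) : ℝ) : ℂ) * φ ((Real.cos t)⁻¹ • x) *
      Complex.exp (-Complex.I * ((‖x‖ ^ 2 * Real.tan t / (2 * ε) : ℝ) : ℂ))
  else
    Complex.exp (-Complex.I * (n : ℂ) * ((π / 2 : ℝ) : ℂ)) *
      ((|Real.cos t| ^ (-(n : ℝ) / 2) : ℝ) : ℂ) * φ ((Real.cos t)⁻¹ • x) *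
      Complex.exp (-Complex.I * ((‖x‖ ^ 2 * Real.tan t / (2 * ε) : ℝ) : ℂ))

/-- The Σ-norm ‖φ‖_Σ = ‖φ‖_{L²} + ‖|x|φ‖_{L²} + ‖∇φ‖_{L²}, with values in ℝ≥0∞. -/
def SigmaNorm {n : ℕ} (φ : Rn n → ℂ) : ℝ≥0∞ :=
  eLpNorm φ 2 volume + eLpNorm (fun x => (‖x‖ : ℂ) * φ x) 2 volume
    + eLpNorm (gradE φ) 2 volume

/-- The H¹-norm (‖φ‖_{L²}² + ‖∇φ‖_{L²}²)^{1/2}, with values in ℝ≥0∞. -/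
def H1norm {n : ℕ} (φ : Rn n → ℂ) : ℝ≥0∞ :=
  (eLpNorm φ 2 volume ^ (2 : ℝ) + eLpNorm (gradE φ) 2 volume ^ (2 : ℝ)) ^ ((1 : ℝ) / 2)

/-- The nonlinear WKB phase g(t,x) = −(|x|^{−γ}∗|f|²)(x) ∫₀ᵗ |cos τ|^{−γ} dτ. -/
def gphase {n : ℕ} (γ : ℝ) (f : Rn n → ℂ) (t : ℝ) (x : Rn n) : ℝ :=
  -(conv γ (fun y => Complex.normSq (f y)) x) * ∫ τ in (0 : ℝ)..t, |Real.cos τ| ^ (-γ)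

/-- The Fourier transform Fφ(ξ) = (2π)^{−n/2} ∫ e^{−ix·ξ} φ(x) dx. -/
def FT {n : ℕ} (φ : Rn n → ℂ) (ξ : Rn n) : ℂ :=
  (((2 * π : ℝ) ^ (-(n : ℝ) / 2) : ℝ) : ℂ) *
    ∫ x : Rn n, Complex.exp (-Complex.I * ((∑ j, x j * ξ j : ℝ) : ℂ)) * φ x

/-- The inverse Fourier transform. -/
def FTinv {n : ℕ} (φ : Rn n → ℂ) (ξ : Rn n) : ℂ :=
  (((2 * π : ℝ) ^ (-(n : ℝ) / 2) : ℝ) : ℂ) *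
    ∫ x : Rn n, Complex.exp (Complex.I * ((∑ j, x j * ξ j : ℝ) : ℂ)) * φ x

section
/-! ### Schwartz space basics -/

abbrev SR (n : ℕ) := SchwartzMap (Rn n) ℂ

/-- multiplication by a function of temperate growth -/
def mulS {n : ℕ} (g : Rn n → ℂ) : SR n →L[ℂ] SR n := SchwartzMap.smulLeftCLM ℂ g

lemma mulS_apply {n : ℕ} {g : Rn n → ℂ} (hg : g.HasTemperateGrowth) (φ : SR n) (x : Rn n) :
    mulS g φ x = g x * φ x := by
  simp [mulS, hg]

abbrev ej {n : ℕ} (j : Fin n) : Rn n := EuclideanSpace.single j (1 : ℝ)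

def Dop {n : ℕ} (j : Fin n) : SR n →L[ℂ] SR n :=
  LineDeriv.lineDerivOpCLM ℂ (SR n) (ej j)

lemma Dop_apply {n : ℕ} (j : Fin n) (φ : SR n) (x : Rn n) :
    Dop j φ x = fderiv ℝ φ x (ej j) := by
  simp [Dop, SchwartzMap.lineDerivOp_apply_eq_fderiv]

lemma coord_tg {n : ℕ} (j : Fin n) :
    (fun x : Rn n => ((x j : ℝ) : ℂ)).HasTemperateGrowth := by
  have h1 : (fun x : Rn n => x j).HasTemperateGrowth :=
    (EuclideanSpace.proj j : Rn n →L[ℝ] ℝ).hasTemperateGrowth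
  exact Function.HasTemperateGrowth.comp Function.Complex.hasTemperateGrowth_ofReal h1

def Xop {n : ℕ} (j : Fin n) : SR n →L[ℂ] SR n := mulS (fun x => ((x j : ℝ) : ℂ))

lemma Xop_apply {n : ℕ} (j : Fin n) (φ : SR n) (x : Rn n) :
    Xop j φ x = (x j : ℂ) * φ x := mulS_apply (coord_tg j) φ x

lemma add_ap {n : ℕ} (φ ψ : SR n) (x : Rn n) : (φ + ψ) x = φ x + ψ x := by simp
lemma sub_ap {n : ℕ} (φ ψ : SR n) (x : Rn n) : (φ - ψ) x = φ x - ψ x := by simp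
lemma smul_ap {n : ℕ} (c : ℂ) (φ : SR n) (x : Rn n) : (c • φ) x = c * φ x := by simp

lemma SR_diff {n : ℕ} (φ : SR n) (x : Rn n) : DifferentiableAt ℝ (φ : Rn n → ℂ) x :=
  φ.differentiableAt

lemma SR_hasFDerivAt {n : ℕ} (φ : SR n) (x : Rn n) : HasFDerivAt (φ : Rn n → ℂ) (fderiv ℝ φ x) x :=
  (SR_diff φ x).hasFDerivAt

lemma Dop_mulS {n : ℕ} (j : Fin n) {g g' : Rn n → ℂ} (hg : g.HasTemperateGrowth)
    (hg' : g'.HasTemperateGrowth) (h : ∀ x, fderiv ℝ g x (ej j) = g' x) (φ : SR n) :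
    Dop j (mulS g φ) = mulS g' φ + mulS g (Dop j φ) := by
  ext x
  rw [Dop_apply, add_ap, mulS_apply hg', mulS_apply hg, Dop_apply]
  have e : (⇑(mulS g φ) : Rn n → ℂ) = fun x => g x * φ x := funext fun y => mulS_apply hg φ y
  have hd : DifferentiableAt ℝ g x := (hg.1.differentiable (by simp)) x
  rw [e, fderiv_fun_mul hd (SR_diff φ x)]
  simp [h, mul_comm]
  ring

lemma fderiv_coord {n : ℕ} (j k : Fin n) (x : Rn n) :
    fderiv ℝ (fun x : Rn n => ((x k : ℝ) : ℂ)) x (ej j) = if j = k then 1 else 0 := by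
  have h : HasFDerivAt (fun x : Rn n => ((x k : ℝ) : ℂ))
      (Complex.ofRealCLM.comp (EuclideanSpace.proj k : Rn n →L[ℝ] ℝ)) x :=
    (Complex.ofRealCLM.comp (EuclideanSpace.proj k : Rn n →L[ℝ] ℝ)).hasFDerivAt
  rw [h.fderiv]
  simp [ej, eq_comm]
  split_ifs <;> simp

lemma Dop_Xop {n : ℕ} (j k : Fin n) (φ : SR n) :
    Dop j (Xop k φ) = (if j = k then (1 : ℂ) else 0) • φ + Xop k (Dop j φ) := by
  rw [Xop, Dop_mulS j (coord_tg k) (Function.HasTemperateGrowth.const (if j = k then (1 : ℂ) else 0))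
    (fun x => fderiv_coord j k x)]
  congr 1
  ext x
  rw [mulS_apply (Function.HasTemperateGrowth.const _), smul_ap]

lemma Dop_comm {n : ℕ} (j k : Fin n) (φ : SR n) : Dop j (Dop k φ) = Dop k (Dop j φ) := by
  ext x
  have e : ∀ i, (⇑(Dop i φ) : Rn n → ℂ) = fun y => fderiv ℝ φ y (ej i) :=
    fun i => funext fun y => Dop_apply i φ y
  rw [Dop_apply, Dop_apply, e, e]
  have h2 : ContDiffAt ℝ 2 (φ : Rn n → ℂ) x := φ.contDiffAt 2
  have hs := h2.isSymmSndFDerivAt (by simp)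
  have hd : DifferentiableAt ℝ (fderiv ℝ (φ : Rn n → ℂ)) x :=
    (h2.fderiv_right (m := 1) (by norm_num)).differentiableAt (by simp)
  have h : ∀ i, fderiv ℝ (fun y => fderiv ℝ (φ : Rn n → ℂ) y (ej i)) x =
      (ContinuousLinearMap.apply ℝ ℂ (ej i)).comp (fderiv ℝ (fderiv ℝ (φ : Rn n → ℂ)) x) := by
    intro i
    exact ((ContinuousLinearMap.apply ℝ ℂ (ej i)).hasFDerivAt.comp x hd.hasFDerivAt).fderiv
  rw [h, h]
  exact hs (ej j) (ej k)

lemma Xop_comm {n : ℕ} (j k : Fin n) (φ : SR n) : Xop j (Xop k φ) = Xop k (Xop j φ) := by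
  ext x
  simp only [Xop_apply]; ring

def LapS {n : ℕ} (φ : SR n) : SR n := ∑ j, Dop j (Dop j φ)

lemma sum_ap {n : ℕ} {ι : Type*} (s : Finset ι) (F : ι → SR n) (x : Rn n) :
    (∑ i ∈ s, F i) x = ∑ i ∈ s, F i x := by
  simp

lemma lap_eq {n : ℕ} (φ : SR n) (x : Rn n) : lap (⇑φ) x = LapS φ x := by
  rw [LapS, sum_ap, lap]
  refine Finset.sum_congr rfl fun j _ => ?_
  rw [Dop_apply]
  congr 2

lemma LapS_add {n : ℕ} (φ ψ : SR n) : LapS (φ + ψ) = LapS φ + LapS ψ := by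
  simp [LapS, Finset.sum_add_distrib]
lemma LapS_smul {n : ℕ} (c : ℂ) (φ : SR n) : LapS (c • φ) = c • LapS φ := by
  simp [LapS, Finset.smul_sum]
lemma LapS_D {n : ℕ} (j : Fin n) (φ : SR n) : LapS (Dop j φ) = Dop j (LapS φ) := by
  simp only [LapS, map_sum]
  refine Finset.sum_congr rfl fun k _ => ?_
  rw [Dop_comm k j φ, Dop_comm k j (Dop k φ)]

/-! ### L² -/

def toL2 {n : ℕ} : SR n →L[ℂ] Lp ℂ 2 (volume : Measure (Rn n)) :=
  SchwartzMap.toLpCLM ℂ ℂ 2 volume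

def nrm {n : ℕ} (φ : SR n) : ℝ := ‖toL2 φ‖
def ip {n : ℕ} (φ ψ : SR n) : ℂ := inner ℂ (toL2 φ) (toL2 ψ)

lemma ip_eq {n : ℕ} (φ ψ : SR n) : ip φ ψ = ∫ x, conj (φ x) * ψ x := by
  have := SchwartzMap.inner_toL2_toL2_eq φ ψ (volume : Measure (Rn n))
  rw [ip, toL2]
  simp only [SchwartzMap.toLpCLM_apply]
  rw [this]
  simp [mul_comm]

lemma nrm_nonneg {n : ℕ} (φ : SR n) : 0 ≤ nrm φ := norm_nonneg _
lemma nrm_add {n : ℕ} (φ ψ : SR n) : nrm (φ + ψ) ≤ nrm φ + nrm ψ := by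
  simp only [nrm, map_add]; exact norm_add_le _ _
lemma nrm_sub {n : ℕ} (φ ψ : SR n) : nrm (φ - ψ) ≤ nrm φ + nrm ψ := by
  simp only [nrm, map_sub]; exact norm_sub_le _ _
lemma nrm_smul {n : ℕ} (c : ℂ) (φ : SR n) : nrm (c • φ) = ‖c‖ * nrm φ := by
  simp only [nrm, map_smul, norm_smul]
lemma nrm_zero {n : ℕ} : nrm (0 : SR n) = 0 := by simp [nrm]
lemma nrm_neg {n : ℕ} (φ : SR n) : nrm (-φ) = nrm φ := by simp [nrm]
lemma nrm_sub_comm {n : ℕ} (φ ψ : SR n) : nrm (φ - ψ) = nrm (ψ - φ) := by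
  rw [← nrm_neg, neg_sub]
lemma nrm_sum {n : ℕ} {ι : Type*} (s : Finset ι) (F : ι → SR n) :
    nrm (∑ i ∈ s, F i) ≤ ∑ i ∈ s, nrm (F i) := by
  simp only [nrm, map_sum]; exact norm_sum_le _ _

lemma ip_self {n : ℕ} (φ : SR n) : ip φ φ = ((nrm φ ^ 2 : ℝ) : ℂ) := by
  rw [ip, nrm, inner_self_eq_norm_sq_to_K]; simp
lemma ip_le {n : ℕ} (φ ψ : SR n) : ‖ip φ ψ‖ ≤ nrm φ * nrm ψ := norm_inner_le_norm _ _
lemma ip_conj {n : ℕ} (φ ψ : SR n) : conj (ip φ ψ) = ip ψ φ := inner_conj_symm _ _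
lemma ip_add_right {n : ℕ} (φ ψ χ : SR n) : ip φ (ψ + χ) = ip φ ψ + ip φ χ := by
  simp [ip, inner_add_right]
lemma ip_add_left {n : ℕ} (φ ψ χ : SR n) : ip (φ + ψ) χ = ip φ χ + ip ψ χ := by
  simp [ip, inner_add_left]
lemma ip_sub_right {n : ℕ} (φ ψ χ : SR n) : ip φ (ψ - χ) = ip φ ψ - ip φ χ := by
  simp [ip, inner_sub_right]
lemma ip_sub_left {n : ℕ} (φ ψ χ : SR n) : ip (φ - ψ) χ = ip φ χ - ip ψ χ := by
  simp [ip, inner_sub_left]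
lemma ip_smul_right {n : ℕ} (c : ℂ) (φ ψ : SR n) : ip φ (c • ψ) = c * ip φ ψ := by
  simp [ip, inner_smul_right]
lemma ip_smul_left {n : ℕ} (c : ℂ) (φ ψ : SR n) : ip (c • φ) ψ = conj c * ip φ ψ := by
  simp [ip, inner_smul_left]
lemma ip_sum_right {n : ℕ} {ι : Type*} (s : Finset ι) (φ : SR n) (F : ι → SR n) :
    ip φ (∑ i ∈ s, F i) = ∑ i ∈ s, ip φ (F i) := by
  simp [ip, inner_sum]
lemma ip_sum_left {n : ℕ} {ι : Type*} (s : Finset ι) (φ : SR n) (F : ι → SR n) :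
    ip (∑ i ∈ s, F i) φ = ∑ i ∈ s, ip (F i) φ := by
  simp [ip, sum_inner]

lemma nrm_sq {n : ℕ} (φ : SR n) : nrm φ ^ 2 = ∫ x, ‖φ x‖ ^ 2 := by
  have h := ip_self φ
  rw [ip_eq] at h
  have : (∫ x, conj (φ x) * φ x) = ((∫ x, ‖φ x‖ ^ 2 : ℝ) : ℂ) := by
    rw [← integral_complex_ofReal]
    congr 1; ext x
    rw [mul_comm, Complex.mul_conj, Complex.normSq_eq_norm_sq]
  rw [this] at h
  exact_mod_cast h.symm

lemma eLp_eq {n : ℕ} (φ : SR n) : eLpNorm (⇑φ) 2 volume = ENNReal.ofReal (nrm φ) := by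
  rw [nrm, toL2, SchwartzMap.toLpCLM_apply, SchwartzMap.norm_toLp, ENNReal.ofReal_toReal]
  exact (φ.eLpNorm_lt_top 2 volume).ne

/-- complex conjugate of a Schwartz function -/
def cj {n : ℕ} (φ : SR n) : SR n :=
  SchwartzMap.postcompCLM (𝕜 := ℝ) (Complex.conjCLE : ℂ →L[ℝ] ℂ) φ

lemma cj_apply {n : ℕ} (φ : SR n) (x : Rn n) : cj φ x = conj (φ x) := by
  simp [cj]

lemma Dop_cj {n : ℕ} (j : Fin n) (φ : SR n) : Dop j (cj φ) = cj (Dop j φ) := by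
  ext x
  rw [Dop_apply, cj_apply, Dop_apply]
  have e : (⇑(cj φ) : Rn n → ℂ) = fun x => Complex.conjCLE (φ x) := by
    ext y; simp [cj_apply]
  have := ((Complex.conjCLE : ℂ →L[ℝ] ℂ).hasFDerivAt.comp x (SR_hasFDerivAt φ x)).fderiv
  rw [e]
  have e2 : (fun x => Complex.conjCLE (φ x)) = (⇑(Complex.conjCLE : ℂ →L[ℝ] ℂ)) ∘ ⇑φ := rfl
  rw [e2, this]
  simp

lemma ip_D {n : ℕ} (j : Fin n) (φ ψ : SR n) : ip (Dop j φ) ψ = - ip φ (Dop j ψ) := by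
  have h := SchwartzMap.integral_mul_lineDerivOp_right_eq_neg_left
    (μ := (volume : Measure (Rn n))) (cj φ) ψ (ej j)
  have e1 : ip φ (Dop j ψ) = ∫ x, cj φ x * (LineDeriv.lineDerivOp (ej j) ψ : SR n) x := by
    rw [ip_eq]; simp only [cj_apply]; rfl
  have e2 : ip (Dop j φ) ψ = ∫ x, (LineDeriv.lineDerivOp (ej j) (cj φ) : SR n) x * ψ x := by
    rw [ip_eq]
    refine integral_congr_ae (Eventually.of_forall fun x => ?_)
    have : (LineDeriv.lineDerivOp (ej j) (cj φ) : SR n) = Dop j (cj φ) := rfl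
    simp only [this, Dop_cj, cj_apply]
  rw [e1, e2, h]; simp

lemma ip_X {n : ℕ} (j : Fin n) (φ ψ : SR n) : ip (Xop j φ) ψ = ip φ (Xop j ψ) := by
  rw [ip_eq, ip_eq]
  congr 1; ext x
  simp only [Xop_apply, map_mul, Complex.conj_ofReal]; ring

lemma SR_eq_of_nrm {n : ℕ} {φ : SR n} (h : nrm φ = 0) : φ = 0 := by
  have h1 : toL2 φ = 0 := norm_eq_zero.mp h
  apply SchwartzMap.injective_toLp (F := ℂ) 2 (volume : Measure (Rn n))
  exact h1.trans (map_zero (toL2 (n := n))).symm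

/-- Σ norm on Schwartz functions -/
def nS {n : ℕ} (φ : SR n) : ℝ := nrm φ + ∑ j, nrm (Xop j φ) + ∑ j, nrm (Dop j φ)
def h1 {n : ℕ} (φ : SR n) : ℝ := nrm φ + ∑ j, nrm (Dop j φ)

lemma sum_nrm_nonneg {n : ℕ} {ι : Type*} (s : Finset ι) (F : ι → SR n) :
    0 ≤ ∑ j ∈ s, nrm (F j) :=
  Finset.sum_nonneg fun _ _ => nrm_nonneg _

lemma h1_nonneg {n : ℕ} (φ : SR n) : 0 ≤ h1 φ := add_nonneg (nrm_nonneg _) (sum_nrm_nonneg _ _)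
lemma nS_nonneg {n : ℕ} (φ : SR n) : 0 ≤ nS φ :=
  add_nonneg (add_nonneg (nrm_nonneg _) (sum_nrm_nonneg _ _)) (sum_nrm_nonneg _ _)
lemma nrm_le_h1 {n : ℕ} (φ : SR n) : nrm φ ≤ h1 φ := by
  have := sum_nrm_nonneg Finset.univ (fun j => Dop j φ); unfold h1; linarith
lemma h1_le_nS {n : ℕ} (φ : SR n) : h1 φ ≤ nS φ := by
  have := sum_nrm_nonneg Finset.univ (fun j => Xop j φ); unfold h1 nS; linarith
lemma nrm_le_nS {n : ℕ} (φ : SR n) : nrm φ ≤ nS φ := (nrm_le_h1 φ).trans (h1_le_nS φ)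
lemma nrmD_le_h1 {n : ℕ} (j : Fin n) (φ : SR n) : nrm (Dop j φ) ≤ h1 φ := by
  have := Finset.single_le_sum (f := fun j => nrm (Dop j φ)) (fun i _ => nrm_nonneg _)
    (Finset.mem_univ j)
  have := nrm_nonneg φ; unfold h1; linarith
lemma nrmD_le_nS {n : ℕ} (j : Fin n) (φ : SR n) : nrm (Dop j φ) ≤ nS φ :=
  (nrmD_le_h1 j φ).trans (h1_le_nS φ)
lemma nrmX_le_nS {n : ℕ} (j : Fin n) (φ : SR n) : nrm (Xop j φ) ≤ nS φ := by
  have := Finset.single_le_sum (f := fun j => nrm (Xop j φ)) (fun i _ => nrm_nonneg _)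
    (Finset.mem_univ j)
  have := nrm_nonneg φ
  have := sum_nrm_nonneg Finset.univ (fun j => Dop j φ)
  unfold nS; linarith

lemma h1_add {n : ℕ} (φ ψ : SR n) : h1 (φ + ψ) ≤ h1 φ + h1 ψ := by
  have : ∑ j, nrm (Dop j (φ + ψ)) ≤ ∑ j, nrm (Dop j φ) + ∑ j, nrm (Dop j ψ) := by
    rw [← Finset.sum_add_distrib]
    exact Finset.sum_le_sum fun j _ => by rw [map_add]; exact nrm_add _ _
  have := nrm_add φ ψ
  unfold h1; linarith
lemma nS_add {n : ℕ} (φ ψ : SR n) : nS (φ + ψ) ≤ nS φ + nS ψ := by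
  have : ∑ j, nrm (Xop j (φ + ψ)) ≤ ∑ j, nrm (Xop j φ) + ∑ j, nrm (Xop j ψ) := by
    rw [← Finset.sum_add_distrib]
    exact Finset.sum_le_sum fun j _ => by rw [map_add]; exact nrm_add _ _
  have := h1_add φ ψ
  unfold h1 at this
  unfold nS; linarith
lemma h1_smul {n : ℕ} (c : ℂ) (φ : SR n) : h1 (c • φ) = ‖c‖ * h1 φ := by
  simp [h1, nrm_smul, mul_add, Finset.mul_sum]
lemma nS_smul {n : ℕ} (c : ℂ) (φ : SR n) : nS (c • φ) = ‖c‖ * nS φ := by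
  simp [nS, nrm_smul, mul_add, Finset.mul_sum]
lemma nS_sub {n : ℕ} (φ ψ : SR n) : nS (φ - ψ) ≤ nS φ + nS ψ := by
  have := nS_add φ ((-1 : ℂ) • ψ)
  rw [nS_smul] at this
  simpa [sub_eq_add_neg] using this
lemma h1_sub {n : ℕ} (φ ψ : SR n) : h1 (φ - ψ) ≤ h1 φ + h1 ψ := by
  have := h1_add φ ((-1 : ℂ) • ψ)
  rw [h1_smul] at this
  simpa [sub_eq_add_neg] using this
lemma nS_sub_comm {n : ℕ} (φ ψ : SR n) : nS (φ - ψ) = nS (ψ - φ) := by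
  have := nS_smul (-1 : ℂ) (φ - ψ)
  simpa using this.symm

/-- a bound on all pieces bounds the Σ norm -/
lemma nS_le {n : ℕ} {φ : SR n} {B : ℝ} (h0 : nrm φ ≤ B) (hX : ∀ j, nrm (Xop j φ) ≤ B)
    (hD : ∀ j, nrm (Dop j φ) ≤ B) : nS φ ≤ (2 * n + 1) * B := by
  have h2 : ∑ j, nrm (Xop j φ) ≤ n * B := by
    simpa using Finset.sum_le_sum (s := Finset.univ) fun j _ => hX j
  have h3 : ∑ j, nrm (Dop j φ) ≤ n * B := by
    simpa using Finset.sum_le_sum (s := Finset.univ) fun j _ => hD j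
  unfold nS; linarith

end

section
/-! ### Convolution with the singular kernel -/

def kerB {n : ℕ} (a : ℝ) : Rn n → ℝ := (Metric.ball (0 : Rn n) 1).indicator (fun z => ‖z‖ ^ (-a))

lemma ker_meas {n : ℕ} (a : ℝ) : Measurable (fun z : Rn n => ‖z‖ ^ (-a)) :=
  measurable_norm.pow_const _

lemma kerB_integrable {n : ℕ} {a : ℝ} (hn : 1 ≤ n) (ha : a < n) :
    Integrable (kerB (n := n) a) := by
  unfold kerB
  rw [integrable_indicator_iff measurableSet_ball]
  refine integrableOn_ball_of_norm_le_rpow (C := 1) (α := a) (by simpa using hn) (by simpa using ha)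
    (Eventually.of_forall fun z => ?_) (ker_meas a).aestronglyMeasurable
  rw [one_mul, Real.norm_of_nonneg (by positivity)]

lemma ker_le {n : ℕ} {a : ℝ} (ha : 0 ≤ a) (z : Rn n) : ‖z‖ ^ (-a) ≤ kerB a z + 1 := by
  unfold kerB
  by_cases h : z ∈ Metric.ball (0 : Rn n) 1
  · rw [Set.indicator_of_mem h]; linarith
  · rw [Set.indicator_of_notMem h, zero_add]
    have : 1 ≤ ‖z‖ := by simpa using h
    exact Real.rpow_le_one_of_one_le_of_nonpos this (by linarith)

lemma kerB_nonneg {n : ℕ} {a : ℝ} (z : Rn n) : 0 ≤ kerB a z := by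
  unfold kerB
  exact Set.indicator_nonneg (fun z _ => by positivity) z

lemma jap_int {n : ℕ} (x : Rn n) : Integrable (fun z : Rn n => (1 + ‖x - z‖) ^ (-((n : ℝ) + 1))) := by
  have h := integrable_one_add_norm (E := Rn n) (μ := volume) (r := (n : ℝ) + 1) (by simp)
  exact (h.comp_sub_left x)

lemma ker_integrable {n : ℕ} {a : ℝ} (hn : 1 ≤ n) (ha0 : 0 ≤ a) (ha : a < n)
    {F : Type} [NormedAddCommGroup F] [NormedSpace ℝ F] {g : Rn n → F}
    (hg : AEStronglyMeasurable g volume) {C : ℝ} (x : Rn n)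
    (hC : ∀ z, ‖g z‖ ≤ C * (1 + ‖x - z‖) ^ (-((n : ℝ) + 1))) :
    Integrable (fun z => (‖z‖ ^ (-a)) • g z) := by
  have hC0 : 0 ≤ C := by
    have := (norm_nonneg _).trans (hC x)
    simpa using this
  refine Integrable.mono' (((kerB_integrable hn ha).const_mul C).add ((jap_int x).const_mul C))
    ((ker_meas a).aestronglyMeasurable.smul hg) (Eventually.of_forall fun z => ?_)
  have h1 : (1 + ‖x - z‖) ^ (-((n : ℝ) + 1)) ≤ 1 :=
    Real.rpow_le_one_of_one_le_of_nonpos (by linarith [norm_nonneg (x - z)]) (by linarith [Nat.cast_nonneg (α := ℝ) n])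
  have h0 : 0 ≤ (1 + ‖x - z‖) ^ (-((n : ℝ) + 1)) := by positivity
  rw [norm_smul, Real.norm_of_nonneg (by positivity)]
  calc ‖z‖ ^ (-a) * ‖g z‖ ≤ (kerB a z + 1) * (C * (1 + ‖x - z‖) ^ (-((n : ℝ) + 1))) := by
        gcongr
        · linarith [kerB_nonneg (a := a) z]
        · exact ker_le ha0 z
        · exact hC z
    _ ≤ _ := by
      simp only [Pi.add_apply]
      have := kerB_nonneg (a := a) z
      nlinarith [mul_le_mul_of_nonneg_left h1 (mul_nonneg hC0 this)]

/-- decay of Schwartz functions -/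
lemma sch_decay {n : ℕ} {F : Type} [NormedAddCommGroup F] [NormedSpace ℝ F]
    (ρ : SchwartzMap (Rn n) F) : ∃ C, 0 ≤ C ∧ ∀ y, ‖ρ y‖ ≤ C * (1 + ‖y‖) ^ (-((n : ℝ) + 1)) := by
  refine ⟨2 ^ (n+1) * (Finset.Iic (n+1, 0)).sup (fun m => SchwartzMap.seminorm ℝ m.1 m.2) ρ, by positivity, fun y => ?_⟩
  have h := SchwartzMap.one_add_le_sup_seminorm_apply (𝕜 := ℝ) (m := (n+1, 0)) (k := n+1) (n := 0) le_rfl le_rfl ρ y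
  rw [norm_iteratedFDeriv_zero] at h
  have hp : 0 < (1 + ‖y‖) ^ (n+1) := by positivity
  have e : (1 + ‖y‖) ^ (-((n : ℝ) + 1)) = ((1 + ‖y‖) ^ (n+1))⁻¹ := by
    rw [Real.rpow_neg (by positivity)]
    congr 1
    exact_mod_cast Real.rpow_natCast (1 + ‖y‖) (n+1)
  rw [e, ← div_eq_mul_inv, le_div_iff₀ hp, mul_comm]
  exact h

def KC {n : ℕ} {F : Type} [NormedAddCommGroup F] [NormedSpace ℝ F] (a : ℝ) (ρ : Rn n → F)
    (x : Rn n) : F := ∫ z, (‖z‖ ^ (-a)) • ρ (x - z)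


lemma KC_int {n : ℕ} {a : ℝ} (hn : 1 ≤ n) (ha0 : 0 ≤ a) (ha : a < n)
    {F : Type} [NormedAddCommGroup F] [NormedSpace ℝ F] (ρ : SchwartzMap (Rn n) F) (x : Rn n) :
    Integrable (fun z => (‖z‖ ^ (-a)) • ρ (x - z)) := by
  obtain ⟨C, _, hC⟩ := sch_decay ρ
  exact ker_integrable hn ha0 ha (by
    exact (ρ.continuous.comp (by fun_prop)).aestronglyMeasurable) x (fun z => hC _)

lemma KC_bound {n : ℕ} {a : ℝ} (hn : 1 ≤ n) (ha0 : 0 ≤ a) (ha : a < n)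
    {F : Type} [NormedAddCommGroup F] [NormedSpace ℝ F] (ρ : SchwartzMap (Rn n) F) : ∃ B, ∀ x, ‖KC a ρ x‖ ≤ B := by
  obtain ⟨C, hC0, hC⟩ := sch_decay ρ
  refine ⟨C * (∫ z, kerB (n := n) a z) + ∫ z, ‖ρ z‖, fun x => ?_⟩
  have hi : Integrable (fun z => C * kerB a z + ‖ρ (x - z)‖) :=
    ((kerB_integrable hn ha).const_mul C).add ((ρ.integrable.comp_sub_left x).norm)
  calc ‖KC a ρ x‖ ≤ ∫ z, ‖(‖z‖ ^ (-a)) • ρ (x - z)‖ := norm_integral_le_integral_norm _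
    _ ≤ ∫ z, (C * kerB a z + ‖ρ (x - z)‖) := by
      refine integral_mono (KC_int hn ha0 ha ρ x).norm hi fun z => ?_
      simp only [norm_smul]
      rw [Real.norm_of_nonneg (by positivity : (0:ℝ) ≤ ‖z‖ ^ (-a))]
      have h1 : (1 + ‖x - z‖) ^ (-((n : ℝ) + 1)) ≤ 1 :=
        Real.rpow_le_one_of_one_le_of_nonpos (by linarith [norm_nonneg (x - z)]) (by linarith [Nat.cast_nonneg (α := ℝ) n])
      have h2 : ‖ρ (x - z)‖ ≤ C := (hC _).trans (by nlinarith)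
      have h3 := ker_le ha0 z
      have h4 := kerB_nonneg (a := a) z
      nlinarith [norm_nonneg (ρ (x - z)), mul_le_mul_of_nonneg_left h2 h4, mul_le_mul_of_nonneg_right h3 (norm_nonneg (ρ (x - z)))]
    _ = _ := by
      rw [integral_add ((kerB_integrable hn ha).const_mul C) ((ρ.integrable.comp_sub_left x).norm), integral_const_mul]
      congr 1
      exact integral_sub_left_eq_self (fun z => ‖ρ z‖) volume x

lemma KC_hasFDerivAt {n : ℕ} {a : ℝ} (hn : 1 ≤ n) (ha0 : 0 ≤ a) (ha : a < n)
    {F : Type} [NormedAddCommGroup F] [NormedSpace ℝ F] (ρ : SchwartzMap (Rn n) F) (x : Rn n) :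
    HasFDerivAt (KC a ρ) (KC a (SchwartzMap.fderivCLM ℝ (Rn n) F ρ) x) x := by
  set ρ' := SchwartzMap.fderivCLM ℝ (Rn n) F ρ
  obtain ⟨C, hC0, hC⟩ := sch_decay ρ'
  have hj : ∀ y ∈ Metric.ball x 1, ∀ z, (1 + ‖y - z‖) ^ (-((n : ℝ) + 1)) ≤
      2 ^ ((n:ℝ) + 1) * (1 + ‖x - z‖) ^ (-((n : ℝ) + 1)) := by
    intro y hy z
    have h1 : ‖x - z‖ ≤ 1 + ‖y - z‖ := by
      have : ‖x - z‖ ≤ ‖x - y‖ + ‖y - z‖ := norm_sub_le_norm_sub_add_norm_sub x y z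
      have h2 : ‖x - y‖ < 1 := by rw [← dist_eq_norm, dist_comm]; exact hy
      linarith
    have h2 : (1 + ‖x - z‖) / 2 ≤ 1 + ‖y - z‖ := by linarith [norm_nonneg (y - z)]
    calc (1 + ‖y - z‖) ^ (-((n : ℝ) + 1)) ≤ ((1 + ‖x - z‖) / 2) ^ (-((n : ℝ) + 1)) :=
          Real.rpow_le_rpow_of_nonpos (by positivity) h2 (by linarith [Nat.cast_nonneg (α := ℝ) n])
      _ = _ := by
        rw [Real.div_rpow (by positivity) (by norm_num), Real.rpow_neg (by norm_num : (0:ℝ) ≤ 2)]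
        field_simp
  refine hasFDerivAt_integral_of_dominated_of_fderiv_le (𝕜 := ℝ) (s := Metric.ball x 1)
    (F := fun y z => (‖z‖ ^ (-a)) • ρ (y - z)) (F' := fun y z => (‖z‖ ^ (-a)) • ρ' (y - z))
    (bound := fun z => ‖(‖z‖ ^ (-a)) • (C * 2 ^ ((n:ℝ) + 1) * (1 + ‖x - z‖) ^ (-((n : ℝ) + 1)))‖)
    (Metric.ball_mem_nhds x one_pos) ?_ (KC_int hn ha0 ha ρ x) ?_ ?_ ?_ ?_
  · exact Eventually.of_forall fun y => (KC_int hn ha0 ha ρ y).aestronglyMeasurable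
  · exact (KC_int hn ha0 ha ρ' x).aestronglyMeasurable
  · refine Eventually.of_forall fun z y hy => ?_
    rw [norm_smul, norm_smul]
    gcongr
    refine (hC _).trans ?_
    refine le_trans ?_ (le_abs_self _)
    rw [mul_assoc]
    exact mul_le_mul_of_nonneg_left (hj y hy z) hC0
  · refine Integrable.norm (ker_integrable hn ha0 ha (C := C * 2 ^ ((n:ℝ) + 1)) ?_ x fun z => ?_)
    · exact ((jap_int x).const_mul _).aestronglyMeasurable
    · rw [Real.norm_of_nonneg (by positivity)]
  · refine Eventually.of_forall fun z y hy => ?_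
    have h1 : HasFDerivAt (fun y => ρ (y - z)) (fderiv ℝ ρ (y - z)) y := by
      have := (ρ.hasFDerivAt (y - z)).comp y ((hasFDerivAt_id y).sub_const z)
      rw [ContinuousLinearMap.comp_id] at this; exact this
    exact h1.const_smul _

lemma KC_aux {n : ℕ} {a : ℝ} (hn : 1 ≤ n) (ha0 : 0 ≤ a) (ha : a < n) (k : ℕ) : ∀ (F : Type) [NormedAddCommGroup F] [NormedSpace ℝ F]
    (ρ : SchwartzMap (Rn n) F), ContDiff ℝ k (KC a ρ) ∧ ∃ B, ∀ x, ‖iteratedFDeriv ℝ k (KC a ρ) x‖ ≤ B := by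
  induction k with
  | zero =>
    intro F _ _ ρ
    refine ⟨?_, ?_⟩
    · rw [CharP.cast_eq_zero, contDiff_zero]
      exact continuous_iff_continuousAt.mpr fun x => (KC_hasFDerivAt hn ha0 ha ρ x).continuousAt
    · obtain ⟨B, hB⟩ := KC_bound hn ha0 ha ρ
      exact ⟨B, fun x => by rw [norm_iteratedFDeriv_zero]; exact hB x⟩
  | succ k ih =>
    intro F _ _ ρ
    have hf : fderiv ℝ (KC a ρ) = KC a (SchwartzMap.fderivCLM ℝ (Rn n) F ρ) :=
      funext fun x => (KC_hasFDerivAt hn ha0 ha ρ x).fderiv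
    obtain ⟨h1, B, hB⟩ := ih _ (SchwartzMap.fderivCLM ℝ (Rn n) F ρ)
    refine ⟨?_, B, fun x => ?_⟩
    · push_cast
      rw [contDiff_succ_iff_fderiv]
      refine ⟨fun x => (KC_hasFDerivAt hn ha0 ha ρ x).differentiableAt, by simp, ?_⟩
      rw [hf]; exact h1
    · rw [← norm_iteratedFDeriv_fderiv, hf]; exact hB x

lemma KC_tg {n : ℕ} {a : ℝ} (hn : 1 ≤ n) (ha0 : 0 ≤ a) (ha : a < n)
    {F : Type} [NormedAddCommGroup F] [NormedSpace ℝ F] (ρ : SchwartzMap (Rn n) F) : (KC a ρ).HasTemperateGrowth := by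
  refine ⟨contDiff_infty.mpr fun k => (KC_aux hn ha0 ha k F ρ).1, fun k => ?_⟩
  obtain ⟨B, hB⟩ := (KC_aux hn ha0 ha k F ρ).2
  exact ⟨0, B, fun x => by simpa using hB x⟩

end

section
/-! ### Hardy inequality -/

lemma euler_aux {n : ℕ} {a : ℝ} (hn : 1 ≤ n) (ha0 : 0 ≤ a) (ha : a < n) (ρ : SR n) (x : Rn n) :
    KC a (⇑(∑ j, (Xop j (Dop j ρ) - ((x j : ℝ) : ℂ) • Dop j ρ))) x = ((a - n : ℝ) : ℂ) * KC a (⇑ρ) x := by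
  set ζ : SR n := ∑ j, (Xop j (Dop j ρ) - ((x j : ℝ) : ℂ) • Dop j ρ) with hζ
  have hζa : ∀ y, ζ y = fderiv ℝ ρ y (y - x) := by
    intro y
    have : y - x = ∑ j, (y j - x j) • ej j := by
      ext k
      simp [Finset.sum_apply, Pi.single_apply]
    rw [hζ, sum_ap]
    conv_rhs => rw [this, map_sum]
    refine Finset.sum_congr rfl fun j _ => ?_
    rw [sub_ap, Xop_apply, smul_ap, map_smul, Dop_apply]
    rw [Complex.real_smul]; push_cast; ring
  obtain ⟨C, hC0, hC⟩ := sch_decay ζ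
  set I : ℝ → ℂ := fun r => ∫ z, (‖z‖ ^ (-a)) • ρ (x - r • z) with hI
  have hsc : ∀ r : ℝ, 0 < r → I r = ((r ^ (a - n) : ℝ) : ℂ) * KC a (⇑ρ) x := by
    intro r hr
    have h := Measure.integral_comp_smul (volume : Measure (Rn n)) (fun z => (‖z‖ ^ (-a)) • ρ (x - z)) r
    have h2 : ∀ z : Rn n, (‖r • z‖ ^ (-a)) • ρ (x - r • z) = (r ^ (-a)) • ((‖z‖ ^ (-a)) • ρ (x - r • z)) := by
      intro z
      rw [norm_smul, Real.norm_of_nonneg hr.le, Real.mul_rpow hr.le (norm_nonneg _), mul_smul]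
    simp only [h2] at h
    rw [integral_smul] at h
    have h3 : I r = (r ^ a) • ((r ^ (-a)) • I r) := by
      rw [smul_smul, ← Real.rpow_add hr]; simp
    rw [h3]
    simp only [hI, KC]
    rw [h, smul_smul, Complex.real_smul]
    congr 2
    rw [Real.rpow_sub hr, abs_of_pos (by positivity)]
    simp [div_eq_mul_inv]
  have hd : HasDerivAt I (KC a (⇑ζ) x) 1 := by
    have key := hasDerivAt_integral_of_dominated_loc_of_deriv_le (𝕜 := ℝ) (μ := (volume : Measure (Rn n)))
      (F := fun r z => (‖z‖ ^ (-a)) • ρ (x - r • z))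
      (F' := fun r z => (‖z‖ ^ (-a)) • ((r⁻¹ : ℝ) • ζ (x - r • z))) (x₀ := 1) (s := Metric.ball 1 (1/2))
      (bound := fun z => (‖z‖ ^ (-a)) • (2 * C * (2 * (1 + ‖x‖)) ^ ((n:ℝ) + 1) * (1 + ‖(0:Rn n) - z‖) ^ (-((n : ℝ) + 1))))
      (Metric.ball_mem_nhds _ (by norm_num)) ?_ ?_ ?_ ?_ ?_ ?_
    · have h2 := key.2
      simpa [hI, KC] using h2
    · refine Eventually.of_forall fun r => ?_
      exact (ker_meas a).aestronglyMeasurable.smul (ρ.continuous.comp (by fun_prop)).aestronglyMeasurable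
    · simpa using KC_int hn ha0 ha ρ x
    · exact (ker_meas a).aestronglyMeasurable.smul
        (Continuous.aestronglyMeasurable (f := fun z : Rn n => (1:ℝ)⁻¹ • ζ (x - (1:ℝ) • z)) (by
          have := ζ.continuous
          fun_prop))
    · refine Eventually.of_forall fun z r hr => ?_
      rw [Metric.mem_ball, Real.dist_eq, abs_lt] at hr
      have hr0 : (1/2:ℝ) ≤ r := by linarith
      have hr1 : r⁻¹ ≤ 2 := by
        rw [inv_le_comm₀ (by linarith) (by norm_num)]; linarith
      rw [norm_smul, norm_smul, Real.norm_of_nonneg (by positivity), smul_eq_mul,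
        Real.norm_of_nonneg (by positivity : (0:ℝ) ≤ r⁻¹)]
      refine mul_le_mul_of_nonneg_left ?_ (by positivity)
      have h1 : (1 + ‖(0:Rn n) - z‖) / (2 * (1 + ‖x‖)) ≤ 1 + ‖x - r • z‖ := by
        rw [div_le_iff₀ (by positivity), zero_sub, norm_neg]
        have h2 : ‖r • z‖ ≤ ‖x‖ + ‖x - r • z‖ := by
          have := norm_sub_le x (x - r • z)
          simpa using this
        rw [norm_smul, Real.norm_of_nonneg (by linarith)] at h2
        nlinarith [norm_nonneg x, norm_nonneg (x - r • z), norm_nonneg z, mul_nonneg (norm_nonneg x) (norm_nonneg (x - r • z)),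
          mul_le_mul_of_nonneg_right hr0 (norm_nonneg z)]
      have h3 : ‖ζ (x - r • z)‖ ≤ C * ((2 * (1 + ‖x‖)) ^ ((n:ℝ) + 1) * (1 + ‖(0:Rn n) - z‖) ^ (-((n : ℝ) + 1))) := by
        refine (hC _).trans (mul_le_mul_of_nonneg_left ?_ hC0)
        calc _ ≤ ((1 + ‖(0:Rn n) - z‖) / (2 * (1 + ‖x‖))) ^ (-((n : ℝ) + 1)) :=
              Real.rpow_le_rpow_of_nonpos (by positivity) h1 (by linarith [Nat.cast_nonneg (α := ℝ) n])
          _ = _ := by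
            rw [Real.div_rpow (by positivity) (by positivity), Real.rpow_neg (by positivity : (0:ℝ) ≤ 2 * (1 + ‖x‖))]
            field_simp
      calc r⁻¹ * ‖ζ (x - r • z)‖ ≤ 2 * (C * ((2 * (1 + ‖x‖)) ^ ((n:ℝ) + 1) * (1 + ‖(0:Rn n) - z‖) ^ (-((n : ℝ) + 1)))) := by
            gcongr
        _ = _ := by ring
    · refine ker_integrable hn ha0 ha (C := 2 * C * (2 * (1 + ‖x‖)) ^ ((n:ℝ) + 1)) ?_ 0 fun z => ?_
      · exact ((jap_int 0).const_mul _).aestronglyMeasurable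
      · rw [Real.norm_of_nonneg (by positivity)]
    · refine Eventually.of_forall fun z r hr => ?_
      rw [Metric.mem_ball, Real.dist_eq, abs_lt] at hr
      have hr0 : r ≠ 0 := by intro h; subst h; norm_num at hr
      have h1 : HasDerivAt (fun r : ℝ => x - r • z) (-z) r := by
        simpa using ((hasDerivAt_id r).smul_const z).const_sub x
      have h2 := (SR_hasFDerivAt ρ (x - r • z)).comp_hasDerivAt r h1
      refine HasDerivAt.fun_const_smul _ ?_
      have e : r⁻¹ • ζ (x - r • z) = fderiv ℝ ρ (x - r • z) (-z) := by
        rw [hζa, sub_sub_cancel_left, ← smul_neg, map_smul, smul_smul, inv_mul_cancel₀ hr0, one_smul]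
      rw [e]; exact h2
  have hd2 : HasDerivAt I (((a - n : ℝ) : ℂ) * KC a (⇑ρ) x) 1 := by
    have h1 : HasDerivAt (fun r : ℝ => ((r ^ (a - n) : ℝ) : ℂ)) ((a - n : ℝ) : ℂ) 1 := by
      have := (Real.hasDerivAt_rpow_const (x := 1) (p := a - n) (Or.inl one_ne_zero)).ofReal_comp
      simpa using this
    refine (h1.mul_const _).congr_of_eventuallyEq ?_
    filter_upwards [lt_mem_nhds (zero_lt_one' ℝ)] with r hr using hsc r hr
  exact hd.unique hd2


class Par (n : ℕ) (γ : ℝ) : Prop where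
  hn : 2 ≤ n
  h0 : 0 < γ
  h1 : γ < 1

def prS {n : ℕ} (φ ψ : SR n) : SR n := mulS (⇑φ) (cj ψ)

lemma prS_apply {n : ℕ} (φ ψ : SR n) (x : Rn n) : prS φ ψ x = φ x * conj (ψ x) := by
  rw [prS, mulS_apply φ.hasTemperateGrowth, cj_apply]

lemma Dop_prS {n : ℕ} (j : Fin n) (φ ψ : SR n) : Dop j (prS φ ψ) = prS (Dop j φ) ψ + prS φ (Dop j ψ) := by
  ext x
  rw [add_ap, prS_apply, prS_apply, Dop_apply]
  have h1 := (SR_hasFDerivAt φ x).mul (SR_hasFDerivAt (cj ψ) x)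
  have h2 : (⇑(prS φ ψ) : Rn n → ℂ) = fun y => φ y * cj ψ y := by
    ext y; rw [prS_apply, cj_apply]
  have h3 : fderiv ℝ (⇑(prS φ ψ)) x = φ x • fderiv ℝ (⇑(cj ψ)) x + cj ψ x • fderiv ℝ (⇑φ) x := by
    rw [h2]; exact h1.fderiv
  rw [h3]
  have h4 := Dop_cj j ψ
  have h5 : fderiv ℝ (⇑(cj ψ)) x (ej j) = conj (Dop j ψ x) := by
    rw [← Dop_apply, h4, cj_apply]
  simp only [ContinuousLinearMap.add_apply, ContinuousLinearMap.smul_apply, smul_eq_mul, h5, cj_apply, Dop_apply]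
  ring

lemma sq_integrable {n : ℕ} (φ : SR n) : Integrable (fun x => ‖φ x‖ ^ 2) := by
  have := (prS φ φ).integrable (μ := volume)
  have h := this.norm
  refine h.congr (Eventually.of_forall fun x => ?_)
  simp [prS_apply, sq]

lemma prS_self {n : ℕ} (φ : SR n) (x : Rn n) : prS φ φ x = ((‖φ x‖ ^ 2 : ℝ) : ℂ) := by
  rw [prS_apply, Complex.mul_conj, Complex.normSq_eq_norm_sq]

/-- singular square integral -/
lemma hsq_int {n : ℕ} {a : ℝ} (hn : 1 ≤ n) (ha0 : 0 ≤ a) (ha : a < n) (φ : SR n) (x : Rn n) :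
    Integrable (fun z => ‖z‖ ^ (-a) * ‖φ (x - z)‖ ^ 2) := by
  refine (KC_int hn ha0 ha (prS φ φ) x).norm.congr (Eventually.of_forall fun z => ?_)
  simp only [norm_smul, prS_self]
  rw [Real.norm_of_nonneg (by positivity : (0:ℝ) ≤ ‖z‖ ^ (-a)), Complex.norm_real, Real.norm_of_nonneg (by positivity)]

lemma KC_sq {n : ℕ} {a : ℝ} (φ : SR n) (x : Rn n) :
    KC a (⇑(prS φ φ)) x = ((∫ z, ‖z‖ ^ (-a) * ‖φ (x - z)‖ ^ 2 : ℝ) : ℂ) := by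
  rw [KC, ← integral_complex_ofReal]
  refine integral_congr_ae (Eventually.of_forall fun z => ?_)
  simp only [prS_self, Complex.real_smul]; push_cast; ring

lemma sq_int_eq {n : ℕ} (φ : SR n) (x : Rn n) : ∫ z, ‖φ (x - z)‖ ^ 2 = nrm φ ^ 2 := by
  rw [nrm_sq]; exact integral_sub_left_eq_self (fun z => ‖φ z‖ ^ 2) volume x

lemma sum_sq_le_h1 {n : ℕ} (φ : SR n) : ∑ j, nrm (Dop j φ) ^ 2 ≤ n * h1 φ ^ 2 := by
  calc ∑ j, nrm (Dop j φ) ^ 2 ≤ ∑ _j : Fin n, h1 φ ^ 2 :=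
        Finset.sum_le_sum fun j _ => pow_le_pow_left₀ (nrm_nonneg _) (nrmD_le_h1 j φ) 2
    _ = _ := by simp

lemma hardy1 {n : ℕ} {a : ℝ} (hn : 2 ≤ n) (ha1 : 1 ≤ a) (ha : a < 2) :
    ∃ C, 0 ≤ C ∧ ∀ (φ : SR n) (x : Rn n), ∫ z, ‖z‖ ^ (-a) * ‖φ (x - z)‖ ^ 2 ≤ C * h1 φ ^ 2 := by
  have hn2 : (2:ℝ) ≤ n := by exact_mod_cast hn
  have hn1 : 1 ≤ n := by omega
  have ha0 : 0 ≤ a := by linarith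
  have han : a < n := by linarith
  set η : ℝ := (n - a) / (2 * n) with hη
  have hη0 : 0 < η := by apply div_pos <;> linarith
  refine ⟨2 / (n - a) * ((η⁻¹ + 1) * n + n), by have : 0 < n - a := by linarith
                                                positivity, fun φ x => ?_⟩
  set H := ∫ z, ‖z‖ ^ (-a) * ‖φ (x - z)‖ ^ 2 with hH
  have hH0 : 0 ≤ H := integral_nonneg fun z => by positivity
  have e := euler_aux hn1 ha0 han (prS φ φ) x
  set ζ : SR n := ∑ j, (Xop j (Dop j (prS φ φ)) - ((x j : ℝ) : ℂ) • Dop j (prS φ φ)) with hζ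
  rw [KC_sq] at e
  have e2 : (n - a) * H = ‖KC a (⇑ζ) x‖ := by
    rw [e, norm_mul, Complex.norm_real, Complex.norm_real, ← hH, Real.norm_of_nonneg hH0, Real.norm_eq_abs,
      abs_sub_comm, abs_of_pos (by linarith)]
  have hpt : ∀ z, ‖(‖z‖ ^ (-a)) • ζ (x - z)‖ ≤ (n * η) * (‖z‖ ^ (-a) * ‖φ (x - z)‖ ^ 2)
      + ((η⁻¹ + 1) * ∑ j, ‖Dop j φ (x - z)‖ ^ 2 + n * ‖φ (x - z)‖ ^ 2) := by
    intro z
    by_cases hz : z = 0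
    · subst hz
      rw [norm_zero, Real.zero_rpow (by linarith), zero_smul, norm_zero]
      positivity
    have hz0 : 0 < ‖z‖ := norm_pos_iff.mpr hz
    have h1 : ‖z‖ ^ (-a) * ‖z‖ ≤ ‖z‖ ^ (-a/2) + 1 := by
      have e3 : ‖z‖ ^ (-a) * ‖z‖ = ‖z‖ ^ (1 - a) := by
        rw [sub_eq_neg_add, Real.rpow_add hz0, Real.rpow_one]
      rw [e3]
      rcases le_total ‖z‖ 1 with h | h
      · have := Real.rpow_le_rpow_of_exponent_ge hz0 h (show -a/2 ≤ 1 - a by linarith)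
        linarith
      · have := Real.rpow_le_one_of_one_le_of_nonpos h (show 1 - a ≤ 0 by linarith)
        have h3 : 0 ≤ ‖z‖ ^ (-a/2) := by positivity
        linarith
    have hsq : (‖z‖ ^ (-a/2)) ^ 2 = ‖z‖ ^ (-a) := by
      rw [← Real.rpow_natCast, ← Real.rpow_mul hz0.le]; congr 1; push_cast; ring
    have hζb : ‖ζ (x - z)‖ ≤ ∑ j, ‖z‖ * (2 * ‖φ (x - z)‖ * ‖Dop j φ (x - z)‖) := by
      rw [hζ, sum_ap]
      refine (norm_sum_le _ _).trans (Finset.sum_le_sum fun j _ => ?_)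
      rw [sub_ap, Xop_apply, smul_ap, ← sub_mul, norm_mul, Dop_prS, add_ap, prS_apply, prS_apply]
      refine mul_le_mul ?_ ?_ (norm_nonneg _) (norm_nonneg _)
      · rw [← Complex.ofReal_sub, Complex.norm_real]
        have := PiLp.norm_apply_le z j
        simpa using this
      · refine (norm_add_le _ _).trans ?_
        simp only [norm_mul, RCLike.norm_conj]
        nlinarith
    rw [norm_smul, Real.norm_of_nonneg (by positivity)]
    set q := ‖z‖ ^ (-a/2)
    have hq : 0 ≤ q := by positivity
    set F := ‖φ (x - z)‖
    have hF : 0 ≤ F := norm_nonneg _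
    calc ‖z‖ ^ (-a) * ‖ζ (x - z)‖ ≤ ‖z‖ ^ (-a) * ∑ j, ‖z‖ * (2 * F * ‖Dop j φ (x - z)‖) := by gcongr
      _ = ∑ j, (‖z‖ ^ (-a) * ‖z‖) * (2 * F * ‖Dop j φ (x - z)‖) := by
        rw [Finset.mul_sum]; exact Finset.sum_congr rfl fun j _ => by ring
      _ ≤ ∑ j, (η * (q ^ 2 * F ^ 2) + (η⁻¹ + 1) * ‖Dop j φ (x - z)‖ ^ 2 + F ^ 2) := by
        refine Finset.sum_le_sum fun j _ => ?_
        set G := ‖Dop j φ (x - z)‖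
        have hG : 0 ≤ G := norm_nonneg _
        have i1 : (‖z‖ ^ (-a) * ‖z‖) * (2 * F * G) ≤ (q + 1) * (2 * F * G) :=
          mul_le_mul_of_nonneg_right h1 (by positivity)
        have i2 : 2 * (q * F) * G ≤ η * (q * F) ^ 2 + η⁻¹ * G ^ 2 := by
          have := mul_nonneg hη0.le (sq_nonneg (q * F - η⁻¹ * G))
          have e5 : η * (q * F - η⁻¹ * G) ^ 2 = η * (q * F) ^ 2 - 2 * (q * F) * G * (η * η⁻¹) + η⁻¹ * G ^ 2 * (η * η⁻¹) := by ring
          rw [mul_inv_cancel₀ hη0.ne'] at e5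
          linarith
        nlinarith [sq_nonneg (F - G)]
      _ = _ := by
        rw [Finset.sum_add_distrib, Finset.sum_add_distrib,
          ← Finset.mul_sum (f := fun j => ‖Dop j φ (x - z)‖ ^ 2), hsq]
        simp only [Finset.sum_const, Finset.card_univ, Fintype.card_fin, nsmul_eq_mul]; ring
  have iI := hsq_int hn1 ha0 han φ x
  have iF : Integrable (fun z => ‖φ (x - z)‖ ^ 2) := (sq_integrable φ).comp_sub_left x
  have iD : ∀ j, Integrable (fun z => ‖Dop j φ (x - z)‖ ^ 2) := fun j => (sq_integrable (Dop j φ)).comp_sub_left x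
  have iDs : Integrable (fun z => ∑ j, ‖Dop j φ (x - z)‖ ^ 2) := integrable_finsetSum _ fun j _ => iD j
  have e4 : (n - a) * H ≤ (n * η) * H + ((η⁻¹ + 1) * ∑ j, nrm (Dop j φ) ^ 2 + n * nrm φ ^ 2) := by
    rw [e2]
    calc ‖KC a (⇑ζ) x‖ ≤ ∫ z, ‖(‖z‖ ^ (-a)) • ζ (x - z)‖ := norm_integral_le_integral_norm _
      _ ≤ ∫ z, ((n * η) * (‖z‖ ^ (-a) * ‖φ (x - z)‖ ^ 2)
      + ((η⁻¹ + 1) * ∑ j, ‖Dop j φ (x - z)‖ ^ 2 + n * ‖φ (x - z)‖ ^ 2)) :=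
        integral_mono (KC_int hn1 ha0 han ζ x).norm ((iI.const_mul _).add ((iDs.const_mul _).add (iF.const_mul _))) hpt
      _ = _ := by
        have i3 : Integrable (fun z => (η⁻¹ + 1) * ∑ j, ‖Dop j φ (x - z)‖ ^ 2 + n * ‖φ (x - z)‖ ^ 2) :=
          (iDs.const_mul _).add (iF.const_mul _)
        rw [integral_add (iI.const_mul _) i3,
          integral_add (iDs.const_mul _) (iF.const_mul _), integral_const_mul, integral_const_mul, integral_const_mul,
          integral_finsetSum _ fun j _ => iD j, sq_int_eq]
        simp only [sq_int_eq]; rfl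
  have e5 : (n:ℝ) * η = (n - a) / 2 := by rw [hη]; field_simp
  rw [e5] at e4
  have e6 := sum_sq_le_h1 φ
  have e7 : nrm φ ^ 2 ≤ h1 φ ^ 2 := pow_le_pow_left₀ (nrm_nonneg _) (nrm_le_h1 φ) 2
  have hna : 0 < n - a := by linarith
  have e8 : (n - a) / 2 * H ≤ ((η⁻¹ + 1) * n + n) * h1 φ ^ 2 := by
    have := mul_le_mul_of_nonneg_left e6 (by positivity : (0:ℝ) ≤ η⁻¹ + 1)
    have := mul_le_mul_of_nonneg_left e7 (by positivity : (0:ℝ) ≤ (n:ℝ))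
    nlinarith
  calc H = 2 / (n - a) * ((n - a) / 2 * H) := by field_simp
    _ ≤ 2 / (n - a) * (((η⁻¹ + 1) * n + n) * h1 φ ^ 2) := by gcongr
    _ = _ := by ring

lemma hardy (n : ℕ) (γ : ℝ) [P : Par n γ] :
    ∃ C, 0 ≤ C ∧ ∀ (φ : SR n) (x : Rn n), ∫ z, ‖z‖ ^ (-(2*γ)) * ‖φ (x - z)‖ ^ 2 ≤ C * h1 φ ^ 2 := by
  have hn := P.hn
  have h0 := P.h0
  have hγ1 := P.h1
  have hn2 : (2:ℝ) ≤ n := by exact_mod_cast hn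
  set a := 2 * max γ (1/2) with ha
  have ha1 : 1 ≤ a := by have := le_max_right γ (1/2); linarith
  have ha2 : a < 2 := by
    have : max γ (1/2) < 1 := max_lt hγ1 (by norm_num)
    linarith
  have ha3 : 2 * γ ≤ a := by have := le_max_left γ (1/2); linarith
  obtain ⟨C, hC0, hC⟩ := hardy1 hn ha1 ha2
  refine ⟨C + 1, by linarith, fun φ x => ?_⟩
  have iF : Integrable (fun z => ‖φ (x - z)‖ ^ 2) := (sq_integrable φ).comp_sub_left x
  have iA := hsq_int (a := a) (by omega) (by linarith) (by linarith) φ x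
  calc _ ≤ ∫ z, (‖z‖ ^ (-a) * ‖φ (x - z)‖ ^ 2 + ‖φ (x - z)‖ ^ 2) := by
        refine integral_mono (hsq_int (by omega) (by linarith) (by linarith) φ x) (iA.add iF) fun z => ?_
        have : ‖z‖ ^ (-(2*γ)) ≤ ‖z‖ ^ (-a) + 1 := by
          rcases eq_or_lt_of_le (norm_nonneg z) with h | h
          · rw [← h, Real.zero_rpow (by linarith), Real.zero_rpow (by linarith)]; norm_num
          rcases le_total ‖z‖ 1 with h' | h'
          · have := Real.rpow_le_rpow_of_exponent_ge h h' (show -a ≤ -(2*γ) by linarith)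
            linarith
          · have := Real.rpow_le_one_of_one_le_of_nonpos h' (show -(2*γ) ≤ 0 by linarith)
            have h3 : 0 ≤ ‖z‖ ^ (-a) := by positivity
            linarith
        have := mul_le_mul_of_nonneg_right this (sq_nonneg ‖φ (x - z)‖)
        simp only; linarith
    _ = (∫ z, ‖z‖ ^ (-a) * ‖φ (x - z)‖ ^ 2) + nrm φ ^ 2 := by rw [integral_add iA iF, sq_int_eq]
    _ ≤ C * h1 φ ^ 2 + h1 φ ^ 2 := add_le_add (hC φ x) (pow_le_pow_left₀ (nrm_nonneg _) (nrm_le_h1 φ) 2)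
    _ = _ := by ring

end

section
/-! ### The bilinear potential and the trilinear nonlinearity -/

lemma Par.n1 {n : ℕ} {γ : ℝ} (P : Par n γ) : 1 ≤ n := by have := P.hn; omega
lemma Par.lt {n : ℕ} {γ : ℝ} (P : Par n γ) : γ < n := by
  have := P.hn; have := P.h1
  have : (2:ℝ) ≤ n := by exact_mod_cast P.hn
  linarith

def VV {n : ℕ} (γ : ℝ) (φ ψ : SR n) : Rn n → ℂ := KC γ (⇑(prS φ ψ))

lemma VV_tg {n : ℕ} (γ : ℝ) [P : Par n γ] (φ ψ : SR n) : (VV γ φ ψ).HasTemperateGrowth :=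
  KC_tg P.n1 P.h0.le P.lt _

def TT {n : ℕ} (γ : ℝ) (φ ψ χ : SR n) : SR n := mulS (VV γ φ ψ) χ

lemma TT_apply {n : ℕ} (γ : ℝ) [P : Par n γ] (φ ψ χ : SR n) (x : Rn n) :
    TT γ φ ψ χ x = VV γ φ ψ x * χ x := mulS_apply (VV_tg γ φ ψ) χ x

lemma KC_eq {n : ℕ} (a : ℝ) (ρ : Rn n → ℂ) (x : Rn n) :
    KC a ρ x = ∫ y, ((‖x - y‖ ^ (-a) : ℝ) : ℂ) * ρ y := by
  rw [KC, ← integral_sub_left_eq_self _ volume x]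
  simp [Complex.real_smul]

lemma hartree_eq {n : ℕ} (γ : ℝ) (φ : SR n) (x : Rn n) :
    ((hartree γ (⇑φ) x : ℝ) : ℂ) = VV γ φ φ x := by
  rw [VV, KC_eq, hartree, conv, ← integral_complex_ofReal]
  refine integral_congr_ae (Eventually.of_forall fun y => ?_)
  simp only [prS_apply, Complex.mul_conj]; push_cast; ring

lemma prS_add_left {n : ℕ} (φ φ' ψ : SR n) : prS (φ + φ') ψ = prS φ ψ + prS φ' ψ := by
  ext x; simp only [add_ap, prS_apply]; ring
lemma prS_add_right {n : ℕ} (φ ψ ψ' : SR n) : prS φ (ψ + ψ') = prS φ ψ + prS φ ψ' := by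
  ext x; simp only [add_ap, prS_apply, map_add]; ring
lemma prS_smul_left {n : ℕ} (c : ℂ) (φ ψ : SR n) : prS (c • φ) ψ = c • prS φ ψ := by
  ext x; simp only [smul_ap, prS_apply]; ring
lemma prS_smul_right {n : ℕ} (c : ℂ) (φ ψ : SR n) : prS φ (c • ψ) = conj c • prS φ ψ := by
  ext x; simp only [smul_ap, prS_apply, map_mul]; ring

lemma KC_add {n : ℕ} {a : ℝ} (hn : 1 ≤ n) (ha0 : 0 ≤ a) (ha : a < n) (ρ σ : SR n) (x : Rn n) :
    KC a (⇑(ρ + σ)) x = KC a (⇑ρ) x + KC a (⇑σ) x := by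
  rw [KC, KC, KC, ← integral_add (KC_int hn ha0 ha ρ x) (KC_int hn ha0 ha σ x)]
  simp only [add_ap, smul_add]

lemma KC_smul {n : ℕ} {a : ℝ} (c : ℂ) (ρ : SR n) (x : Rn n) :
    KC a (⇑(c • ρ)) x = c * KC a (⇑ρ) x := by
  rw [KC, KC, ← integral_const_mul]
  congr 1; ext z
  rw [smul_ap, Complex.real_smul, Complex.real_smul]; ring

section
variable {n : ℕ} {γ : ℝ} [P : Par n γ]

lemma VV_add_left (φ φ' ψ : SR n) (x : Rn n) : VV γ (φ + φ') ψ x = VV γ φ ψ x + VV γ φ' ψ x := by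
  rw [VV, VV, VV, prS_add_left, KC_add P.n1 P.h0.le P.lt]
lemma VV_add_right (φ ψ ψ' : SR n) (x : Rn n) : VV γ φ (ψ + ψ') x = VV γ φ ψ x + VV γ φ ψ' x := by
  rw [VV, VV, VV, prS_add_right, KC_add P.n1 P.h0.le P.lt]

lemma VV_smul_left (c : ℂ) (φ ψ : SR n) (x : Rn n) : VV γ (c • φ) ψ x = c * VV γ φ ψ x := by
  rw [VV, VV, prS_smul_left, KC_smul]

lemma VV_smul_right (c : ℂ) (φ ψ : SR n) (x : Rn n) : VV γ φ (c • ψ) x = conj c * VV γ φ ψ x := by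
  rw [VV, VV, prS_smul_right, KC_smul]

lemma VV_conj (φ ψ : SR n) (x : Rn n) : conj (VV γ φ ψ x) = VV γ ψ φ x := by
  rw [VV, VV, KC, KC, ← integral_conj]
  congr 1; ext z
  simp only [Complex.real_smul, prS_apply, map_mul, Complex.conj_ofReal, Complex.conj_conj]; ring

lemma TT_add1 (φ φ' ψ χ : SR n) : TT γ (φ + φ') ψ χ = TT γ φ ψ χ + TT γ φ' ψ χ := by
  ext x; simp only [add_ap, TT_apply, VV_add_left]; ring
lemma TT_add2 (φ ψ ψ' χ : SR n) : TT γ φ (ψ + ψ') χ = TT γ φ ψ χ + TT γ φ ψ' χ := by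
  ext x; simp only [add_ap, TT_apply, VV_add_right]; ring

lemma TT_add3 (φ ψ χ χ' : SR n) : TT γ φ ψ (χ + χ') = TT γ φ ψ χ + TT γ φ ψ χ' := by
  rw [TT, map_add]; rfl
lemma TT_smul1 (c : ℂ) (φ ψ χ : SR n) : TT γ (c • φ) ψ χ = c • TT γ φ ψ χ := by
  ext x; simp only [smul_ap, TT_apply, VV_smul_left]; ring
lemma TT_smul2 (c : ℂ) (φ ψ χ : SR n) : TT γ φ (c • ψ) χ = conj c • TT γ φ ψ χ := by
  ext x; simp only [smul_ap, TT_apply, VV_smul_right]; ring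

lemma TT_smul3 (c : ℂ) (φ ψ χ : SR n) : TT γ φ ψ (c • χ) = c • TT γ φ ψ χ := by
  rw [TT, map_smul]; rfl
lemma TT_sub1 (φ φ' ψ χ : SR n) : TT γ (φ - φ') ψ χ = TT γ φ ψ χ - TT γ φ' ψ χ := by
  rw [eq_sub_iff_add_eq, ← TT_add1, sub_add_cancel]
lemma TT_sub2 (φ ψ ψ' χ : SR n) : TT γ φ (ψ - ψ') χ = TT γ φ ψ χ - TT γ φ ψ' χ := by
  rw [eq_sub_iff_add_eq, ← TT_add2, sub_add_cancel]

lemma TT_sub3 (φ ψ χ χ' : SR n) : TT γ φ ψ (χ - χ') = TT γ φ ψ χ - TT γ φ ψ χ' := by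
  rw [eq_sub_iff_add_eq, ← TT_add3, sub_add_cancel]

/-- telescoping -/
lemma TT_diff (a b c a' b' c' : SR n) : TT γ a b c - TT γ a' b' c' =
    TT γ (a - a') b c + TT γ a' (b - b') c + TT γ a' b' (c - c') := by
  rw [TT_sub1, TT_sub2, TT_sub3]; abel
end

lemma cs_int {n : ℕ} {f g : Rn n → ℝ} (hf0 : ∀ x, 0 ≤ f x) (hg0 : ∀ x, 0 ≤ g x)
    (mf : AEStronglyMeasurable f volume) (mg : AEStronglyMeasurable g volume)
    (hf : Integrable (fun x => f x ^ 2)) (hg : Integrable (fun x => g x ^ 2)) :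
    ∫ x, f x * g x ≤ √(∫ x, f x ^ 2) * √(∫ x, g x ^ 2) := by
  have h := integral_mul_le_Lp_mul_Lq_of_nonneg (μ := (volume : Measure (Rn n))) (p := 2) (q := 2)
    Real.HolderConjugate.two_two (Eventually.of_forall hf0) (Eventually.of_forall hg0)
    (by simpa using (memLp_two_iff_integrable_sq mf).mpr hf) (by simpa using (memLp_two_iff_integrable_sq mg).mpr hg)
  rw [Real.sqrt_eq_rpow, Real.sqrt_eq_rpow]
  simpa using h

lemma VV_bound (n : ℕ) (γ : ℝ) [P : Par n γ] : ∃ C, 0 ≤ C ∧ ∀ (φ ψ : SR n) (x : Rn n),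
    ‖VV γ φ ψ x‖ ≤ C * (h1 φ * nrm ψ) := by
  obtain ⟨C, hC0, hC⟩ := hardy n γ
  have hn2 : (2:ℝ) ≤ n := by exact_mod_cast P.hn
  refine ⟨√C, by positivity, fun φ ψ x => ?_⟩
  have e : ∀ z : Rn n, (‖z‖ ^ (-γ) * ‖φ (x - z)‖) ^ 2 = ‖z‖ ^ (-(2*γ)) * ‖φ (x - z)‖ ^ 2 := by
    intro z
    rw [mul_pow, ← Real.rpow_natCast (‖z‖ ^ (-γ)), ← Real.rpow_mul (norm_nonneg _)]
    congr 2; push_cast; ring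
  have hm : ∀ χ : SR n, AEStronglyMeasurable (fun z => ‖χ (x - z)‖) volume := fun χ =>
    (χ.continuous.comp (f := fun z : Rn n => x - z) (by fun_prop)).norm.aestronglyMeasurable
  calc ‖VV γ φ ψ x‖ ≤ ∫ z, ‖(‖z‖ ^ (-γ)) • prS φ ψ (x - z)‖ := norm_integral_le_integral_norm _
    _ = ∫ z, (‖z‖ ^ (-γ) * ‖φ (x - z)‖) * ‖ψ (x - z)‖ := by
      congr 1; ext z
      rw [norm_smul, Real.norm_of_nonneg (by positivity), prS_apply, norm_mul, RCLike.norm_conj, mul_assoc]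
    _ ≤ √(∫ z, (‖z‖ ^ (-γ) * ‖φ (x - z)‖) ^ 2) * √(∫ z, ‖ψ (x - z)‖ ^ 2) := by
      refine cs_int (fun z => by positivity) (fun z => norm_nonneg _)
        ((ker_meas γ).aestronglyMeasurable.mul (hm φ)) (hm ψ) ?_ ((sq_integrable ψ).comp_sub_left x)
      simp only [e]
      exact hsq_int P.n1 (by linarith [P.h0]) (by linarith [P.h1]) φ x
    _ ≤ √(C * h1 φ ^ 2) * √(nrm ψ ^ 2) := by
      rw [sq_int_eq]
      simp only [e]
      gcongr
      exact hC φ x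
    _ = _ := by
      rw [Real.sqrt_mul hC0, Real.sqrt_sq (h1_nonneg _), Real.sqrt_sq (nrm_nonneg _), mul_assoc]

/-- the constant in the potential bound -/
def CV (n : ℕ) (γ : ℝ) [P : Par n γ] : ℝ := Classical.choose (VV_bound n γ)

lemma CV_nonneg (n : ℕ) (γ : ℝ) [P : Par n γ] : 0 ≤ CV n γ := (Classical.choose_spec (VV_bound n γ)).1
lemma VV_le1 {n : ℕ} {γ : ℝ} [P : Par n γ] (φ ψ : SR n) (x : Rn n) : ‖VV γ φ ψ x‖ ≤ CV n γ * (h1 φ * nrm ψ) :=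
  (Classical.choose_spec (VV_bound n γ)).2 φ ψ x
lemma VV_le2 {n : ℕ} {γ : ℝ} [P : Par n γ] (φ ψ : SR n) (x : Rn n) : ‖VV γ φ ψ x‖ ≤ CV n γ * (nrm φ * h1 ψ) := by
  rw [← VV_conj, RCLike.norm_conj, mul_comm (nrm φ)]; exact VV_le1 ψ φ x

lemma nrm_le_of_pt {n : ℕ} {φ ψ : SR n} {B : ℝ} (hB : 0 ≤ B) (h : ∀ x, ‖φ x‖ ≤ B * ‖ψ x‖) :
    nrm φ ≤ B * nrm ψ := by
  have h2 : nrm φ ^ 2 ≤ (B * nrm ψ) ^ 2 := by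
    rw [mul_pow, nrm_sq, nrm_sq, ← integral_const_mul]
    refine integral_mono (sq_integrable φ) ((sq_integrable ψ).const_mul _) fun x => ?_
    have := pow_le_pow_left₀ (norm_nonneg _) (h x) 2
    simpa [mul_pow] using this
  exact le_of_sq_le_sq h2 (mul_nonneg hB (nrm_nonneg _))

lemma TT_le1 {n : ℕ} {γ : ℝ} [P : Par n γ] (φ ψ χ : SR n) :
    nrm (TT γ φ ψ χ) ≤ CV n γ * (h1 φ * nrm ψ * nrm χ) := by
  have := nrm_le_of_pt (φ := TT γ φ ψ χ) (ψ := χ) (B := CV n γ * (h1 φ * nrm ψ))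
    (mul_nonneg (CV_nonneg n γ) (mul_nonneg (h1_nonneg _) (nrm_nonneg _))) (fun x => by
      rw [TT_apply, norm_mul]
      exact mul_le_mul_of_nonneg_right (VV_le1 φ ψ x) (norm_nonneg _))
  linarith
lemma TT_le2 {n : ℕ} {γ : ℝ} [P : Par n γ] (φ ψ χ : SR n) :
    nrm (TT γ φ ψ χ) ≤ CV n γ * (nrm φ * h1 ψ * nrm χ) := by
  have := nrm_le_of_pt (φ := TT γ φ ψ χ) (ψ := χ) (B := CV n γ * (nrm φ * h1 ψ))
    (mul_nonneg (CV_nonneg n γ) (mul_nonneg (nrm_nonneg _) (h1_nonneg _))) (fun x => by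
      rw [TT_apply, norm_mul]
      exact mul_le_mul_of_nonneg_right (VV_le2 φ ψ x) (norm_nonneg _))
  linarith

lemma KC_fderiv {n : ℕ} {a : ℝ} (hn : 1 ≤ n) (ha0 : 0 ≤ a) (ha : a < n) (ρ : SR n) (x : Rn n) (j : Fin n) :
    fderiv ℝ (KC a (⇑ρ)) x (ej j) = KC a (⇑(Dop j ρ)) x := by
  rw [(KC_hasFDerivAt hn ha0 ha ρ x).fderiv, KC, KC,
    ContinuousLinearMap.integral_apply (KC_int hn ha0 ha (SchwartzMap.fderivCLM ℝ (Rn n) ℂ ρ) x)]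
  congr 1

lemma VV_fderiv {n : ℕ} {γ : ℝ} [P : Par n γ] (φ ψ : SR n) (x : Rn n) (j : Fin n) :
    fderiv ℝ (VV γ φ ψ) x (ej j) = VV γ (Dop j φ) ψ x + VV γ φ (Dop j ψ) x := by
  rw [VV, KC_fderiv P.n1 P.h0.le P.lt, Dop_prS, KC_add P.n1 P.h0.le P.lt]; rfl

lemma Dop_TT {n : ℕ} {γ : ℝ} [P : Par n γ] (j : Fin n) (φ ψ χ : SR n) :
    Dop j (TT γ φ ψ χ) = TT γ (Dop j φ) ψ χ + TT γ φ (Dop j ψ) χ + TT γ φ ψ (Dop j χ) := by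
  have h := Dop_mulS j (VV_tg γ φ ψ) (g' := fun x => VV γ (Dop j φ) ψ x + VV γ φ (Dop j ψ) x)
    ((VV_tg γ (Dop j φ) ψ).add (VV_tg γ φ (Dop j ψ))) (fun x => VV_fderiv φ ψ x j) χ
  rw [TT, h]
  ext x
  simp only [add_ap, TT_apply]
  have hg : Function.HasTemperateGrowth (fun x => VV γ (Dop j φ) ψ x + VV γ φ (Dop j ψ) x) :=
    (VV_tg γ (Dop j φ) ψ).add (VV_tg γ φ (Dop j ψ))
  rw [mulS_apply hg, mulS_apply (VV_tg γ φ ψ)]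
  ring

lemma Xop_TT {n : ℕ} {γ : ℝ} [P : Par n γ] (j : Fin n) (φ ψ χ : SR n) :
    Xop j (TT γ φ ψ χ) = TT γ φ ψ (Xop j χ) := by
  ext x; simp only [Xop_apply, TT_apply]; ring

lemma TT_X12 {n : ℕ} {γ : ℝ} (j : Fin n) (φ ψ χ : SR n) :
    TT γ (Xop j φ) ψ χ = TT γ φ (Xop j ψ) χ := by
  have : prS (Xop j φ) ψ = prS φ (Xop j ψ) := by
    ext x; simp only [Xop_apply, prS_apply, map_mul, Complex.conj_ofReal]; ring
  rw [TT, TT, VV, VV, this]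

lemma TT_swap {n : ℕ} {γ : ℝ} [P : Par n γ] (φ ψ χ ω : SR n) :
    ip ω (TT γ φ ψ χ) = ip ψ (TT γ χ ω φ) := by
  have key : ∀ F G : SR n, ∫ x, F x * KC γ (⇑G) x = ∫ x, G x * KC γ (⇑F) x := by
    intro F G
    obtain ⟨B, hB⟩ := KC_bound (a := γ) P.n1 P.h0.le P.lt (prS G G)
    have hi : Integrable (Function.uncurry fun x y => F x * (((‖x - y‖ ^ (-γ) : ℝ) : ℂ) * G y)) (volume.prod volume) := by
      have hm : AEStronglyMeasurable (Function.uncurry fun x y => F x * (((‖x - y‖ ^ (-γ) : ℝ) : ℂ) * G y)) (volume.prod volume) := by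
        refine Measurable.aestronglyMeasurable ?_
        have h1 := F.continuous.measurable
        have h2 := G.continuous.measurable
        have h3 : Measurable (fun p : Rn n × Rn n => ‖p.1 - p.2‖ ^ (-γ)) := ((measurable_fst.sub measurable_snd).norm).pow_const _
        exact (h1.comp measurable_fst).mul ((Complex.measurable_ofReal.comp h3).mul (h2.comp measurable_snd))
      have hk : ∀ x, Integrable (fun y => ((‖x - y‖ ^ (-γ) : ℝ) : ℂ) * G y) := by
        intro x
        have := (KC_int (a := γ) P.n1 P.h0.le P.lt G x).comp_sub_left x
        refine this.congr (Eventually.of_forall fun y => ?_)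
        simp [Complex.real_smul]
      rw [integrable_prod_iff hm]
      refine ⟨Eventually.of_forall fun x => by simpa [Function.uncurry] using (hk x).const_mul (F x), ?_⟩
      obtain ⟨C, hC0, hC⟩ := sch_decay G
      refine Integrable.mono' ((F.integrable (μ := volume)).norm.mul_const (C * (∫ z, kerB (n := n) γ z) + ∫ z, ‖G z‖)) hm.norm.integral_prod_right' (Eventually.of_forall fun x => ?_)
      rw [Real.norm_of_nonneg (integral_nonneg fun y => norm_nonneg _)]
      simp only [Function.uncurry, norm_mul, integral_const_mul]
      refine mul_le_mul_of_nonneg_left ?_ (norm_nonneg _)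
      have e : ∫ y, ‖((‖x - y‖ ^ (-γ) : ℝ) : ℂ)‖ * ‖G y‖ = ∫ z, ‖z‖ ^ (-γ) * ‖G (x - z)‖ := by
        rw [← integral_sub_left_eq_self _ volume x]
        congr 1; ext z
        rw [sub_sub_cancel, Complex.norm_real, Real.norm_of_nonneg (by positivity)]
      rw [e]
      have i1 : Integrable (fun z => ‖z‖ ^ (-γ) * ‖G (x - z)‖) := by
        refine (KC_int (a := γ) P.n1 P.h0.le P.lt G x).norm.congr (Eventually.of_forall fun z => ?_)
        simp only [norm_smul]; rw [Real.norm_of_nonneg (by positivity : (0:ℝ) ≤ ‖z‖ ^ (-γ))]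
      have i2 : Integrable (fun z => C * kerB γ z + ‖G (x - z)‖) :=
        ((kerB_integrable P.n1 P.lt).const_mul C).add (G.integrable.comp_sub_left x).norm
      calc _ ≤ ∫ z, (C * kerB γ z + ‖G (x - z)‖) := by
            refine integral_mono i1 i2 fun z => ?_
            have h1 : (1 + ‖x - z‖) ^ (-((n : ℝ) + 1)) ≤ 1 :=
              Real.rpow_le_one_of_one_le_of_nonpos (by linarith [norm_nonneg (x - z)]) (by linarith [Nat.cast_nonneg (α := ℝ) n])
            have h2 : ‖G (x - z)‖ ≤ C := (hC _).trans (by nlinarith)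
            have h3 := ker_le P.h0.le z
            have h4 := kerB_nonneg (a := γ) z
            simp only
            nlinarith [norm_nonneg (G (x - z)), mul_le_mul_of_nonneg_left h2 h4, mul_le_mul_of_nonneg_right h3 (norm_nonneg (G (x - z)))]
        _ = _ := by
          rw [integral_add ((kerB_integrable P.n1 P.lt).const_mul C) (G.integrable.comp_sub_left x).norm, integral_const_mul]
          congr 1
          exact integral_sub_left_eq_self (fun z => ‖G z‖) volume x
    calc ∫ x, F x * KC γ (⇑G) x = ∫ x, ∫ y, F x * (((‖x - y‖ ^ (-γ) : ℝ) : ℂ) * G y) := by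
          simp only [KC_eq, integral_const_mul]
      _ = ∫ y, ∫ x, F x * (((‖x - y‖ ^ (-γ) : ℝ) : ℂ) * G y) := integral_integral_swap hi
      _ = _ := by
        congr 1; ext y
        rw [KC_eq, ← integral_const_mul]
        congr 1; ext x
        rw [norm_sub_rev]; ring
  have h := key (prS χ ω) (prS φ ψ)
  rw [ip_eq, ip_eq]
  calc _ = ∫ x, prS χ ω x * KC γ (⇑(prS φ ψ)) x := by
        congr 1; ext x; rw [TT_apply, prS_apply, VV]; ring
    _ = _ := h
    _ = _ := by
        congr 1; ext x; rw [TT_apply, prS_apply, VV]; ring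

end

section
/-! ### Unimodular multipliers and the free Schroedinger group -/
open FourierTransform SchwartzMap

lemma eI_tg : Function.HasTemperateGrowth (fun t : ℝ => Complex.exp (Complex.I * (t : ℂ))) := by
  have hd : ∀ k, iteratedDeriv k (fun t : ℝ => Complex.exp (Complex.I * (t : ℂ))) =
      fun t : ℝ => Complex.I ^ k * Complex.exp (Complex.I * (t : ℂ)) := by
    intro k
    induction k with
    | zero => simp
    | succ k ih =>
      rw [iteratedDeriv_succ, ih]
      ext t
      have h1 : HasDerivAt (fun t : ℝ => Complex.I * (t : ℂ)) Complex.I t := by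
        simpa using (Complex.ofRealCLM.hasDerivAt (x := t)).const_mul Complex.I
      have h2 := h1.cexp.const_mul (Complex.I ^ k)
      rw [h2.deriv]; ring
  refine ⟨?_, fun k => ⟨0, 1, fun t => ?_⟩⟩
  · exact Complex.contDiff_exp.comp (contDiff_const.mul Complex.ofRealCLM.contDiff)
  · rw [norm_iteratedFDeriv_eq_norm_iteratedDeriv, hd]
    simp [Complex.norm_exp]

def ph {n : ℕ} (g : Rn n → ℝ) (x : Rn n) : ℂ := Complex.exp (Complex.I * ((g x : ℝ) : ℂ))

lemma ph_tg {n : ℕ} {g : Rn n → ℝ} (hg : g.HasTemperateGrowth) : (ph g).HasTemperateGrowth :=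
  eI_tg.comp hg

lemma ph_norm {n : ℕ} (g : Rn n → ℝ) (x : Rn n) : ‖ph g x‖ = 1 := by
  simp [ph, Complex.norm_exp]

lemma ph_fderiv {n : ℕ} {g : Rn n → ℝ} {x : Rn n} (hg : DifferentiableAt ℝ g x) (v : Rn n) :
    fderiv ℝ (ph g) x v = Complex.I * ((fderiv ℝ g x v : ℝ) : ℂ) * ph g x := by
  have h1 : HasFDerivAt (fun y => ((g y : ℝ) : ℂ)) (Complex.ofRealCLM.comp (fderiv ℝ g x)) x :=
    Complex.ofRealCLM.hasFDerivAt.comp x hg.hasFDerivAt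
  have h2 := (h1.const_mul Complex.I).cexp
  have h3 : fderiv ℝ (ph g) x = _ := h2.fderiv
  rw [h3]
  simp [ph]; ring

lemma ip_unimod {n : ℕ} {g : Rn n → ℂ} (hg : g.HasTemperateGrowth) (h : ∀ x, ‖g x‖ = 1) (φ ψ : SR n) :
    ip (mulS g φ) (mulS g ψ) = ip φ ψ := by
  rw [ip_eq, ip_eq]
  congr 1; ext x
  rw [mulS_apply hg, mulS_apply hg, map_mul]
  have : conj (g x) * g x = 1 := by
    rw [mul_comm, Complex.mul_conj, Complex.normSq_eq_norm_sq, h]; norm_num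
  linear_combination (conj (φ x) * ψ x) * this

lemma nrm_of_ip {n : ℕ} {φ ψ : SR n} (h : ip φ φ = ip ψ ψ) : nrm φ = nrm ψ := by
  rw [ip_self, ip_self] at h
  have h2 : nrm φ ^ 2 = nrm ψ ^ 2 := by exact_mod_cast h
  exact (sq_eq_sq₀ (nrm_nonneg _) (nrm_nonneg _)).mp h2

lemma nrm_unimod {n : ℕ} {g : Rn n → ℂ} (hg : g.HasTemperateGrowth) (h : ∀ x, ‖g x‖ = 1) (φ : SR n) :
    nrm (mulS g φ) = nrm φ := nrm_of_ip (ip_unimod hg h φ φ)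

lemma normsq_tg {n : ℕ} : Function.HasTemperateGrowth (fun x : Rn n => ‖x‖ ^ 2) := by
  have h : (fun x : Rn n => ‖x‖ ^ 2) = fun x => ∑ j, x j * x j := by
    ext x; rw [EuclideanSpace.norm_sq_eq]
    exact Finset.sum_congr rfl fun j _ => by rw [Real.norm_eq_abs, sq_abs, sq]
  rw [h]
  refine Function.HasTemperateGrowth.sum fun j _ => ?_
  have hc : Function.HasTemperateGrowth (fun x : Rn n => x j) :=
    (EuclideanSpace.proj j : Rn n →L[ℝ] ℝ).hasTemperateGrowth
  exact hc.mul hc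

lemma cnormsq_tg {n : ℕ} (c : ℝ) : Function.HasTemperateGrowth (fun x : Rn n => c * ‖x‖ ^ 2) := by
  have h := normsq_tg (n := n)
  fun_prop

lemma ip_F {n : ℕ} (φ ψ : SR n) : ip (𝓕 φ) (𝓕 ψ) = ip φ ψ := inner_fourier_toL2_eq φ ψ

lemma nrm_F {n : ℕ} (φ : SR n) : nrm (𝓕 φ) = nrm φ := nrm_of_ip (ip_F φ φ)

lemma inner_ej {n : ℕ} (j : Fin n) (x : Rn n) : inner ℝ x (ej j) = x j := by
  simp [ej, EuclideanSpace.inner_single_right]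

lemma Xop_eq {n : ℕ} (j : Fin n) (φ : SR n) : smulLeftCLM ℂ (fun x : Rn n => inner ℝ x (ej j)) φ = Xop j φ := by
  ext x
  rw [Xop_apply, smulLeftCLM_apply_apply (by fun_prop), inner_ej, Complex.real_smul]

lemma F_D {n : ℕ} (j : Fin n) (φ : SR n) : 𝓕 (Dop j φ) = (2 * π * Complex.I) • Xop j (𝓕 φ) := by
  rw [← Xop_eq]; exact fourier_lineDerivOp_eq φ (ej j)

lemma D_F {n : ℕ} (j : Fin n) (φ : SR n) : Dop j (𝓕 φ) = 𝓕 (-(2 * π * Complex.I) • Xop j φ) := by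
  rw [← Xop_eq]; exact lineDerivOp_fourier_eq φ (ej j)

lemma F_X {n : ℕ} (j : Fin n) (φ : SR n) : 𝓕 (Xop j φ) = (Complex.I / (2 * π)) • Dop j (𝓕 φ) := by
  rw [D_F, ← FourierTransform.fourier_smul, smul_smul]
  congr 1
  rw [show Complex.I / (2 * π) * -(2 * π * Complex.I) = 1 by
    have : (π : ℂ) ≠ 0 := by exact_mod_cast Real.pi_ne_zero
    field_simp; simp, one_smul]

def Em {n : ℕ} (s : ℝ) : Rn n → ℂ := ph (fun ξ => (-4 * π ^ 2 * s) * ‖ξ‖ ^ 2)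

lemma Em_tg {n : ℕ} (s : ℝ) : (Em (n := n) s).HasTemperateGrowth := ph_tg (cnormsq_tg _)

def EE {n : ℕ} (s : ℝ) (φ : SR n) : SR n := 𝓕⁻ (mulS (Em s) (𝓕 φ))

lemma F_E {n : ℕ} (s : ℝ) (φ : SR n) : 𝓕 (EE s φ) = mulS (Em s) (𝓕 φ) := by
  rw [EE, FourierTransform.fourier_fourierInv_eq]

lemma F_inj {n : ℕ} {φ ψ : SR n} (h : 𝓕 φ = 𝓕 ψ) : φ = ψ := by
  have h1 : (𝓕⁻ (𝓕 φ) : SR n) = φ := FourierTransform.fourierInv_fourier_eq φ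
  have h2 : (𝓕⁻ (𝓕 ψ) : SR n) = ψ := FourierTransform.fourierInv_fourier_eq ψ
  rw [← h1, h, h2]

lemma F_sub {n : ℕ} (φ ψ : SR n) : 𝓕 (φ - ψ) = 𝓕 φ - 𝓕 ψ :=
  map_sub (FourierTransform.fourierCLM ℂ (SR n)) φ ψ

lemma E_add {n : ℕ} (s : ℝ) (φ ψ : SR n) : EE s (φ + ψ) = EE s φ + EE s ψ := by
  apply F_inj; simp only [F_E, FourierTransform.fourier_add, map_add]
lemma E_sub {n : ℕ} (s : ℝ) (φ ψ : SR n) : EE s (φ - ψ) = EE s φ - EE s ψ := by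
  apply F_inj; simp only [F_E, F_sub, map_sub]
lemma E_smul {n : ℕ} (s : ℝ) (c : ℂ) (φ : SR n) : EE s (c • φ) = c • EE s φ := by
  apply F_inj; simp only [F_E, FourierTransform.fourier_smul, map_smul]

lemma E_ip {n : ℕ} (s : ℝ) (φ ψ : SR n) : ip (EE s φ) (EE s ψ) = ip φ ψ := by
  rw [← ip_F, F_E, F_E, ip_unimod (Em_tg s) (fun x => ph_norm _ x), ip_F]
lemma E_nrm {n : ℕ} (s : ℝ) (φ : SR n) : nrm (EE s φ) = nrm φ := nrm_of_ip (E_ip s φ φ)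

lemma E_grp {n : ℕ} (s t : ℝ) (φ : SR n) : EE s (EE t φ) = EE (s + t) φ := by
  apply F_inj
  simp only [F_E]
  ext x
  simp only [mulS_apply (Em_tg _)]
  rw [← mul_assoc]; congr 1
  simp only [Em, ph]
  rw [← Complex.exp_add]; congr 1; push_cast; ring

lemma E_zero {n : ℕ} (φ : SR n) : EE 0 φ = φ := by
  apply F_inj
  rw [F_E]
  ext x
  rw [mulS_apply (Em_tg _)]; simp [Em, ph]

lemma E_neg {n : ℕ} (s : ℝ) (φ : SR n) : EE (-s) (EE s φ) = φ := by rw [E_grp]; simp [E_zero]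
lemma E_neg' {n : ℕ} (s : ℝ) (φ : SR n) : EE s (EE (-s) φ) = φ := by rw [E_grp]; simp [E_zero]
lemma E_adj {n : ℕ} (s : ℝ) (φ ψ : SR n) : ip φ (EE s ψ) = ip (EE (-s) φ) ψ := by
  rw [← E_ip (-s), E_neg]

lemma E_D {n : ℕ} (s : ℝ) (j : Fin n) (φ : SR n) : Dop j (EE s φ) = EE s (Dop j φ) := by
  apply F_inj
  rw [F_D, F_E, F_E, F_D, map_smul]
  congr 1
  ext x
  simp only [mulS_apply (Em_tg _), Xop_apply]; ring

lemma fderiv_normsq {n : ℕ} (c : ℝ) (j : Fin n) (x : Rn n) :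
    fderiv ℝ (fun x : Rn n => c * ‖x‖ ^ 2) x (ej j) = 2 * c * x j := by
  have h := ((hasStrictFDerivAt_norm_sq x).hasFDerivAt).const_mul c
  rw [h.fderiv]
  simp only [ContinuousLinearMap.smul_apply, innerSL_apply_apply, inner_ej, smul_eq_mul, nsmul_eq_mul]
  push_cast; ring

lemma ph_normsq_D {n : ℕ} (c : ℝ) (j : Fin n) (φ : SR n) :
    Dop j (mulS (ph (fun x => c * ‖x‖ ^ 2)) φ) = mulS (ph (fun x => c * ‖x‖ ^ 2)) (Dop j φ + (2 * c * Complex.I) • Xop j φ) := by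
  have hd : Differentiable ℝ (fun x : Rn n => c * ‖x‖ ^ 2) := (cnormsq_tg c).1.differentiable (by simp)
  have hg := ph_tg (cnormsq_tg (n := n) c)
  have hg' : Function.HasTemperateGrowth (fun x : Rn n => (2 * c * Complex.I * ((x j : ℝ) : ℂ)) * ph (fun x => c * ‖x‖ ^ 2) x) := by
    have := coord_tg j
    fun_prop
  rw [Dop_mulS j hg hg' (fun x => ?_)]
  · ext x
    simp only [add_ap, mulS_apply hg, mulS_apply hg', smul_ap, Xop_apply]; ring
  · rw [ph_fderiv (hd x), fderiv_normsq]; push_cast; ring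

lemma E_X {n : ℕ} (s : ℝ) (j : Fin n) (φ : SR n) :
    Xop j (EE s φ) = EE s (Xop j φ - (2 * s * Complex.I) • Dop j φ) := by
  apply F_inj
  rw [F_X, F_E, F_E, Em, ph_normsq_D, F_sub, FourierTransform.fourier_smul, F_X, F_D, ← map_smul]
  congr 1
  rw [smul_add, smul_smul, smul_smul, sub_eq_add_neg, ← neg_smul]
  congr 2
  have : (π : ℂ) ≠ 0 := by exact_mod_cast Real.pi_ne_zero
  push_cast
  field_simp
  norm_num

lemma F_Lap {n : ℕ} (φ : SR n) (ξ : Rn n) : 𝓕 (LapS φ) ξ = ((-4 * π ^ 2 * ‖ξ‖ ^ 2 : ℝ) : ℂ) * 𝓕 φ ξ := by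
  have h : 𝓕 (LapS φ) = ∑ j, 𝓕 (Dop j (Dop j φ)) := by
    rw [LapS]; exact map_sum (FourierTransform.fourierCLM ℂ (SR n)) _ _
  rw [h, sum_ap]
  simp only [F_D, map_smul, smul_ap, Xop_apply]
  rw [EuclideanSpace.norm_sq_eq]
  push_cast
  rw [Finset.mul_sum, Finset.sum_mul]
  refine Finset.sum_congr rfl fun j _ => ?_
  have : ((‖ξ j‖ : ℝ) : ℂ) ^ 2 = (ξ j : ℂ) ^ 2 := by
    rw [← Complex.ofReal_pow, Real.norm_eq_abs, sq_abs]; push_cast; rfl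
  rw [this]
  linear_combination (4 * π ^ 2 * (ξ j : ℂ) ^ 2 * 𝓕 φ ξ) * Complex.I_sq

lemma E_sub_one {n : ℕ} (s : ℝ) (φ : SR n) : nrm (EE s φ - φ) ≤ |s| * nrm (LapS φ) := by
  rw [← nrm_F, ← nrm_F (LapS φ)]
  refine nrm_le_of_pt (abs_nonneg s) fun ξ => ?_
  rw [F_sub, F_E, sub_ap, mulS_apply (Em_tg s), F_Lap, norm_mul, ← mul_assoc, ← sub_one_mul, norm_mul]
  refine mul_le_mul_of_nonneg_right ?_ (norm_nonneg _)
  have := Real.norm_exp_I_mul_ofReal_sub_one_le (x := (-4 * π ^ 2 * s) * ‖ξ‖ ^ 2)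
  refine this.trans (le_of_eq ?_)
  rw [Complex.norm_real, Real.norm_eq_abs, Real.norm_eq_abs, ← abs_mul]
  congr 1; ring

end

section
/-! ### The trilinear form in the moving frame -/

lemma m3 {C a b c a' b' c' : ℝ} (hC : 0 ≤ C) (ha : 0 ≤ a) (hb : 0 ≤ b) (hc : 0 ≤ c)
    (h1 : a ≤ a') (h2 : b ≤ b') (h3 : c ≤ c') : C * (a * b * c) ≤ C * (a' * b' * c') := by
  have ha' := ha.trans h1
  have hb' := hb.trans h2
  gcongr

lemma E_h1 {n : ℕ} (s : ℝ) (φ : SR n) : h1 (EE s φ) = h1 φ := by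
  unfold h1; simp only [E_D, E_nrm]

lemma E_sub_one_h1 {n : ℕ} (s : ℝ) (φ : SR n) : h1 (EE s φ - φ) ≤ |s| * h1 (LapS φ) := by
  unfold h1
  rw [mul_add, Finset.mul_sum]
  refine add_le_add (E_sub_one s φ) (Finset.sum_le_sum fun j _ => ?_)
  rw [map_sub, E_D, ← LapS_D]
  exact E_sub_one s _

def TE {n : ℕ} (γ s : ℝ) (a b c : SR n) : SR n := EE (-s) (TT γ (EE s a) (EE s b) (EE s c))

section
variable {n : ℕ} {γ : ℝ} [P : Par n γ]

lemma TE_le1 (s : ℝ) (a b c : SR n) : nrm (TE γ s a b c) ≤ CV n γ * (h1 a * nrm b * nrm c) := by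
  rw [TE, E_nrm]
  have := TT_le1 (γ := γ) (EE s a) (EE s b) (EE s c)
  rwa [E_h1, E_nrm, E_nrm] at this
lemma TE_le2 (s : ℝ) (a b c : SR n) : nrm (TE γ s a b c) ≤ CV n γ * (nrm a * h1 b * nrm c) := by
  rw [TE, E_nrm]
  have := TT_le2 (γ := γ) (EE s a) (EE s b) (EE s c)
  rwa [E_h1, E_nrm, E_nrm] at this

lemma TE_D (s : ℝ) (j : Fin n) (a b c : SR n) : Dop j (TE γ s a b c) =
    TE γ s (Dop j a) b c + TE γ s a (Dop j b) c + TE γ s a b (Dop j c) := by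
  simp only [TE, E_D, Dop_TT, E_add]

lemma TE_X (s : ℝ) (j : Fin n) (a b c : SR n) : Xop j (TE γ s a b c) =
    TE γ s (Xop j a) b c - TE γ s a (Xop j b) c + TE γ s a b (Xop j c) := by
  have hx : ∀ φ : SR n, EE s (Xop j φ) = Xop j (EE s φ) + (2 * s * Complex.I) • Dop j (EE s φ) := by
    intro φ
    rw [E_X, E_sub, E_smul, E_D]; abel
  simp only [TE]
  rw [E_X, ← E_sub, ← E_add]
  congr 1
  simp only [hx, Dop_TT, Xop_TT, TT_add1, TT_add2, TT_add3, TT_smul1, TT_smul2, TT_smul3, TT_X12]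
  simp only [map_mul, Complex.conj_I, Complex.conj_ofReal, map_ofNat, smul_add, Complex.ofReal_neg, mul_neg, neg_mul, neg_smul]
  abel

lemma TE_add1 (s : ℝ) (φ φ' ψ χ : SR n) : TE γ s (φ + φ') ψ χ = TE γ s φ ψ χ + TE γ s φ' ψ χ := by
  simp only [TE, E_add, TT_add1]
lemma TE_diff (s : ℝ) (a b c a' b' c' : SR n) : TE γ s a b c - TE γ s a' b' c' =
    TE γ s (a - a') b c + TE γ s a' (b - b') c + TE γ s a' b' (c - c') := by
  simp only [TE, E_sub, ← E_add, ← TT_diff]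

lemma TE_nS (s : ℝ) (a b c : SR n) :
    nS (TE γ s a b c) ≤ (2 * n + 1) * (3 * CV n γ * (nS a * nS b * nS c)) := by
  have hC := CV_nonneg n γ
  have key1 : ∀ a' b' c' : SR n, nrm a' ≤ nS a → h1 b' ≤ nS b → nrm c' ≤ nS c →
      nrm (TE γ s a' b' c') ≤ CV n γ * (nS a * nS b * nS c) := fun a' b' c' h1' h2' h3' =>
    (TE_le2 s a' b' c').trans (m3 hC (nrm_nonneg _) (h1_nonneg _) (nrm_nonneg _) h1' h2' h3')
  have key2 : ∀ a' b' c' : SR n, h1 a' ≤ nS a → nrm b' ≤ nS b → nrm c' ≤ nS c →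
      nrm (TE γ s a' b' c') ≤ CV n γ * (nS a * nS b * nS c) := fun a' b' c' h1' h2' h3' =>
    (TE_le1 s a' b' c').trans (m3 hC (h1_nonneg _) (nrm_nonneg _) (nrm_nonneg _) h1' h2' h3')
  have hp : 0 ≤ CV n γ * (nS a * nS b * nS c) :=
    mul_nonneg hC (mul_nonneg (mul_nonneg (nS_nonneg _) (nS_nonneg _)) (nS_nonneg _))
  refine nS_le ?_ (fun j => ?_) (fun j => ?_)
  · have := key1 a b c (nrm_le_nS a) (h1_le_nS b) (nrm_le_nS c)
    linarith
  · rw [TE_X]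
    have e1 := key1 (Xop j a) b c (nrmX_le_nS j a) (h1_le_nS b) (nrm_le_nS c)
    have e2 := key2 a (Xop j b) c (h1_le_nS a) (nrmX_le_nS j b) (nrm_le_nS c)
    have e3 := key1 a b (Xop j c) (nrm_le_nS a) (h1_le_nS b) (nrmX_le_nS j c)
    have e4 := nrm_add (TE γ s (Xop j a) b c - TE γ s a (Xop j b) c) (TE γ s a b (Xop j c))
    have e5 := nrm_sub (TE γ s (Xop j a) b c) (TE γ s a (Xop j b) c)
    linarith
  · rw [TE_D]
    have e1 := key1 (Dop j a) b c (nrmD_le_nS j a) (h1_le_nS b) (nrm_le_nS c)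
    have e2 := key2 a (Dop j b) c (h1_le_nS a) (nrmD_le_nS j b) (nrm_le_nS c)
    have e3 := key1 a b (Dop j c) (nrm_le_nS a) (h1_le_nS b) (nrmD_le_nS j c)
    have e4 := nrm_add (TE γ s (Dop j a) b c + TE γ s a (Dop j b) c) (TE γ s a b (Dop j c))
    have e5 := nrm_add (TE γ s (Dop j a) b c) (TE γ s a (Dop j b) c)
    linarith

def CS (n : ℕ) (γ : ℝ) [P : Par n γ] : ℝ := (2 * n + 1) * (3 * CV n γ)
lemma CS_nonneg (n : ℕ) (γ : ℝ) [P : Par n γ] : 0 ≤ CS n γ :=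
  mul_nonneg (by positivity) (mul_nonneg (by norm_num) (CV_nonneg n γ))

lemma TE_nS' (s : ℝ) (a b c : SR n) : nS (TE γ s a b c) ≤ CS n γ * (nS a * nS b * nS c) := by
  have := TE_nS (γ := γ) s a b c
  unfold CS; linarith

/-- local Lipschitz bound in the Σ norm -/
lemma TE_lip (s : ℝ) {a b : SR n} {M : ℝ} (ha : nS a ≤ M) (hb : nS b ≤ M) :
    nS (TE γ s a a a - TE γ s b b b) ≤ 3 * CS n γ * M ^ 2 * nS (a - b) := by
  rw [TE_diff]
  have hC := CS_nonneg n γ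
  have h0 := nS_nonneg (a - b)
  have g1 := (TE_nS' (γ := γ) s (a - b) a a).trans (m3 hC h0 (nS_nonneg _) (nS_nonneg _) le_rfl ha ha)
  have g2 := (TE_nS' (γ := γ) s b (a - b) a).trans (m3 hC (nS_nonneg _) h0 (nS_nonneg _) hb le_rfl ha)
  have g3 := (TE_nS' (γ := γ) s b b (a - b)).trans (m3 hC (nS_nonneg _) (nS_nonneg _) h0 hb hb le_rfl)
  have g4 := nS_add (TE γ s (a - b) a a + TE γ s b (a - b) a) (TE γ s b b (a - b))
  have g5 := nS_add (TE γ s (a - b) a a) (TE γ s b (a - b) a)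
  nlinarith

lemma TE_zero (a b c : SR n) : TE γ 0 a b c = TT γ a b c := by simp [TE, E_zero]

/-- a norm controlling two more derivatives -/
def N2 (φ : SR n) : ℝ := h1 φ + ∑ j, h1 (Dop j φ) + ∑ j, h1 (Dop j (Dop j φ))

lemma h1_le_N2 (φ : SR n) : h1 φ ≤ N2 φ := by
  have a1 : 0 ≤ ∑ j, h1 (Dop j φ) := Finset.sum_nonneg fun j _ => h1_nonneg _
  have a2 : 0 ≤ ∑ j, h1 (Dop j (Dop j φ)) := Finset.sum_nonneg fun j _ => h1_nonneg _
  unfold N2; linarith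
lemma N2_nonneg (φ : SR n) : 0 ≤ N2 φ := (h1_nonneg φ).trans (h1_le_N2 φ)
lemma h1D_le_N2 (j : Fin n) (φ : SR n) : h1 (Dop j φ) ≤ N2 φ := by
  have a1 := Finset.single_le_sum (f := fun j => h1 (Dop j φ)) (fun i _ => h1_nonneg _) (Finset.mem_univ j)
  have a2 : 0 ≤ ∑ j, h1 (Dop j (Dop j φ)) := Finset.sum_nonneg fun j _ => h1_nonneg _
  have := h1_nonneg φ
  unfold N2; linarith
lemma h1DD_le_N2 (j : Fin n) (φ : SR n) : h1 (Dop j (Dop j φ)) ≤ N2 φ := by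
  have a1 := Finset.single_le_sum (f := fun j => h1 (Dop j (Dop j φ))) (fun i _ => h1_nonneg _) (Finset.mem_univ j)
  have a2 : 0 ≤ ∑ j, h1 (Dop j φ) := Finset.sum_nonneg fun j _ => h1_nonneg _
  have := h1_nonneg φ
  unfold N2; linarith
lemma h1_sum {ι : Type*} (s : Finset ι) (F : ι → SR n) : h1 (∑ i ∈ s, F i) ≤ ∑ i ∈ s, h1 (F i) := by
  classical
  induction s using Finset.induction_on with
  | empty => simp [h1, nrm_zero]
  | insert i s hi ih =>
    rw [Finset.sum_insert hi, Finset.sum_insert hi]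
    exact (h1_add _ _).trans (by linarith)
lemma h1Lap_le_N2 (φ : SR n) : h1 (LapS φ) ≤ N2 φ := by
  have a2 : 0 ≤ ∑ j, h1 (Dop j φ) := Finset.sum_nonneg fun j _ => h1_nonneg _
  have := h1_nonneg φ
  have := h1_sum Finset.univ (fun j => Dop j (Dop j φ))
  unfold N2 LapS; linarith

lemma nrm_Lap_TT (a b c : SR n) : nrm (LapS (TT γ a b c)) ≤ n * (9 * CV n γ * (N2 a * N2 b * N2 c)) := by
  have hC := CV_nonneg n γ
  have key : ∀ a' b' c' : SR n, h1 a' ≤ N2 a → h1 b' ≤ N2 b → h1 c' ≤ N2 c →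
      nrm (TT γ a' b' c') ≤ CV n γ * (N2 a * N2 b * N2 c) := fun a' b' c' h1' h2' h3' =>
    (TT_le1 a' b' c').trans (m3 hC (h1_nonneg _) (nrm_nonneg _) (nrm_nonneg _) h1'
      ((nrm_le_h1 _).trans h2') ((nrm_le_h1 _).trans h3'))
  have hj : ∀ j, nrm (Dop j (Dop j (TT γ a b c))) ≤ 9 * CV n γ * (N2 a * N2 b * N2 c) := by
    intro j
    simp only [Dop_TT, map_add]
    have a0 := h1_le_N2 a
    have a1 := h1D_le_N2 j a
    have a2 := h1DD_le_N2 j a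
    have b0 := h1_le_N2 b
    have b1 := h1D_le_N2 j b
    have b2 := h1DD_le_N2 j b
    have c0 := h1_le_N2 c
    have c1 := h1D_le_N2 j c
    have c2 := h1DD_le_N2 j c
    refine (nrm_add _ _).trans ((add_le_add ((nrm_add _ _).trans (add_le_add ((nrm_add _ _).trans (add_le_add ((nrm_add _ _).trans (add_le_add (key _ _ _ a2 b0 c0) (key _ _ _ a1 b1 c0))) (key _ _ _ a1 b0 c1)))
      ((nrm_add _ _).trans (add_le_add ((nrm_add _ _).trans (add_le_add (key _ _ _ a1 b1 c0) (key _ _ _ a0 b2 c0))) (key _ _ _ a0 b1 c1)))))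
      ((nrm_add _ _).trans (add_le_add ((nrm_add _ _).trans (add_le_add (key _ _ _ a1 b0 c1) (key _ _ _ a0 b1 c1))) (key _ _ _ a0 b0 c2)))).trans ?_)
    linarith
  refine (nrm_sum _ _).trans ((Finset.sum_le_sum fun j _ => hj j).trans ?_)
  simp

lemma TE_cons0 (s : ℝ) (a b c : SR n) :
    nrm (TE γ s a b c - TT γ a b c) ≤ |s| * ((9 * n + 3) * CV n γ * (N2 a * N2 b * N2 c)) := by
  have hC := CV_nonneg n γ
  have hs := abs_nonneg s
  have e0 : TE γ s a b c - TT γ a b c = EE (-s) (TT γ (EE s a) (EE s b) (EE s c) - TT γ a b c)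
      + (EE (-s) (TT γ a b c) - TT γ a b c) := by
    rw [E_sub, TE]; abel
  rw [e0]
  refine (nrm_add _ _).trans ?_
  rw [E_nrm]
  have g2 := E_sub_one (-s) (TT γ a b c)
  rw [abs_neg] at g2
  have g3 := mul_le_mul_of_nonneg_left (nrm_Lap_TT (γ := γ) a b c) hs
  rw [TT_diff]
  have g4 := nrm_add (TT γ (EE s a - a) (EE s b) (EE s c) + TT γ a (EE s b - b) (EE s c)) (TT γ a b (EE s c - c))
  have g5 := nrm_add (TT γ (EE s a - a) (EE s b) (EE s c)) (TT γ a (EE s b - b) (EE s c))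
  have d : ∀ φ : SR n, h1 (EE s φ - φ) ≤ |s| * N2 φ := fun φ =>
    (E_sub_one_h1 s φ).trans (mul_le_mul_of_nonneg_left (h1Lap_le_N2 φ) hs)
  have z : ∀ φ : SR n, nrm φ ≤ N2 φ := fun φ => (nrm_le_h1 φ).trans (h1_le_N2 φ)
  have g6 := (TT_le1 (γ := γ) (EE s a - a) (EE s b) (EE s c)).trans (m3 hC (h1_nonneg _) (nrm_nonneg _) (nrm_nonneg _)
    (d a) ((E_nrm s b).trans_le (z b)) ((E_nrm s c).trans_le (z c)))
  have g7 := (TT_le2 (γ := γ) a (EE s b - b) (EE s c)).trans (m3 hC (nrm_nonneg _) (h1_nonneg _) (nrm_nonneg _)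
    (z a) (d b) ((E_nrm s c).trans_le (z c)))
  have g8 := (TT_le1 (γ := γ) a b (EE s c - c)).trans (m3 hC (h1_nonneg _) (nrm_nonneg _) (nrm_nonneg _)
    (h1_le_N2 a) (z b) ((nrm_le_h1 _).trans (d c)))
  nlinarith

/-- consistency in the Σ norm -/
lemma TE_cons (s : ℝ) {a : SR n} {M : ℝ} (h0 : N2 a ≤ M) (hX : ∀ j, N2 (Xop j a) ≤ M) (hD : ∀ j, N2 (Dop j a) ≤ M) :
    nS (TE γ s a a a - TT γ a a a) ≤ |s| * ((2 * n + 1) * (3 * ((9 * n + 3) * CV n γ * (M * M * M)))) := by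
  have hC : 0 ≤ (9 * n + 3) * CV n γ := mul_nonneg (by positivity) (CV_nonneg n γ)
  set B := |s| * ((9 * n + 3) * CV n γ * (M * M * M)) with hB
  have key : ∀ a' b' c' : SR n, N2 a' ≤ M → N2 b' ≤ M → N2 c' ≤ M →
      nrm (TE γ s a' b' c' - TT γ a' b' c') ≤ B := fun a' b' c' h1' h2' h3' =>
    (TE_cons0 s a' b' c').trans (mul_le_mul_of_nonneg_left
      (m3 hC (N2_nonneg _) (N2_nonneg _) (N2_nonneg _) h1' h2' h3') (abs_nonneg s))
  have hB0 : 0 ≤ B := (nrm_nonneg _).trans (key a a a h0 h0 h0)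
  have : nS (TE γ s a a a - TT γ a a a) ≤ (2 * n + 1) * (3 * B) := by
    refine nS_le ?_ (fun j => ?_) (fun j => ?_)
    · have := key a a a h0 h0 h0; linarith
    · have e : Xop j (TE γ s a a a - TT γ a a a) = (TE γ s (Xop j a) a a - TT γ (Xop j a) a a)
          - (TE γ s a (Xop j a) a - TT γ a (Xop j a) a) + (TE γ s a a (Xop j a) - TT γ a a (Xop j a)) := by
        rw [map_sub, TE_X, Xop_TT, TT_X12]; abel
      rw [e]
      have e1 := key (Xop j a) a a (hX j) h0 h0
      have e2 := key a (Xop j a) a h0 (hX j) h0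
      have e3 := key a a (Xop j a) h0 h0 (hX j)
      refine (nrm_add _ _).trans ((add_le_add ((nrm_sub _ _).trans (add_le_add e1 e2)) e3).trans ?_)
      linarith
    · have e : Dop j (TE γ s a a a - TT γ a a a) = (TE γ s (Dop j a) a a - TT γ (Dop j a) a a)
          + (TE γ s a (Dop j a) a - TT γ a (Dop j a) a) + (TE γ s a a (Dop j a) - TT γ a a (Dop j a)) := by
        rw [map_sub, TE_D, Dop_TT]; abel
      rw [e]
      have e1 := key (Dop j a) a a (hD j) h0 h0
      have e2 := key a (Dop j a) a h0 (hD j) h0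
      have e3 := key a a (Dop j a) h0 h0 (hD j)
      refine (nrm_add _ _).trans ((add_le_add ((nrm_add _ _).trans (add_le_add e1 e2)) e3).trans ?_)
      linarith
  refine this.trans (le_of_eq ?_)
  rw [hB]; ring

/-! ### words in position and momentum operators -/
inductive Wd : (SR n →L[ℂ] SR n) → Prop
  | id : Wd (ContinuousLinearMap.id ℂ (SR n))
  | D (j : Fin n) {w} : Wd w → Wd (w.comp (Dop j))
  | X (j : Fin n) {w} : Wd w → Wd (w.comp (Xop j))

/-- the phase `θ V(f,f)` -/
def VR (γ : ℝ) (f : SR n) (x : Rn n) : ℝ := hartree γ (⇑f) x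

lemma VR_eq (f : SR n) (x : Rn n) : ((VR γ f x : ℝ) : ℂ) = VV γ f f x := hartree_eq γ f x

lemma VR_re (f : SR n) (x : Rn n) : VR γ f x = (VV γ f f x).re := by
  rw [← VR_eq]; simp

lemma VR_tg (f : SR n) : (VR γ f).HasTemperateGrowth := by
  have : VR γ f = fun x => Complex.reCLM (VV γ f f x) := by
    ext x; rw [VR_re]; rfl
  rw [this]
  exact (Complex.reCLM.hasTemperateGrowth).comp (VV_tg γ f f)

def aH (γ θ : ℝ) (f F : SR n) : SR n := mulS (ph (fun x => (-θ) * VR γ f x)) F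

lemma aH_tg (θ : ℝ) (f : SR n) : (ph (fun x => (-θ) * VR γ f x)).HasTemperateGrowth := by
  have := VR_tg (γ := γ) f
  exact ph_tg (by fun_prop)

lemma aH_X (θ : ℝ) (f F : SR n) (j : Fin n) : Xop j (aH γ θ f F) = aH γ θ f (Xop j F) := by
  ext x; simp only [Xop_apply, aH, mulS_apply (aH_tg θ f)]; ring

def VD (γ : ℝ) (f : SR n) (j : Fin n) (x : Rn n) : ℂ := VV γ (Dop j f) f x + VV γ f (Dop j f) x
lemma VD_tg (f : SR n) (j : Fin n) : (VD γ f j).HasTemperateGrowth :=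
  (VV_tg γ (Dop j f) f).add (VV_tg γ f (Dop j f))

lemma aH_D (θ : ℝ) (f F : SR n) (j : Fin n) : Dop j (aH γ θ f F) =
    aH γ θ f (Dop j F) + (-(θ * Complex.I)) • aH γ θ f (mulS (VD γ f j) F) := by
  have hV := VR_tg (γ := γ) f
  have hd : Differentiable ℝ (fun x => (-θ) * VR γ f x) := (hV.1.differentiable (by simp)).const_mul _
  have hVd := VD_tg (γ := γ) f j
  have hp := aH_tg (γ := γ) θ f
  have hg' : Function.HasTemperateGrowth (fun x => (-(θ * Complex.I)) * VD γ f j x * ph (fun x => (-θ) * VR γ f x) x) := by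
    fun_prop
  rw [aH, Dop_mulS j hp hg' (fun x => ?_)]
  · ext x
    simp only [add_ap, smul_ap, aH, mulS_apply hp, mulS_apply hg', mulS_apply hVd]; ring
  · rw [ph_fderiv (hd x)]
    have e1 : fderiv ℝ (fun x => (-θ) * VR γ f x) x (ej j) = -θ * fderiv ℝ (VR γ f) x (ej j) := by
      rw [fderiv_const_mul ((hV.1.differentiable (by simp)) x)]; rfl
    have e2 : ((fderiv ℝ (VR γ f) x (ej j) : ℝ) : ℂ) = VD γ f j x := by
      have h1 : HasFDerivAt (fun y => ((VR γ f y : ℝ) : ℂ)) (Complex.ofRealCLM.comp (fderiv ℝ (VR γ f) x)) x :=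
        Complex.ofRealCLM.hasFDerivAt.comp x ((hV.1.differentiable (by simp)) x).hasFDerivAt
      have h2 : (fun y => ((VR γ f y : ℝ) : ℂ)) = VV γ f f := by ext y; exact VR_eq f y
      rw [h2] at h1
      rw [VD, ← VV_fderiv, h1.fderiv]; rfl
    rw [e1]; push_cast; rw [e2]; ring

lemma aH_nrm (θ : ℝ) (f F : SR n) : nrm (aH γ θ f F) = nrm F :=
  nrm_unimod (aH_tg θ f) (fun x => ph_norm _ x) F

lemma Wd_bound (f : SR n) (Θ : ℝ) {w : SR n →L[ℂ] SR n} (hw : Wd w) :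
    ∀ F : SR n, ∃ C, ∀ θ, |θ| ≤ Θ → nrm (w (aH γ θ f F)) ≤ C := by
  induction hw with
  | id => intro F; exact ⟨nrm F, fun θ _ => (aH_nrm θ f F).le⟩
  | D j _ ih =>
    intro F
    obtain ⟨C1, h1⟩ := ih (Dop j F)
    obtain ⟨C2, h2⟩ := ih (mulS (VD γ f j) F)
    refine ⟨C1 + Θ * C2, fun θ hθ => ?_⟩
    rw [ContinuousLinearMap.comp_apply, aH_D, map_add, map_smul]
    refine (nrm_add _ _).trans (add_le_add (h1 θ hθ) ?_)
    rw [nrm_smul]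
    have : ‖-((θ : ℂ) * Complex.I)‖ = |θ| := by simp
    rw [this]
    exact mul_le_mul hθ (h2 θ hθ) (nrm_nonneg _) ((abs_nonneg _).trans hθ)
  | X j _ ih =>
    intro F
    obtain ⟨C1, h1⟩ := ih (Xop j F)
    refine ⟨C1, fun θ hθ => ?_⟩
    rw [ContinuousLinearMap.comp_apply, aH_X]; exact h1 θ hθ

lemma sum_bdd {ι : Type*} [Fintype ι] {Θ : ℝ} (G : ι → ℝ → ℝ) (h : ∀ i, ∃ C, ∀ θ, |θ| ≤ Θ → G i θ ≤ C) :
    ∃ C, ∀ θ, |θ| ≤ Θ → ∑ i, G i θ ≤ C := by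
  choose C hC using h
  exact ⟨∑ i, C i, fun θ hθ => Finset.sum_le_sum fun i _ => hC i θ hθ⟩
lemma add_bdd {Θ : ℝ} {G H : ℝ → ℝ} (h : ∃ C, ∀ θ, |θ| ≤ Θ → G θ ≤ C) (h' : ∃ C, ∀ θ, |θ| ≤ Θ → H θ ≤ C) :
    ∃ C, ∀ θ, |θ| ≤ Θ → G θ + H θ ≤ C := by
  obtain ⟨C, hC⟩ := h
  obtain ⟨C', hC'⟩ := h'
  exact ⟨C + C', fun θ hθ => add_le_add (hC θ hθ) (hC' θ hθ)⟩

lemma h1_bdd (f : SR n) (Θ : ℝ) {w : SR n →L[ℂ] SR n} (h : ∀ {w' : SR n →L[ℂ] SR n}, Wd w' → Wd (w'.comp w)) :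
    ∃ C, ∀ θ, |θ| ≤ Θ → h1 (w (aH γ θ f f)) ≤ C :=
  add_bdd (Wd_bound f Θ (h .id) f) (sum_bdd _ fun j => Wd_bound f Θ (h (.D j .id)) f)

lemma N2_bdd (f : SR n) (Θ : ℝ) {w : SR n →L[ℂ] SR n} (h : ∀ {w' : SR n →L[ℂ] SR n}, Wd w' → Wd (w'.comp w)) :
    ∃ C, ∀ θ, |θ| ≤ Θ → N2 (w (aH γ θ f f)) ≤ C :=
  add_bdd (add_bdd (h1_bdd f Θ h) (sum_bdd _ fun j => h1_bdd (w := (Dop j).comp w) f Θ (fun hw => h (.D j hw))))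
    (sum_bdd _ fun j => h1_bdd (w := (Dop j).comp ((Dop j).comp w)) f Θ (fun hw => h (.D j (.D j hw))))

/-- uniform consistency along the approximate profile -/
lemma aH_cons (f : SR n) (Θ : ℝ) : ∃ C, 0 ≤ C ∧ ∀ θ, |θ| ≤ Θ → nS (aH γ θ f f) ≤ C ∧ ∀ s,
    nS (TE γ s (aH γ θ f f) (aH γ θ f f) (aH γ θ f f) - TT γ (aH γ θ f f) (aH γ θ f f) (aH γ θ f f)) ≤ C * |s| := by
  have hid : ∀ {w' : SR n →L[ℂ] SR n}, Wd w' → Wd (w'.comp (ContinuousLinearMap.id ℂ (SR n))) := by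
    intro w' h; simpa using h
  obtain ⟨C0, h0⟩ := N2_bdd (γ := γ) f Θ hid
  obtain ⟨C1, h1'⟩ := sum_bdd (Θ := Θ) (fun j θ => N2 (Xop j (aH γ θ f f))) (fun j => N2_bdd (w := Xop j) (γ := γ) f Θ (fun h => .X j h))
  obtain ⟨C2, h2'⟩ := sum_bdd (Θ := Θ) (fun j θ => N2 (Dop j (aH γ θ f f))) (fun j => N2_bdd (w := Dop j) (γ := γ) f Θ (fun h => .D j h))
  set M := max C0 (max C1 C2)
  set K := (2 * n + 1) * (3 * ((9 * n + 3) * CV n γ * (M * M * M)))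
  refine ⟨max ((2 * n + 1) * M) (max K 0), by simp, fun θ hθ => ?_⟩
  have a0 : N2 (aH γ θ f f) ≤ M := (h0 θ hθ).trans (le_max_left _ _)
  have a1 : ∀ j, N2 (Xop j (aH γ θ f f)) ≤ M := fun j =>
    ((Finset.single_le_sum (f := fun j => N2 (Xop j (aH γ θ f f))) (fun i _ => N2_nonneg _) (Finset.mem_univ j)).trans
      (h1' θ hθ)).trans ((le_max_left _ _).trans (le_max_right _ _))
  have a2 : ∀ j, N2 (Dop j (aH γ θ f f)) ≤ M := fun j =>
    ((Finset.single_le_sum (f := fun j => N2 (Dop j (aH γ θ f f))) (fun i _ => N2_nonneg _) (Finset.mem_univ j)).trans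
      (h2' θ hθ)).trans ((le_max_right _ _).trans (le_max_right _ _))
  have z : ∀ φ : SR n, nrm φ ≤ N2 φ := fun φ => (nrm_le_h1 φ).trans (h1_le_N2 φ)
  refine ⟨(nS_le ((z _).trans a0) (fun j => (z _).trans (a1 j)) (fun j => (z _).trans (a2 j))).trans (le_max_left _ _), fun s => ?_⟩
  refine (TE_cons s a0 a1 a2).trans ?_
  rw [mul_comm]
  exact mul_le_mul_of_nonneg_right ((le_max_left _ _).trans (le_max_right _ _)) (abs_nonneg s)

end

end

section
/-! ### Scaling and the lens transform -/
open SchwartzMap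

def scl {n : ℕ} (c : ℝ) (φ : SR n) : SR n :=
  if hc : c ≠ 0 then compCLMOfContinuousLinearEquiv ℂ (ContinuousLinearEquiv.smulLeft (Units.mk0 c hc) : Rn n ≃L[ℝ] Rn n) φ
  else φ

section
variable {n : ℕ}
lemma scl_apply {c : ℝ} (hc : c ≠ 0) (φ : SR n) (y : Rn n) : scl c φ y = φ (c • y) := by
  rw [scl, dif_pos hc]; rfl

lemma scl_D {c : ℝ} (hc : c ≠ 0) (j : Fin n) (φ : SR n) : Dop j (scl c φ) = (c : ℂ) • scl c (Dop j φ) := by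
  ext y
  rw [smul_ap, scl_apply hc, Dop_apply, Dop_apply]
  have h1 : HasFDerivAt (fun y : Rn n => c • y) (c • ContinuousLinearMap.id ℝ (Rn n)) y :=
    (hasFDerivAt_id y).const_smul c
  have h2 := ((SR_diff φ) (c • y)).hasFDerivAt.comp y h1
  have h3 : (⇑(scl c φ)) = (⇑φ) ∘ (fun y : Rn n => c • y) := by ext z; exact scl_apply hc φ z
  rw [h3, h2.fderiv]
  simp

lemma scl_X {c : ℝ} (hc : c ≠ 0) (j : Fin n) (φ : SR n) : Xop j (scl c φ) = ((c⁻¹ : ℝ) : ℂ) • scl c (Xop j φ) := by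
  ext y
  have : (c : ℂ) ≠ 0 := by exact_mod_cast hc
  simp only [smul_ap, scl_apply hc, Xop_apply, PiLp.smul_apply, smul_eq_mul]
  push_cast; field_simp

lemma scl_ip {c : ℝ} (hc : c ≠ 0) (φ ψ : SR n) : ip (scl c φ) (scl c ψ) = (((|c| ^ n)⁻¹ : ℝ) : ℂ) * ip φ ψ := by
  rw [ip_eq, ip_eq]
  simp only [scl_apply hc]
  have := Measure.integral_comp_smul volume (fun x => conj (φ x) * ψ x) c
  rw [this, finrank_euclideanSpace, Fintype.card_fin, Complex.real_smul, abs_inv, abs_pow]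

lemma scl_TT {γ : ℝ} [P : Par n γ] {c : ℝ} (hc : c ≠ 0) (a b d : SR n) :
    TT γ (scl c a) (scl c b) (scl c d) = ((|c| ^ γ * (|c| ^ n)⁻¹ : ℝ) : ℂ) • scl c (TT γ a b d) := by
  ext y
  have hc' : 0 < |c| := abs_pos.mpr hc
  rw [smul_ap, TT_apply, scl_apply hc, scl_apply hc, TT_apply, ← mul_assoc]
  congr 1
  rw [VV, VV, KC_eq, KC_eq]
  have := Measure.integral_comp_smul volume (fun z => ((‖c • y - z‖ ^ (-γ) : ℝ) : ℂ) * prS a b z) c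
  rw [finrank_euclideanSpace, Fintype.card_fin, abs_inv, abs_pow, Complex.real_smul] at this
  push_cast
  rw [mul_assoc]
  have h2 : (((|c| : ℝ) : ℂ) ^ n)⁻¹ * ∫ (y_1 : Rn n), ((‖c • y - y_1‖ ^ (-γ) : ℝ) : ℂ) * (prS a b) y_1
     = ∫ (x : Rn n), ((‖c • y - c • x‖ ^ (-γ) : ℝ) : ℂ) * (prS a b) (c • x) := by
    rw [this]; push_cast; rfl
  rw [h2, ← integral_const_mul]
  congr 1; ext z
  rw [← smul_sub, norm_smul, Real.norm_eq_abs, Real.mul_rpow hc'.le (norm_nonneg _), prS_apply, prS_apply, scl_apply hc, scl_apply hc]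
  have h5 : ((|c| ^ γ : ℝ) : ℂ) * ((|c| ^ (-γ) : ℝ) : ℂ) = 1 := by
    rw [← Complex.ofReal_mul, ← Real.rpow_add hc']; simp
  push_cast
  linear_combination (-((‖y - z‖ ^ (-γ) : ℝ) : ℂ) * (a (c • z) * conj (b (c • z)))) * h5

def Lam (ε τ : ℝ) (φ : SR n) : SR n :=
  ((|cos τ| ^ ((n : ℝ) / 2) : ℝ) : ℂ) • mulS (ph (fun y => (sin τ * cos τ / (2 * ε)) * ‖y‖ ^ 2)) (scl (cos τ) φ)

def SS (ε τ : ℝ) (φ : SR n) : SR n := EE (-(ε * tan τ / 2)) (Lam ε τ φ)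

lemma scl_add {c : ℝ} (hc : c ≠ 0) (φ ψ : SR n) : scl c (φ + ψ) = scl c φ + scl c ψ := by
  ext y; simp only [add_ap, scl_apply hc]
lemma scl_smul {c : ℝ} (hc : c ≠ 0) (k : ℂ) (φ : SR n) : scl c (k • φ) = k • scl c φ := by
  ext y; simp only [smul_ap, scl_apply hc]

variable {ε τ : ℝ}
lemma Lam_add (hc : cos τ ≠ 0) (φ ψ : SR n) : Lam ε τ (φ + ψ) = Lam ε τ φ + Lam ε τ ψ := by
  rw [Lam, scl_add hc, map_add, smul_add]; rfl
lemma Lam_smul (hc : cos τ ≠ 0) (k : ℂ) (φ : SR n) : Lam ε τ (k • φ) = k • Lam ε τ φ := by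
  rw [Lam, scl_smul hc, map_smul, smul_comm]; rfl
lemma SS_add (hc : cos τ ≠ 0) (φ ψ : SR n) : SS ε τ (φ + ψ) = SS ε τ φ + SS ε τ ψ := by
  rw [SS, Lam_add hc, E_add]; rfl
lemma SS_smul (hc : cos τ ≠ 0) (k : ℂ) (φ : SR n) : SS ε τ (k • φ) = k • SS ε τ φ := by
  rw [SS, Lam_smul hc, E_smul]; rfl
lemma SS_sub (hc : cos τ ≠ 0) (φ ψ : SR n) : SS ε τ (φ - ψ) = SS ε τ φ - SS ε τ ψ := by
  have := SS_smul (ε := ε) hc (-1) ψ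
  rw [sub_eq_add_neg, SS_add hc, sub_eq_add_neg]
  congr 1; simpa using this

lemma rpow_half_sq (hc : cos τ ≠ 0) : |cos τ| ^ ((n : ℝ) / 2) * |cos τ| ^ ((n : ℝ) / 2) = |cos τ| ^ n := by
  rw [← Real.rpow_add (abs_pos.mpr hc), add_halves, Real.rpow_natCast]

lemma SS_ip (hc : cos τ ≠ 0) (φ ψ : SR n) : ip (SS ε τ φ) (SS ε τ ψ) = ip φ ψ := by
  rw [SS, SS, E_ip, Lam, Lam, ip_smul_left, ip_smul_right, ip_unimod (ph_tg (cnormsq_tg _)) (fun x => ph_norm _ x), scl_ip hc,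
    Complex.conj_ofReal, ← mul_assoc, ← mul_assoc, ← Complex.ofReal_mul, ← Complex.ofReal_mul, rpow_half_sq hc, mul_inv_cancel₀, Complex.ofReal_one, one_mul]
  exact pow_ne_zero _ (abs_ne_zero.mpr hc)
lemma SS_nrm (hc : cos τ ≠ 0) (φ : SR n) : nrm (SS ε τ φ) = nrm φ := nrm_of_ip (SS_ip hc φ φ)

lemma Lam_X (hc : cos τ ≠ 0) (j : Fin n) (φ : SR n) : Xop j (Lam ε τ φ) = (((cos τ)⁻¹ : ℝ) : ℂ) • Lam ε τ (Xop j φ) := by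
  rw [Lam, map_smul]
  have : Xop j (mulS (ph (fun y => (sin τ * cos τ / (2 * ε)) * ‖y‖ ^ 2)) (scl (cos τ) φ)) =
     mulS (ph (fun y => (sin τ * cos τ / (2 * ε)) * ‖y‖ ^ 2)) (Xop j (scl (cos τ) φ)) := by
    ext x; simp only [Xop_apply, mulS_apply (ph_tg (cnormsq_tg _))]; ring
  rw [this, scl_X hc, map_smul, smul_comm]; rfl

lemma Lam_D (hc : cos τ ≠ 0) (j : Fin n) (φ : SR n) : Dop j (Lam ε τ φ) =
    Lam ε τ ((cos τ : ℂ) • Dop j φ + (Complex.I * (sin τ / ε : ℝ)) • Xop j φ) := by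
  rw [Lam, map_smul, ph_normsq_D, scl_D hc, scl_X hc, Lam, scl_add hc, scl_smul hc, scl_smul hc, smul_smul]
  have h1 : (Complex.cos (τ : ℂ)) ≠ 0 := by exact_mod_cast hc
  have h6 : (2 * ((sin τ * cos τ / (2 * ε) : ℝ) : ℂ) * Complex.I * (((cos τ)⁻¹ : ℝ) : ℂ)) = Complex.I * ((sin τ / ε : ℝ) : ℂ) := by
    push_cast
    rcases eq_or_ne (ε : ℂ) 0 with h | h
    · simp [h]
    · field_simp
  rw [h6]

lemma SS_D (hc : cos τ ≠ 0) (j : Fin n) (φ : SR n) : Dop j (SS ε τ φ) =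
    SS ε τ ((cos τ : ℂ) • Dop j φ + (Complex.I * (sin τ / ε : ℝ)) • Xop j φ) := by
  rw [SS, E_D, Lam_D hc]; rfl

lemma SS_X (hε : ε ≠ 0) (hc : cos τ ≠ 0) (j : Fin n) (φ : SR n) : Xop j (SS ε τ φ) =
    SS ε τ ((cos τ : ℂ) • Xop j φ + (Complex.I * (ε * sin τ : ℝ)) • Dop j φ) := by
  rw [SS, E_X, Lam_X hc, Lam_D hc, SS]
  congr 1
  rw [← Lam_smul hc, ← Lam_smul hc, sub_eq_add_neg, ← neg_one_smul ℂ, ← Lam_smul hc, ← Lam_add hc]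
  congr 1
  have h1 : (Complex.cos (τ : ℂ)) ≠ 0 := by exact_mod_cast hc
  have h2 : (ε : ℂ) ≠ 0 := by exact_mod_cast hε
  have h3 := Complex.sin_sq_add_cos_sq (τ : ℂ)
  ext x
  simp only [add_ap, smul_ap]
  push_cast
  rw [Complex.tan_eq_sin_div_cos]
  have h4 : Complex.sin (τ:ℂ) ^ 2 = 1 - Complex.cos τ ^ 2 := by rw [← h3]; ring
  field_simp
  ring_nf
  simp only [h4, Complex.I_sq]
  ring

lemma TT_mulS {γ : ℝ} [P : Par n γ] {g : Rn n → ℂ} (hg : g.HasTemperateGrowth) (h : ∀ x, ‖g x‖ = 1) (a b d : SR n) :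
    TT γ (mulS g a) (mulS g b) (mulS g d) = mulS g (TT γ a b d) := by
  have : prS (mulS g a) (mulS g b) = prS a b := by
    ext x
    have : conj (g x) * g x = 1 := by
      rw [mul_comm, Complex.mul_conj, Complex.normSq_eq_norm_sq, h]; norm_num
    simp only [prS_apply, mulS_apply hg, map_mul]
    linear_combination (a x * conj (b x)) * this
  ext x
  rw [TT_apply, mulS_apply hg, mulS_apply hg, TT_apply, VV, this, VV]; ring

lemma SS_TT {γ : ℝ} [P : Par n γ] (hc : cos τ ≠ 0) (a b d : SR n) :
    SS ε τ (TT γ a b d) = ((|cos τ| ^ (-γ) : ℝ) : ℂ) • TE γ (ε * tan τ / 2) (SS ε τ a) (SS ε τ b) (SS ε τ d) := by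
  have hp := abs_pos.mpr hc
  have hEE : ∀ φ : SR n, EE (ε * tan τ / 2) (SS ε τ φ) = Lam ε τ φ := fun φ => by rw [SS, E_neg']
  rw [TE, hEE, hEE, hEE, SS, ← E_smul]
  congr 1
  rw [Lam, Lam, Lam, Lam, TT_smul1, TT_smul2, TT_smul3, TT_mulS (ph_tg (cnormsq_tg _)) (fun x => ph_norm _ x), scl_TT hc, map_smul,
    smul_smul, smul_smul, smul_smul, smul_smul, Complex.conj_ofReal]
  congr 1
  rw [← Complex.ofReal_mul, ← Complex.ofReal_mul, ← Complex.ofReal_mul, ← Complex.ofReal_mul]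
  congr 1
  have h1 := rpow_half_sq (n := n) hc
  have h2 : |cos τ| ^ (-γ) * |cos τ| ^ γ = 1 := by rw [← Real.rpow_add hp]; simp
  have h3 : |cos τ| ^ n * (|cos τ| ^ n)⁻¹ = 1 := mul_inv_cancel₀ (pow_ne_zero _ hp.ne')
  calc _ = |cos τ| ^ ((n : ℝ) / 2) * ((|cos τ| ^ (-γ) * |cos τ| ^ γ) * (|cos τ| ^ n * (|cos τ| ^ n)⁻¹)) := by rw [h2, h3]; ring
    _ = _ := by rw [← h1]; ring

/-! ### the quadratic energy -/
def hf (ε : ℝ) (φ ψ : SR n) : ℂ := ∑ j, (ip (Xop j φ) (Xop j ψ) + (ε ^ 2 : ℝ) * ip (Dop j φ) (Dop j ψ))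

lemma SS_hf (hε : ε ≠ 0) (hc : cos τ ≠ 0) (φ ψ : SR n) : hf ε (SS ε τ φ) (SS ε τ ψ) = hf ε φ ψ := by
  unfold hf
  refine Finset.sum_congr rfl fun j _ => ?_
  rw [SS_X hε hc, SS_X hε hc, SS_D hc, SS_D hc, SS_ip hc, SS_ip hc]
  simp only [ip_add_left, ip_add_right, ip_smul_left, ip_smul_right, map_mul, Complex.conj_I, Complex.conj_ofReal]
  have h2 : (ε : ℂ) ≠ 0 := by exact_mod_cast hε
  have h3 := Complex.sin_sq_add_cos_sq (τ : ℂ)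
  have h4 : Complex.cos (τ:ℂ) ^ 2 = 1 - Complex.sin τ ^ 2 := by rw [← h3]; ring
  push_cast
  field_simp
  ring_nf
  simp only [h4, Complex.I_sq]
  ring

def hq (ε : ℝ) (φ : SR n) : ℝ := ∑ j, (nrm (Xop j φ) ^ 2 + ε ^ 2 * nrm (Dop j φ) ^ 2)
lemma hf_self (ε : ℝ) (φ : SR n) : hf ε φ φ = ((hq ε φ : ℝ) : ℂ) := by
  unfold hf hq; simp only [ip_self]; push_cast; rfl
lemma SS_hq (hε : ε ≠ 0) (hc : cos τ ≠ 0) (φ : SR n) : hq ε (SS ε τ φ) = hq ε φ := by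
  have := SS_hf hε hc φ φ
  rw [hf_self, hf_self] at this; exact_mod_cast this
lemma hq_nonneg (ε : ℝ) (φ : SR n) : 0 ≤ hq ε φ := Finset.sum_nonneg fun j _ => by positivity

lemma nS_le_hq (h0 : 0 < ε) (h1 : ε ≤ 1) (φ : SR n) : nS φ ≤ (2 * n + 1) * ((nrm φ + √(hq ε φ)) / ε) := by
  have hs : ∀ j, nrm (Xop j φ) ^ 2 + ε ^ 2 * nrm (Dop j φ) ^ 2 ≤ hq ε φ := fun j =>
    Finset.single_le_sum (f := fun j => nrm (Xop j φ) ^ 2 + ε ^ 2 * nrm (Dop j φ) ^ 2) (fun i _ => by positivity) (Finset.mem_univ j)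
  have hn := nrm_nonneg φ
  have hq0 := Real.sqrt_nonneg (hq ε φ)
  have hA : nrm φ + √(hq ε φ) ≤ (nrm φ + √(hq ε φ)) / ε := by
    rw [le_div_iff₀ h0]; nlinarith
  refine nS_le (by linarith) (fun j => ?_) (fun j => ?_)
  · have : nrm (Xop j φ) ≤ √(hq ε φ) := Real.le_sqrt_of_sq_le (by have := hs j; nlinarith [sq_nonneg (ε * nrm (Dop j φ))])
    linarith
  · have : ε * nrm (Dop j φ) ≤ √(hq ε φ) := Real.le_sqrt_of_sq_le (by have := hs j; nlinarith [sq_nonneg (nrm (Xop j φ))])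
    rw [le_div_iff₀ h0]; linarith

lemma hq_le_nS (h0 : 0 < ε) (h1 : ε ≤ 1) (φ : SR n) : hq ε φ ≤ 2 * n * nS φ ^ 2 := by
  have : ∀ j, nrm (Xop j φ) ^ 2 + ε ^ 2 * nrm (Dop j φ) ^ 2 ≤ 2 * nS φ ^ 2 := by
    intro j
    have e1 : nrm (Xop j φ) ^ 2 ≤ nS φ ^ 2 := pow_le_pow_left₀ (nrm_nonneg _) (nrmX_le_nS j φ) 2
    have e2 : nrm (Dop j φ) ^ 2 ≤ nS φ ^ 2 := pow_le_pow_left₀ (nrm_nonneg _) (nrmD_le_nS j φ) 2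
    have e3 : ε ^ 2 ≤ 1 := by nlinarith
    have : ε ^ 2 * nrm (Dop j φ) ^ 2 ≤ 1 * nS φ ^ 2 := mul_le_mul e3 e2 (by positivity) (by norm_num)
    linarith
  refine (Finset.sum_le_sum fun j _ => this j).trans ?_
  simp; linarith
end

end

section
/-! ### Gaussians -/
open SchwartzMap

lemma tg_fderiv {n : ℕ} {F : Type} [NormedAddCommGroup F] [NormedSpace ℝ F] {f : Rn n → F} (hf : f.HasTemperateGrowth) :
    (fderiv ℝ f).HasTemperateGrowth := by
  refine ⟨hf.1.fderiv_right (m := ((⊤ : ℕ∞) : WithTop ℕ∞)) (by simp), fun k => ?_⟩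
  obtain ⟨m, C, h⟩ := hf.2 (k + 1)
  refine ⟨m, C, fun x => ?_⟩
  rw [norm_iteratedFDeriv_fderiv]; exact h x

lemma exp_dec {b : ℝ} (hb : 0 < b) (N : ℕ) {r : ℝ} (hr : 0 ≤ r) :
    (1 + r) ^ N * Real.exp (-b * r ^ 2) ≤ Real.exp (N ^ 2 / (4 * b)) := by
  have h1 : (1 + r) ^ N ≤ Real.exp (N * r) := by
    rw [Real.exp_nat_mul]
    exact pow_le_pow_left₀ (by linarith) (by linarith [Real.add_one_le_exp r]) N
  calc _ ≤ Real.exp (N * r) * Real.exp (-b * r ^ 2) := by gcongr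
    _ = Real.exp (N * r + -b * r ^ 2) := by rw [Real.exp_add]
    _ ≤ _ := by
      apply Real.exp_le_exp.mpr
      rw [le_div_iff₀ (by positivity)]
      nlinarith [sq_nonneg (2 * b * r - N)]

lemma gdec {n : ℕ} {b : ℝ} (hb : 0 < b) : ∀ (k : ℕ) (F : Type) [NormedAddCommGroup F] [NormedSpace ℝ F] (Q : Rn n → F),
    Q.HasTemperateGrowth → ∀ m : ℕ, ∃ C, ∀ x, ‖x‖ ^ m * ‖iteratedFDeriv ℝ k (fun x => Real.exp (-b * ‖x‖ ^ 2) • Q x) x‖ ≤ C := by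
  intro k
  induction k with
  | zero =>
    intro F _ _ Q hQ m
    obtain ⟨l, C, h⟩ := hQ.2 0
    refine ⟨|C| * Real.exp ((m + l : ℕ) ^ 2 / (4 * b)), fun x => ?_⟩
    have h' := h x
    rw [norm_iteratedFDeriv_zero] at h' ⊢
    rw [norm_smul, Real.norm_eq_abs, abs_of_pos (Real.exp_pos _)]
    have h3 := exp_dec hb (m + l) (norm_nonneg x)
    have h4 : ‖x‖ ^ m ≤ (1 + ‖x‖) ^ m := pow_le_pow_left₀ (norm_nonneg _) (by linarith [norm_nonneg x]) m
    have h5 : ‖Q x‖ ≤ |C| * (1 + ‖x‖) ^ l := h'.trans (mul_le_mul_of_nonneg_right (le_abs_self C) (by positivity))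
    calc _ ≤ (1 + ‖x‖) ^ m * (Real.exp (-b * ‖x‖ ^ 2) * (|C| * (1 + ‖x‖) ^ l)) := by gcongr
      _ = |C| * ((1 + ‖x‖) ^ (m + l) * Real.exp (-b * ‖x‖ ^ 2)) := by rw [pow_add]; ring
      _ ≤ _ := mul_le_mul_of_nonneg_left h3 (abs_nonneg C)
  | succ k ih =>
    intro F _ _ Q hQ m
    have hB : Function.HasTemperateGrowth (fun x : Rn n => ContinuousLinearMap.smulRightL ℝ (Rn n) F (((-2 * b) • (innerSL ℝ : Rn n →L[ℝ] Rn n →L[ℝ] ℝ)) x) (Q x)) := by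
      refine ContinuousLinearMap.bilinear_hasTemperateGrowth (𝕜 := ℝ) (ContinuousLinearMap.smulRightL ℝ (Rn n) F) ?_ hQ
      exact (((-2 * b) • (innerSL ℝ : Rn n →L[ℝ] Rn n →L[ℝ] ℝ) : Rn n →L[ℝ] Rn n →L[ℝ] ℝ).hasTemperateGrowth)
    obtain ⟨C, h⟩ := ih (Rn n →L[ℝ] F) _ ((tg_fderiv hQ).add hB) m
    refine ⟨C, fun x => ?_⟩
    rw [← norm_iteratedFDeriv_fderiv]
    convert h x using 4
    ext1 y
    have hd : DifferentiableAt ℝ Q y := hQ.1.differentiable (by simp) y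
    have h1 := (((hasStrictFDerivAt_norm_sq y).hasFDerivAt).const_mul (-b)).exp
    have h2 := h1.smul hd.hasFDerivAt
    have h3 : HasFDerivAt (fun x => Real.exp (-b * ‖x‖ ^ 2) • Q x) _ y := h2
    rw [h3.fderiv]
    ext v
    simp [smul_smul]
    congr 1; ring

end

section
open SchwartzMap

def g0 {n : ℕ} (ε : ℝ) : SR n :=
  if h : 0 < ε then
  { toFun := fun x => Real.exp (-(1 / (2 * ε)) * ‖x‖ ^ 2) • (1 : ℂ)
    smooth' := by
      have : ContDiff ℝ (⊤ : ℕ∞) (fun x : Rn n => ‖x‖ ^ 2) := contDiff_norm_sq ℝ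
      fun_prop
    decay' := fun k m => gdec (b := 1 / (2 * ε)) (by positivity) m ℂ (fun _ => (1 : ℂ)) (Function.HasTemperateGrowth.const 1) k }
  else 0

variable {n : ℕ} {ε : ℝ}

lemma g0_apply (h : 0 < ε) (x : Rn n) : g0 ε x = Real.exp (-(1 / (2 * ε)) * ‖x‖ ^ 2) := by
  rw [g0, dif_pos h]
  show Real.exp (-(1 / (2 * ε)) * ‖x‖ ^ 2) • (1 : ℂ) = _
  simp

/-- real pairing of points -/
def dp (p x : Rn n) : ℝ := ∑ j, p j * x j
lemma dp_tg (c : ℝ) (p : Rn n) : (fun x : Rn n => c * dp p x).HasTemperateGrowth := by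
  have h : (fun x : Rn n => c * dp p x) = fun x => (c • innerSL ℝ p) x := by
    ext x; simp [dp, PiLp.inner_apply, mul_comm]
  rw [h]; exact (c • innerSL ℝ p).hasTemperateGrowth
lemma nsq (x : Rn n) : ‖x‖ ^ 2 = ∑ j, x j ^ 2 := by
  rw [EuclideanSpace.norm_eq, Real.sq_sqrt (by positivity)]; simp
lemma nsq_sub (x p : Rn n) (c : ℝ) : ‖x - c • p‖ ^ 2 = ‖x‖ ^ 2 - 2 * c * dp p x + c ^ 2 * ‖p‖ ^ 2 := by
  simp only [nsq, dp, Finset.mul_sum, ← Finset.sum_sub_distrib, ← Finset.sum_add_distrib]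
  refine Finset.sum_congr rfl fun j _ => ?_
  simp; ring

def GS (ε : ℝ) (p : Rn n) (t : ℝ) : SR n :=
  Complex.exp (Complex.I * ((-(n * t / 2) - sin t * cos t * ‖p‖ ^ 2 / (2 * ε) : ℝ) : ℂ)) •
    mulS (ph (fun x => (cos t / ε) * dp p x)) (compSubConstCLM ℂ (sin t • p) (g0 ε))

lemma GS_apply (h : 0 < ε) (p : Rn n) (t : ℝ) (x : Rn n) : GS ε p t x =
    Complex.exp (-(Complex.I * n * t / 2) + (-((‖x‖ ^ 2 : ℝ) : ℂ) / 2 + Complex.I * Complex.exp (-(Complex.I * t)) * dp p x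
      + (Complex.exp (-(Complex.I * t)) ^ 2 - 1) / 4 * ((‖p‖ ^ 2 : ℝ) : ℂ)) / ε) := by
  have hz : Complex.exp (-(Complex.I * t)) = cos t - Complex.I * sin t := by
    rw [show -(Complex.I * t) = ((-t : ℝ) : ℂ) * Complex.I by push_cast; ring, Complex.exp_mul_I, ← Complex.ofReal_cos, ← Complex.ofReal_sin]
    simp; ring
  rw [GS, smul_ap, mulS_apply (ph_tg (dp_tg _ _)), compSubConstCLM_apply, g0_apply h, nsq_sub, ph, hz]
  rw [Complex.ofReal_exp, ← Complex.exp_add, ← Complex.exp_add]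
  congr 1
  have hI : Complex.I ^ 2 = -1 := Complex.I_sq
  have hs : ((sin t : ℝ) : ℂ) ^ 2 = 1 - ((cos t : ℝ) : ℂ) ^ 2 := by
    rw [← Complex.ofReal_pow, Real.sin_sq]; push_cast; ring
  have hε : (ε : ℂ) ≠ 0 := by exact_mod_cast h.ne'
  push_cast
  push_cast at hs
  field_simp
  linear_combination (8*Complex.sin t * dp p x - 2*(↑‖p‖)^2 * Complex.sin t ^2 ) * hI + (-2:ℂ) * ((‖p‖ : ℂ)) ^ 2 * hs

/-- e^{-it} -/
def zz (t : ℝ) : ℂ := Complex.exp (-(Complex.I * t))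
lemma zz_norm (t : ℝ) : ‖zz t‖ = 1 := by simp [zz, Complex.norm_exp]

lemma GS_D (h : 0 < ε) (p : Rn n) (t : ℝ) (j : Fin n) :
    Dop j (GS ε p t) = (ε : ℂ)⁻¹ • ((Complex.I * zz t * p j) • GS ε p t - Xop j (GS ε p t)) := by
  ext x
  rw [Dop_apply, ← (SR_diff (GS ε p t) x).lineDeriv_eq_fderiv]
  apply HasLineDerivAt.lineDeriv
  have e : ∀ s : ℝ, GS ε p t (x + s • ej j) = Complex.exp (-(Complex.I * n * t / 2) + (-((‖x‖ ^ 2 : ℝ) + 2 * s * x j + s ^ 2) / 2 + Complex.I * zz t * (dp p x + s * p j)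
      + (zz t ^ 2 - 1) / 4 * ((‖p‖ ^ 2 : ℝ) : ℂ)) / ε) := by
    intro s
    have h1 : ‖x + s • ej j‖ ^ 2 = ‖x‖ ^ 2 + 2 * s * x j + s ^ 2 := by
      rw [norm_add_sq_real, inner_smul_right, inner_ej, norm_smul]
      simp [ej]; ring
    have h2 : dp p (x + s • ej j) = dp p x + s * p j := by
      simp [dp, mul_add, Finset.sum_add_distrib, ej]; ring
    rw [GS_apply h, h1, h2, zz]; push_cast; rfl
  unfold HasLineDerivAt
  simp only [e]
  have hid : HasDerivAt (fun s : ℝ => (s : ℂ)) 1 0 := Complex.ofRealCLM.hasDerivAt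
  have h3 : HasDerivAt (fun s : ℝ => -(Complex.I * n * t / 2) + (-((‖x‖ ^ 2 : ℝ) + 2 * s * x j + s ^ 2) / 2 + Complex.I * zz t * (dp p x + s * p j)
      + (zz t ^ 2 - 1) / 4 * ((‖p‖ ^ 2 : ℝ) : ℂ)) / (ε : ℂ)) ((- x j + Complex.I * zz t * p j) / ε) 0 := by
    have a1 := ((((hid.const_mul 2).mul_const (x j : ℂ)).const_add ((‖x‖ ^ 2 : ℝ) : ℂ)).add (hid.pow 2)).neg.div_const 2
    have a2 := ((hid.mul_const (p j : ℂ)).const_add (dp p x : ℂ)).const_mul (Complex.I * zz t)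
    have := (((a1.add a2).add_const ((zz t ^ 2 - 1) / 4 * ((‖p‖ ^ 2 : ℝ) : ℂ))).div_const (ε : ℂ)).const_add (-(Complex.I * n * t / 2))
    refine HasDerivAt.congr_deriv this ?_
    simp
    ring
  refine HasDerivAt.congr_deriv h3.cexp ?_
  have := e 0
  simp only [zero_smul, add_zero] at this
  rw [smul_ap, sub_ap, smul_ap, Xop_apply, this]
  push_cast
  ring

def HH (ε : ℝ) (φ : SR n) : SR n :=
  (Complex.I * ε / 2) • LapS φ - (Complex.I / (2 * ε)) • ∑ j, Xop j (Xop j φ)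

lemma GS_HH (h : 0 < ε) (p : Rn n) (t : ℝ) (x : Rn n) :
    HH ε (GS ε p t) x = (-(Complex.I * n / 2) + (zz t * dp p x - Complex.I * zz t ^ 2 * ((‖p‖ ^ 2 : ℝ) : ℂ) / 2) / ε) * GS ε p t x := by
  have hε : (ε : ℂ) ≠ 0 := by exact_mod_cast h.ne'
  have hj : ∀ j, (Complex.I * ε / 2) * (Dop j (Dop j (GS ε p t))) x - (Complex.I / (2 * ε)) * Xop j (Xop j (GS ε p t)) x
      = (-(Complex.I / 2) + (zz t * (p j * x j) - Complex.I * zz t ^ 2 * (p j) ^ 2 / 2) / ε) * GS ε p t x := by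
    intro j
    have hI : Complex.I ^ 2 = -1 := Complex.I_sq
    rw [GS_D h, map_smul, map_sub, map_smul, GS_D h, Dop_Xop, GS_D h]
    simp only [smul_ap, sub_ap, add_ap, Xop_apply, if_true]
    field_simp
    have hI3 : Complex.I ^ 3 = - Complex.I := by rw [pow_succ, hI]; ring
    ring_nf
    simp only [hI, hI3]
    ring
  rw [HH, sub_ap, smul_ap, smul_ap, LapS, sum_ap, sum_ap, Finset.mul_sum, Finset.mul_sum, ← Finset.sum_sub_distrib,
    Finset.sum_congr rfl (fun j _ => hj j), ← Finset.sum_mul]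
  congr 1
  rw [Finset.sum_add_distrib, ← Finset.sum_div, Finset.sum_sub_distrib, ← Finset.mul_sum, ← Finset.sum_div, ← Finset.mul_sum]
  rw [nsq, dp]
  push_cast
  simp
  ring

lemma zz_deriv (t : ℝ) : HasDerivAt zz (-(Complex.I) * zz t) t := by
  have hid : HasDerivAt (fun s : ℝ => (s : ℂ)) 1 t := Complex.ofRealCLM.hasDerivAt
  have : HasDerivAt zz _ t := (hid.const_mul Complex.I).neg.cexp
  refine this.congr_deriv ?_
  show Complex.exp (-(Complex.I * t)) * _ = _
  rw [zz]; ring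

lemma GS_deriv (h : 0 < ε) (p : Rn n) (t : ℝ) (x : Rn n) :
    HasDerivAt (fun s => GS ε p s x) (HH ε (GS ε p t) x) t := by
  rw [GS_HH h]
  have e : (fun s => GS ε p s x) = fun s => Complex.exp (-(Complex.I * n * s / 2) + (-((‖x‖ ^ 2 : ℝ) : ℂ) / 2 + Complex.I * zz s * dp p x
      + (zz s ^ 2 - 1) / 4 * ((‖p‖ ^ 2 : ℝ) : ℂ)) / ε) := by
    ext s; rw [GS_apply h]; rfl
  have hid : HasDerivAt (fun s : ℝ => (s : ℂ)) 1 t := Complex.ofRealCLM.hasDerivAt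
  have a1 := ((hid.const_mul (Complex.I * n)).div_const 2).neg
  have a2 := ((zz_deriv t).const_mul Complex.I).mul_const (dp p x : ℂ)
  have a3 := ((((zz_deriv t).pow 2).sub_const 1).div_const 4).mul_const ((‖p‖ ^ 2 : ℝ) : ℂ)
  have h3 := (a1.add (((a2.const_add (-((‖x‖ ^ 2 : ℝ) : ℂ) / 2)).add a3).div_const (ε : ℂ))).cexp
  have h4 : HasDerivAt (fun s => Complex.exp (-(Complex.I * n * s / 2) + (-((‖x‖ ^ 2 : ℝ) : ℂ) / 2 + Complex.I * zz s * dp p x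
      + (zz s ^ 2 - 1) / 4 * ((‖p‖ ^ 2 : ℝ) : ℂ)) / ε)) _ t := h3
  rw [e]
  refine h4.congr_deriv ?_
  rw [GS_apply h, mul_comm]
  have hI : Complex.I ^ 2 = -1 := Complex.I_sq
  congr 1
  simp
  ring_nf
  simp only [hI]
  ring

lemma zz_cont : Continuous zz := by unfold zz; fun_prop
lemma dp_cont (p : Rn n) : Continuous (dp p) := by unfold dp; fun_prop

lemma GS_cont (h : 0 < ε) (p : Rn n) : Continuous (fun q : ℝ × Rn n => GS ε p q.1 q.2) := by
  simp only [GS_apply h]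
  have := dp_cont p
  have h2 : Continuous fun q : ℝ × Rn n => dp p q.2 := this.comp continuous_snd
  fun_prop

lemma GS_HH_cont (h : 0 < ε) (p : Rn n) : Continuous (fun q : ℝ × Rn n => HH ε (GS ε p q.1) q.2) := by
  simp only [GS_HH h]
  have h1 := GS_cont h p
  have h2 : Continuous fun q : ℝ × Rn n => dp p q.2 := (dp_cont p).comp continuous_snd
  have h3 : Continuous fun q : ℝ × Rn n => zz q.1 := zz_cont.comp continuous_fst
  fun_prop

lemma nrm_tr (a : Rn n) (φ : SR n) : nrm (compSubConstCLM ℂ a φ) = nrm φ := by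
  have : nrm (compSubConstCLM ℂ a φ) ^ 2 = nrm φ ^ 2 := by
    rw [nrm_sq, nrm_sq]
    simp only [compSubConstCLM_apply]
    exact integral_sub_right_eq_self (fun x => ‖φ x‖ ^ 2) a
  exact (pow_left_inj₀ (nrm_nonneg _) (nrm_nonneg _) two_ne_zero).mp this

lemma X_tr (j : Fin n) (a : Rn n) (φ : SR n) : Xop j (compSubConstCLM ℂ a φ) = compSubConstCLM ℂ a (Xop j φ) + (a j : ℂ) • compSubConstCLM ℂ a φ := by
  ext x
  rw [add_ap, smul_ap, Xop_apply, compSubConstCLM_apply, compSubConstCLM_apply, Xop_apply]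
  simp; ring

lemma GS_nrm (p : Rn n) (t : ℝ) : nrm (GS ε p t) = nrm (g0 ε : SR n) := by
  rw [GS, nrm_smul, nrm_unimod (ph_tg (dp_tg _ _)) (ph_norm _), nrm_tr, mul_comm Complex.I, Complex.norm_exp_ofReal_mul_I, one_mul]

lemma GS_nrmX (p : Rn n) (t : ℝ) (j : Fin n) : nrm (Xop j (GS ε p t)) ≤ nrm (Xop j (g0 ε : SR n)) + ‖p‖ * nrm (g0 ε : SR n) := by
  have hX : Xop j (mulS (ph (fun x => (cos t / ε) * dp p x)) (compSubConstCLM ℂ (sin t • p) (g0 ε)))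
     = mulS (ph (fun x => (cos t / ε) * dp p x)) (Xop j (compSubConstCLM ℂ (sin t • p) (g0 ε))) := by
    ext x; rw [Xop_apply, mulS_apply (ph_tg (dp_tg _ _)), mulS_apply (ph_tg (dp_tg _ _)), Xop_apply]; ring
  rw [GS, map_smul, hX, nrm_smul, nrm_unimod (ph_tg (dp_tg _ _)) (ph_norm _), X_tr, mul_comm Complex.I, Complex.norm_exp_ofReal_mul_I, one_mul]
  refine (nrm_add _ _).trans ?_
  rw [nrm_smul, nrm_tr, nrm_tr]
  gcongr
  · exact nrm_nonneg _
  · have h1 : |p j| ≤ ‖p‖ := PiLp.norm_apply_le p j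
    have h2 := abs_sin_le_one t
    have : ‖(((sin t • p) j : ℝ) : ℂ)‖ = |sin t| * |p j| := by rw [Complex.norm_real]; simp
    rw [this]
    nlinarith [abs_nonneg (p j), abs_nonneg (sin t)]

lemma GS_nrmD (h : 0 < ε) (p : Rn n) (j : Fin n) : ∃ C, ∀ t, nrm (Dop j (GS ε p t)) ≤ C := by
  refine ⟨ε⁻¹ * (‖p‖ * nrm (g0 ε : SR n) + (nrm (Xop j (g0 ε : SR n)) + ‖p‖ * nrm (g0 ε : SR n))), fun t => ?_⟩
  rw [GS_D h, nrm_smul, norm_inv, Complex.norm_real, Real.norm_eq_abs, abs_of_pos h]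
  gcongr
  refine (nrm_sub _ _).trans (add_le_add ?_ (GS_nrmX p t j))
  rw [nrm_smul, GS_nrm]
  gcongr
  · exact nrm_nonneg _
  · have h1 : |p j| ≤ ‖p‖ := PiLp.norm_apply_le p j
    simpa [zz_norm] using h1

end

section
open SchwartzMap FourierTransform
variable {n : ℕ} {ε : ℝ}

lemma gauss_int {b : ℂ} (hb : 0 < b.re) (c : Fin n → ℂ) :
    ∫ v : Rn n, Complex.exp (-b * ((‖v‖ ^ 2 : ℝ) : ℂ) + ∑ j, c j * v j) =
      (π / b) ^ ((Fintype.card (Fin n) : ℂ) / 2) * Complex.exp ((∑ j, c j ^ 2) / (4 * b)) := by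
  rw [← (PiLp.volume_preserving_toLp (Fin n)).integral_comp
    (MeasurableEquiv.toLp 2 _).measurableEmbedding, ← GaussianFourier.integral_cexp_neg_mul_sum_add hb c]
  congr 1
  ext v
  rw [nsq]; push_cast; rfl

lemma F_gauss {b : ℂ} (hb : 0 < b.re) (c0 : ℂ) (p : Rn n) (φ : SR n)
    (hφ : ∀ y, φ y = Complex.exp (-b * ((‖y‖ ^ 2 : ℝ) : ℂ) + 2 * Complex.I * b * dp p y + c0)) (ξ : Rn n) :
    𝓕 φ ξ = (π / b) ^ ((Fintype.card (Fin n) : ℂ) / 2) *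
      Complex.exp (c0 - b * ((‖p‖ ^ 2 : ℝ) : ℂ) + 2 * π * dp p ξ - π ^ 2 * ((‖ξ‖ ^ 2 : ℝ) : ℂ) / b) := by
  have hb0 : b ≠ 0 := by rintro rfl; simp at hb
  rw [fourier_coe, Real.fourier_eq']
  have e : ∀ y : Rn n, Complex.exp (((-2 * π * inner ℝ y ξ : ℝ) : ℂ) * Complex.I) • φ y =
      Complex.exp c0 * Complex.exp (-b * ((‖y‖ ^ 2 : ℝ) : ℂ) + ∑ j, (2 * Complex.I * (b * p j - π * ξ j)) * y j) := by
    intro y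
    rw [hφ, smul_eq_mul, ← Complex.exp_add, ← Complex.exp_add]
    congr 1
    have h1 : inner ℝ y ξ = ∑ j, ξ j * y j := by simp [PiLp.inner_apply]
    rw [h1, dp]
    push_cast
    simp only [mul_sub, sub_mul, Finset.sum_sub_distrib, Finset.mul_sum, Finset.sum_mul]
    have e1 : ∑ x, 2 * Complex.I * (b * (p x : ℂ)) * (y x : ℂ) = ∑ x, 2 * Complex.I * b * ((p x : ℂ) * y x) := Finset.sum_congr rfl fun _ _ => by ring
    have e2 : ∑ x, 2 * Complex.I * (π * (ξ x : ℂ)) * (y x : ℂ) = - ∑ x, -2 * π * ((ξ x : ℂ) * y x) * Complex.I := by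
      rw [← Finset.sum_neg_distrib]; exact Finset.sum_congr rfl fun _ _ => by ring
    rw [e1, e2]; ring
  have e' : (fun y : Rn n => Complex.exp (((-2 * π * inner ℝ y ξ : ℝ) : ℂ) * Complex.I) • φ y) = _ := funext e
  rw [e', integral_const_mul, gauss_int hb]
  rw [mul_left_comm, ← Complex.exp_add]
  congr 2
  rw [nsq, nsq, dp]
  push_cast
  have : ∀ j, (2 * Complex.I * (b * (p j : ℂ) - π * (ξ j : ℂ))) ^ 2 = (4 * b) * (- b * (p j) ^ 2 + 2 * π * (p j * ξ j) - π ^ 2 * (ξ j) ^ 2 / b) := by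
    intro j
    rw [mul_pow, mul_pow, Complex.I_sq]; field_simp; ring
  rw [Finset.sum_congr rfl (fun j _ => this j), ← Finset.mul_sum, mul_div_cancel_left₀ _ (by simpa using hb0)]
  rw [Finset.sum_sub_distrib, Finset.sum_add_distrib, ← Finset.mul_sum, ← Finset.mul_sum, ← Finset.sum_div, ← Finset.mul_sum]
  ring

lemma SS_GS (h : 0 < ε) {τ : ℝ} (hc : cos τ ≠ 0) : ∃ κ : ℂ, ‖κ‖ = 1 ∧ ∀ p : Rn n, SS ε τ (GS ε p τ) = κ • GS ε p 0 := by
  have hε : (ε : ℂ) ≠ 0 := by exact_mod_cast h.ne'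
  have hcc : ((cos τ : ℝ) : ℂ) ≠ 0 := by exact_mod_cast hc
  have hz : zz τ = cos τ - Complex.I * sin τ := by
    rw [zz, show -(Complex.I * τ) = ((-τ : ℝ) : ℂ) * Complex.I by push_cast; ring, Complex.exp_mul_I, ← Complex.ofReal_cos, ← Complex.ofReal_sin]
    simp; ring
  have hz0 : zz τ ≠ 0 := by rw [zz]; exact Complex.exp_ne_zero _
  have hI : Complex.I ^ 2 = -1 := Complex.I_sq
  have hs : ((sin τ : ℝ) : ℂ) ^ 2 = 1 - ((cos τ : ℝ) : ℂ) ^ 2 := by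
    rw [← Complex.ofReal_pow, Real.sin_sq]; push_cast; ring
  set b : ℂ := cos τ * zz τ / (2 * ε) with hb
  have hb0 : b ≠ 0 := by rw [hb]; exact div_ne_zero (mul_ne_zero hcc hz0) (mul_ne_zero two_ne_zero hε)
  have hbre : 0 < b.re := by
    have : b = ((cos τ ^ 2 / (2 * ε) : ℝ) : ℂ) - Complex.I * ((cos τ * sin τ / (2 * ε) : ℝ) : ℂ) := by
      rw [hb, hz]; push_cast; ring
    rw [this]
    simp only [Complex.sub_re, Complex.ofReal_re, Complex.I_mul_re, Complex.ofReal_im]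
    have := sq_pos_of_ne_zero hc
    have : 0 < cos τ ^ 2 / (2 * ε) := by positivity
    linarith
  set b0 : ℂ := ((1 / (2 * ε) : ℝ) : ℂ) with hb00
  have hb0re : 0 < b0.re := by rw [hb00, Complex.ofReal_re]; positivity
  have hb0n : b0 ≠ 0 := by rintro h; rw [h] at hb0re; simp at hb0re
  set κ : ℂ := ((|cos τ| ^ ((n : ℝ) / 2) : ℝ) : ℂ) * ((π / b) ^ ((Fintype.card (Fin n) : ℂ) / 2) * Complex.exp (-(Complex.I * n * τ / 2)) / (π / b0) ^ ((Fintype.card (Fin n) : ℂ) / 2)) with hκ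
  have hpb : (π / b0) ^ ((Fintype.card (Fin n) : ℂ) / 2) ≠ 0 := by
    have : (π : ℂ) ≠ 0 := by exact_mod_cast Real.pi_ne_zero
    rw [Complex.cpow_def_of_ne_zero (div_ne_zero this hb0n)]
    exact Complex.exp_ne_zero _
  have key : ∀ p : Rn n, SS ε τ (GS ε p τ) = κ • GS ε p 0 := by
    intro p
    have h0 : Lam ε τ (GS ε p τ) = κ • EE (ε * tan τ / 2) (GS ε p 0) := by
      set φ : SR n := mulS (ph (fun y => (sin τ * cos τ / (2 * ε)) * ‖y‖ ^ 2)) (scl (cos τ) (GS ε p τ)) with hφ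
      have f1 := F_gauss hbre (-(Complex.I * n * τ / 2) + (zz τ ^ 2 - 1) / 4 * ((‖p‖ ^ 2 : ℝ) : ℂ) / ε) p φ (by
        intro y
        rw [hφ, mulS_apply (ph_tg (cnormsq_tg _)), scl_apply hc, GS_apply h, ph, ← Complex.exp_add]
        congr 1
        rw [show Complex.exp (-(Complex.I * τ)) = zz τ from rfl]
        have d1 : dp p (cos τ • y) = cos τ * dp p y := by simp [dp, Finset.mul_sum]; exact Finset.sum_congr rfl fun _ _ => by ring
        have d2 : ‖cos τ • y‖ ^ 2 = cos τ ^ 2 * ‖y‖ ^ 2 := by rw [norm_smul, mul_pow]; simp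
        rw [d1, d2, hb, hz]
        push_cast
        field_simp
        ring)
      have f0 := F_gauss hb0re 0 p (GS ε p 0) (by
        intro y
        rw [GS_apply h, hb00]
        congr 1
        push_cast
        simp
        field_simp)
      apply F_inj
      rw [Lam, ← hφ]
      ext ξ
      rw [FourierTransform.fourier_smul, FourierTransform.fourier_smul, smul_ap, smul_ap, F_E, mulS_apply (Em_tg _), f1, f0, Em, ph, hκ]
      rw [tan_eq_sin_div_cos]
      have : Complex.exp (-(Complex.I * n * τ / 2) + (zz τ ^ 2 - 1) / 4 * ((‖p‖ ^ 2 : ℝ) : ℂ) / ε - b * ((‖p‖ ^ 2 : ℝ) : ℂ) + 2 * π * dp p ξ - π ^ 2 * ((‖ξ‖ ^ 2 : ℝ) : ℂ) / b)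
        = Complex.exp (-(Complex.I * n * τ / 2)) * (Complex.exp (Complex.I * (((-4 * π ^ 2 * (ε * (sin τ / cos τ) / 2)) * ‖ξ‖ ^ 2 : ℝ) : ℂ)) *
          Complex.exp (0 - b0 * ((‖p‖ ^ 2 : ℝ) : ℂ) + 2 * π * dp p ξ - π ^ 2 * ((‖ξ‖ ^ 2 : ℝ) : ℂ) / b0)) := by
        rw [← Complex.exp_add, ← Complex.exp_add]
        congr 1
        have hbi : 1 / b = 2 * ε * (1 + Complex.I * (sin τ / cos τ)) := by
          rw [div_eq_iff hb0, hb, hz]; field_simp; linear_combination (((sin τ : ℝ) : ℂ) ^ 2) * hI - hs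
        have hb0i : 1 / b0 = 2 * ε := by rw [hb00]; push_cast; field_simp
        have hbp : (zz τ ^ 2 - 1) / 4 / ε - b = - b0 := by
          rw [hb, hb00, hz]; push_cast; push_cast at hs; field_simp
          linear_combination 2 * (Complex.sin τ)^2 * hI - 2 * hs
        rw [div_eq_mul_one_div _ b, div_eq_mul_one_div _ b0, hbi, hb0i]
        push_cast
        push_cast at hbp
        linear_combination (‖p‖ : ℂ) ^ 2 * hbp
      rw [this]
      field_simp
    rw [SS, h0, E_smul, E_neg]
  refine ⟨κ, ?_, key⟩
  have h1 := congrArg nrm (key 0)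
  rw [SS_nrm hc, nrm_smul, GS_nrm, GS_nrm] at h1
  have h2 : nrm (g0 ε : SR n) ≠ 0 := by
    intro h3
    have h4 : (g0 ε : SR n) = 0 := SR_eq_of_nrm (by simpa using h3)
    have := g0_apply h (0 : Rn n)
    rw [h4] at this
    simp at this
  exact (mul_right_cancel₀ h2 (by rw [one_mul]; exact h1)).symm

end

section
open SchwartzMap FourierTransform
variable {n : ℕ} {ε : ℝ}

lemma GS_dense (h : 0 < ε) :
    (Submodule.span ℂ (Set.range fun p : Rn n => toL2 (GS ε p 0))).topologicalClosure = ⊤ := by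
  rw [Submodule.topologicalClosure_eq_top_iff, Submodule.eq_bot_iff]
  intro w hw
  have hG : ∀ p : Rn n, ∫ x, conj (GS ε p 0 x) * w x = 0 := by
    intro p
    have h1 : inner ℂ (toL2 (GS ε p 0)) w = 0 := (Submodule.mem_orthogonal _ w).mp hw _ (Submodule.subset_span ⟨p, rfl⟩)
    rw [L2.inner_def] at h1
    rw [← h1]
    refine integral_congr_ae ?_
    filter_upwards [SchwartzMap.coeFn_toLp (GS ε p 0) 2 volume] with x hx
    have : (toL2 (GS ε p 0)) x = GS ε p 0 x := hx
    rw [this, RCLike.inner_apply, mul_comm]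
  set F : Rn n → ℂ := fun x => g0 ε x * w x with hF
  have hFi : Integrable F := by
    have h1 : MemLp (g0 ε : SR n) 2 volume := (g0 ε).memLp 2 volume
    exact h1.integrable_mul (Lp.memLp w)
  have hFF : ∀ ξ : Rn n, 𝓕 F ξ = 0 := by
    intro ξ
    rw [Real.fourier_eq', ← hG ((2 * π * ε) • ξ)]
    congr 1
    ext x
    have : conj (GS ε ((2 * π * ε) • ξ) 0 x) = Complex.exp (((-2 * π * inner ℝ x ξ : ℝ) : ℂ) * Complex.I) * g0 ε x := by
      have hd : dp ((2 * π * ε) • ξ) x = 2 * π * ε * inner ℝ x ξ := by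
        simp [dp, PiLp.inner_apply, Finset.mul_sum, mul_assoc]
      rw [GS_apply h, ← Complex.exp_conj, g0_apply h, Complex.ofReal_exp, ← Complex.exp_add, hd]
      have hε : (ε : ℂ) ≠ 0 := by exact_mod_cast h.ne'
      have h2 : conj (2 : ℂ) = 2 := Complex.conj_ofNat 2
      congr 1
      simp [h2]
      field_simp
      ring
    rw [this, smul_eq_mul, hF]; ring
  have hS : ∀ k : SR n, ∫ x, F x * k x = 0 := by
    intro k
    have := VectorFourier.integral_fourierIntegral_smul_eq_flip (e := Real.fourierChar) (μ := volume) (ν := volume) (L := innerₗ (Rn n)) (f := F) (g := (𝓕⁻ k : SR n)) Real.continuous_fourierChar (by simpa using continuous_inner) hFi (𝓕⁻ k : SR n).integrable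
    have e1 : ∀ ξ, VectorFourier.fourierIntegral Real.fourierChar volume (innerₗ (Rn n)) F ξ = 0 := hFF
    have e2 : VectorFourier.fourierIntegral Real.fourierChar volume (innerₗ (Rn n)).flip (𝓕⁻ k : SR n) = k := by
      rw [flip_innerₗ ]
      have : 𝓕 (𝓕⁻ k : SR n) = k := FourierTransform.fourier_fourierInv_eq k
      conv_rhs => rw [← this, fourier_coe]
      rfl
    rw [e2] at this
    simp only [e1, zero_mul, integral_zero, smul_eq_mul] at this
    exact this.symm
  have hz : ∀ᵐ x : Rn n, F x = 0 := by
    refine ae_eq_zero_of_integral_contDiff_smul_eq_zero hFi.locallyIntegrable fun g hg hgc => ?_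
    have hgc' : HasCompactSupport (fun x => (g x : ℂ)) := hgc.comp_left (g := fun r : ℝ => (r : ℂ)) (by simp)
    have hg' : ContDiff ℝ (⊤ : ℕ∞) (fun x => (g x : ℂ)) := Complex.ofRealCLM.contDiff.comp hg
    have := hS (hgc'.toSchwartzMap hg')
    rw [← this]
    congr 1; ext x
    rw [Complex.real_smul, mul_comm]; rfl
  refine (Lp.eq_zero_iff_ae_eq_zero).mpr ?_
  filter_upwards [hz] with x hx
  rw [hF] at hx
  have h0 : (g0 ε x : ℂ) ≠ 0 := by rw [g0_apply h]; exact_mod_cast (Real.exp_pos _).ne'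
  simpa [h0] using hx

end

section
open SchwartzMap
variable {n : ℕ} {ε γ : ℝ}

/-! ### cutoffs -/
def bmp (n : ℕ) : ContDiffBump (0 : Rn n) := ⟨1, 2, one_pos, one_lt_two⟩
lemma bmp_cs (n : ℕ) : HasCompactSupport (fun x : Rn n => ((bmp n x : ℝ) : ℂ)) :=
  (bmp n).hasCompactSupport.comp_left (g := fun r : ℝ => (r : ℂ)) (by simp)
lemma bmp_sm (n : ℕ) : ContDiff ℝ (⊤ : ℕ∞) (fun x : Rn n => ((bmp n x : ℝ) : ℂ)) :=
  Complex.ofRealCLM.contDiff.comp (bmp n).contDiff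
def chi (n : ℕ) : SR n := (bmp_cs n).toSchwartzMap (bmp_sm n)
lemma chi_apply (x : Rn n) : chi n x = ((bmp n x : ℝ) : ℂ) := rfl

def KK (n : ℕ) (k : ℕ) : SR n := scl (((k : ℝ) + 1)⁻¹) (chi n)
lemma kne (k : ℕ) : (((k : ℝ) + 1)⁻¹) ≠ 0 := by positivity
lemma KK_apply (k : ℕ) (x : Rn n) : KK n k x = ((bmp n ((((k : ℝ) + 1)⁻¹) • x) : ℝ) : ℂ) := by
  rw [KK, scl_apply (kne k), chi_apply]
lemma KK_conj (k : ℕ) (x : Rn n) : conj (KK n k x) = KK n k x := by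
  rw [KK_apply, Complex.conj_ofReal]
lemma KK_le (k : ℕ) (x : Rn n) : ‖KK n k x‖ ≤ 1 := by
  rw [KK_apply, Complex.norm_real, Real.norm_eq_abs, abs_of_nonneg (bmp n).nonneg]
  exact (bmp n).le_one
lemma KK_one (k : ℕ) (x : Rn n) (h : ‖x‖ ≤ k + 1) : KK n k x = 1 := by
  rw [KK_apply, (bmp n).one_of_mem_closedBall]; · simp
  simp only [Metric.mem_closedBall, dist_zero_right, norm_smul, bmp]
  rw [Real.norm_eq_abs, abs_of_pos (by positivity), inv_mul_le_iff₀ (by positivity)]; linarith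
lemma KK_zero (k : ℕ) (x : Rn n) (h : 2 * ((k : ℝ) + 1) ≤ ‖x‖) : KK n k x = 0 := by
  rw [KK_apply, (bmp n).zero_of_le_dist]; · simp
  simp only [dist_zero_right, norm_smul, bmp]
  rw [Real.norm_eq_abs, abs_of_pos (by positivity), le_inv_mul_iff₀ (by positivity)]; linarith
lemma KK_tendsto (x : Rn n) : Tendsto (fun k => KK n k x) atTop (𝓝 1) := by
  refine tendsto_const_nhds.congr' ?_
  obtain ⟨N, hN⟩ := exists_nat_ge ‖x‖
  filter_upwards [eventually_ge_atTop N] with k hk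
  rw [KK_one]
  have : (N : ℝ) ≤ k := by exact_mod_cast hk
  linarith
lemma SR_bdd (φ : SR n) : ∃ C, 0 ≤ C ∧ ∀ x, ‖φ x‖ ≤ C := by
  obtain ⟨C, hC⟩ := φ.decay' 0 0
  refine ⟨C, ?_, fun x => by have h := hC x; rw [pow_zero, one_mul, norm_iteratedFDeriv_zero] at h; exact h⟩
  have := hC 0
  exact le_trans (by positivity) this
lemma KK_D (n : ℕ) : ∃ C, 0 ≤ C ∧ ∀ (k : ℕ) (j : Fin n) x, ‖Dop j (KK n k) x‖ ≤ C * ((k : ℝ) + 1)⁻¹ ∧ ‖Dop j (Dop j (KK n k)) x‖ ≤ C * ((k : ℝ) + 1)⁻¹ := by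
  choose C1 h1 h1' using fun j => SR_bdd (Dop j (chi n))
  choose C2 h2 h2' using fun j => SR_bdd (Dop j (Dop j (chi n)))
  refine ⟨∑ j, C1 j + ∑ j, C2 j, add_nonneg (Finset.sum_nonneg fun j _ => h1 j) (Finset.sum_nonneg fun j _ => h2 j), fun k j x => ?_⟩
  have hk : (0 : ℝ) < ((k : ℝ) + 1)⁻¹ := by positivity
  have hk1 : ((k : ℝ) + 1)⁻¹ ≤ 1 := inv_le_one_of_one_le₀ (by linarith [Nat.cast_nonneg (α := ℝ) k])
  have e1 : C1 j ≤ ∑ j, C1 j := Finset.single_le_sum (fun j _ => h1 j) (Finset.mem_univ j)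
  have e2 : C2 j ≤ ∑ j, C2 j := Finset.single_le_sum (fun j _ => h2 j) (Finset.mem_univ j)
  have s1 : 0 ≤ ∑ j, C1 j := (h1 j).trans e1
  have s2 : 0 ≤ ∑ j, C2 j := (h2 j).trans e2
  constructor
  · rw [KK, scl_D (kne k), smul_ap, scl_apply (kne k), norm_mul, Complex.norm_real, Real.norm_eq_abs, abs_of_pos hk, mul_comm]
    have := h1' j ((((k : ℝ) + 1)⁻¹) • x)
    gcongr; linarith
  · rw [KK, scl_D (kne k), map_smul, scl_D (kne k), smul_ap, smul_ap, scl_apply (kne k), norm_mul, norm_mul, Complex.norm_real, Real.norm_eq_abs, abs_of_pos hk, mul_comm]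
    have := h2' j ((((k : ℝ) + 1)⁻¹) • x)
    have a := norm_nonneg (((Dop j) ((Dop j) (chi n))) ((((k : ℝ) + 1)⁻¹) • x))
    gcongr
    calc _ ≤ 1 * ‖((Dop j) ((Dop j) (chi n))) ((((k : ℝ) + 1)⁻¹) • x)‖ := by gcongr
      _ ≤ _ := by linarith

abbrev mK (k : ℕ) (φ : SR n) : SR n := mulS (KK n k) φ
lemma mK_apply (k : ℕ) (φ : SR n) (x : Rn n) : mK k φ x = KK n k x * φ x := mulS_apply (KK n k).hasTemperateGrowth φ x
lemma mK_nrm (k : ℕ) (φ : SR n) : nrm (mK k φ) ≤ nrm φ := by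
  have := nrm_le_of_pt (φ := mK k φ) (ψ := φ) (B := 1) zero_le_one (fun x => by
    rw [mK_apply, norm_mul]; gcongr; exact KK_le k x)
  simpa using this
lemma mK_ip (k : ℕ) (φ ψ : SR n) : ip (mK k φ) ψ = ∫ x, KK n k x * (conj (φ x) * ψ x) := by
  rw [ip_eq]; congr 1; ext x; rw [mK_apply, map_mul, KK_conj]; ring
lemma mK_tendsto (φ ψ : SR n) : Tendsto (fun k => ip (mK k φ) ψ) atTop (𝓝 (ip φ ψ)) := by
  simp only [mK_ip]
  rw [ip_eq]
  have hi : Integrable (fun x => conj (φ x) * ψ x) := by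
    have h1 : MemLp ψ 2 volume := ψ.memLp 2 volume
    have h2 : MemLp (cj φ) 2 volume := (cj φ).memLp 2 volume
    exact h2.integrable_mul h1
  refine tendsto_integral_of_dominated_convergence (fun x => ‖conj (φ x) * ψ x‖) ?_ hi.norm ?_ ?_
  · intro k
    exact ((KK n k).continuous.aestronglyMeasurable).mul hi.1
  · intro k
    refine Eventually.of_forall fun x => ?_
    rw [norm_mul]
    exact mul_le_of_le_one_left (norm_nonneg _) (KK_le k x)
  · refine Eventually.of_forall fun x => ?_
    simpa using (KK_tendsto x).mul_const (conj (φ x) * ψ x)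

/-! ### antisymmetry -/
lemma HH_anti (φ ψ : SR n) : ip φ (HH ε ψ) = - ip (HH ε φ) ψ := by
  have e1 : ip φ (LapS ψ) = ip (LapS φ) ψ := by
    rw [LapS, LapS, ip_sum_right, ip_sum_left]
    refine Finset.sum_congr rfl fun j _ => ?_
    have a := ip_D j φ (Dop j ψ)
    have b := ip_D j (Dop j φ) ψ
    rw [b, a, neg_neg]
  have e2 : ip φ (∑ j, Xop j (Xop j ψ)) = ip (∑ j, Xop j (Xop j φ)) ψ := by
    rw [ip_sum_right, ip_sum_left]
    refine Finset.sum_congr rfl fun j _ => ?_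
    rw [ip_X, ip_X]
  rw [HH, HH, ip_sub_right, ip_sub_left, ip_smul_right, ip_smul_right, ip_smul_left, ip_smul_left, e1, e2]
  have h2 : conj (2 : ℂ) = 2 := Complex.conj_ofNat 2
  simp [h2]
  ring

lemma HH_add (φ ψ : SR n) : HH ε (φ + ψ) = HH ε φ + HH ε ψ := by
  simp only [HH, LapS_add, map_add, Finset.sum_add_distrib, smul_add]; abel

lemma hf_HH (h : 0 < ε) (φ ψ : SR n) : hf ε φ ψ = 2 * Complex.I * ε * ip φ (HH ε ψ) := by
  have hε : (ε : ℂ) ≠ 0 := by exact_mod_cast h.ne'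
  have hI : Complex.I ^ 2 = -1 := Complex.I_sq
  rw [hf, HH, ip_sub_right, ip_smul_right, ip_smul_right, LapS, ip_sum_right, ip_sum_right, Finset.sum_add_distrib, ← Finset.mul_sum]
  have e1 : ∑ j, ip φ (Dop j (Dop j ψ)) = - ∑ j, ip (Dop j φ) (Dop j ψ) := by
    rw [← Finset.sum_neg_distrib]; refine Finset.sum_congr rfl fun j _ => ?_; rw [ip_D, neg_neg]
  have e2 : ∑ j, ip φ (Xop j (Xop j ψ)) = ∑ j, ip (Xop j φ) (Xop j ψ) := by
    refine Finset.sum_congr rfl fun j _ => ?_; rw [ip_X]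
  rw [e1, e2]
  push_cast
  field_simp
  ring_nf
  simp only [hI]
  ring

lemma KK_comm (n : ℕ) (h : 0 < ε) : ∃ C, 0 ≤ C ∧ ∀ (k : ℕ) (φ : SR n) B, nrm φ ≤ B → (∀ j, nrm (Dop j φ) ≤ B) →
    nrm (mK k (HH ε φ) - HH ε (mK k φ)) ≤ C * B * ((k : ℝ) + 1)⁻¹ := by
  obtain ⟨C, hC, hK⟩ := KK_D n
  refine ⟨ε / 2 * (n * (3 * C)), by positivity, fun k φ B h0 hD => ?_⟩
  have e : mK k (HH ε φ) - HH ε (mK k φ) = (-(Complex.I * ε / 2)) • ∑ j, (mulS (Dop j (Dop j (KK n k))) φ + (2 : ℂ) • mulS (Dop j (KK n k)) (Dop j φ)) := by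
    have t0 := (KK n k).hasTemperateGrowth
    have hD1 : ∀ j (ψ : SR n), Dop j (mK k ψ) = mulS (Dop j (KK n k)) ψ + mK k (Dop j ψ) := fun j ψ =>
      Dop_mulS j t0 (Dop j (KK n k)).hasTemperateGrowth (fun x => (Dop_apply j _ x).symm) ψ
    have hD2 : ∀ j (ψ : SR n), Dop j (mulS (Dop j (KK n k)) ψ) = mulS (Dop j (Dop j (KK n k))) ψ + mulS (Dop j (KK n k)) (Dop j ψ) := fun j ψ =>
      Dop_mulS j (Dop j (KK n k)).hasTemperateGrowth (Dop j (Dop j (KK n k))).hasTemperateGrowth (fun x => (Dop_apply j _ x).symm) ψ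
    have hX : ∀ j (ψ : SR n), Xop j (mK k ψ) = mK k (Xop j ψ) := fun j ψ => by
      ext x; rw [Xop_apply, mK_apply, mK_apply, Xop_apply]; ring
    rw [HH, HH]
    simp only [LapS, hD1, hD2, hX, map_add, map_sub, map_smul, map_sum, Finset.sum_add_distrib, smul_add]
    rw [← Finset.smul_sum]
    module
  rw [e, nrm_smul]
  have hn : ‖-(Complex.I * (ε : ℂ) / 2)‖ = ε / 2 := by
    rw [norm_neg, norm_div, norm_mul]; simp [abs_of_pos h]
  rw [hn]
  have hB : 0 ≤ B := (nrm_nonneg φ).trans h0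
  have : nrm (∑ j, (mulS (Dop j (Dop j (KK n k))) φ + (2 : ℂ) • mulS (Dop j (KK n k)) (Dop j φ))) ≤ ∑ j : Fin n, 3 * C * B * ((k : ℝ) + 1)⁻¹ := by
    refine (nrm_sum _ _).trans (Finset.sum_le_sum fun j _ => ?_)
    refine (nrm_add _ _).trans ?_
    rw [nrm_smul]
    have a1 := nrm_le_of_pt (φ := mulS (Dop j (Dop j (KK n k))) φ) (ψ := φ) (B := C * ((k : ℝ) + 1)⁻¹) (by positivity) (fun x => by
      rw [mulS_apply (Dop j (Dop j (KK n k))).hasTemperateGrowth, norm_mul]; gcongr; exact (hK k j x).2)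
    have a2 := nrm_le_of_pt (φ := mulS (Dop j (KK n k)) (Dop j φ)) (ψ := Dop j φ) (B := C * ((k : ℝ) + 1)⁻¹) (by positivity) (fun x => by
      rw [mulS_apply (Dop j (KK n k)).hasTemperateGrowth, norm_mul]; gcongr; exact (hK k j x).1)
    have a3 : C * ((k : ℝ) + 1)⁻¹ * nrm φ ≤ C * ((k : ℝ) + 1)⁻¹ * B := by gcongr
    have a4 : C * ((k : ℝ) + 1)⁻¹ * nrm (Dop j φ) ≤ C * ((k : ℝ) + 1)⁻¹ * B := by gcongr; exact hD j
    rw [Complex.norm_ofNat]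
    nlinarith
  rw [Finset.sum_const, Finset.card_univ, Fintype.card_fin, nsmul_eq_mul] at this
  calc _ ≤ ε / 2 * (n * (3 * C * B * ((k : ℝ) + 1)⁻¹)) := by gcongr
    _ = _ := by ring

end

section
open SchwartzMap
variable {n : ℕ} {ε γ lam : ℝ} {u : ℝ → SR n}

abbrev NN (γ : ℝ) [P : Par n γ] (φ : SR n) : SR n := TT γ φ φ φ

structure Sol (γ ε lam : ℝ) [P : Par n γ] (u : ℝ → SR n) : Prop where
  smooth : ContDiff ℝ (⊤ : ℕ∞) (fun p : ℝ × Rn n => u p.1 p.2)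
  eq : ∀ t x, HasDerivAt (fun s => u s x) ((HH ε (u t) - (Complex.I * lam) • NN γ (u t)) x) t

lemma swap_int {g : ℝ → Rn n → ℂ} (hg : Continuous (fun q : ℝ × Rn n => g q.1 q.2)) {R : ℝ} (hR : ∀ τ x, R ≤ ‖x‖ → g τ x = 0)
    (s t : ℝ) (hst : s ≤ t) : (∫ x, ∫ τ in s..t, g τ x) = ∫ τ in s..t, ∫ x, g τ x ∧
      IntervalIntegrable (fun τ => ∫ x, g τ x) volume s t := by
  have hi : Integrable (Function.uncurry g) ((volume.restrict (Set.Ioc s t)).prod (volume : Measure (Rn n))) := by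
    have h1 : IntegrableOn (Function.uncurry g) (Set.Icc s t ×ˢ Metric.closedBall (0 : Rn n) R) ((volume : Measure ℝ).prod volume) :=
      (hg.continuousOn).integrableOn_compact (isCompact_Icc.prod (isCompact_closedBall _ _))
    have h2 : IntegrableOn (Function.uncurry g) (Set.Ioc s t ×ˢ Set.univ) ((volume : Measure ℝ).prod volume) := by
      refine (h1.mono_set (s := Set.Ioc s t ×ˢ Metric.closedBall (0 : Rn n) R) (Set.prod_mono Set.Ioc_subset_Icc_self le_rfl)).of_forall_diff_eq_zero (measurableSet_Ioc.prod MeasurableSet.univ) ?_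
      rintro ⟨τ, x⟩ ⟨hx1, hx2⟩
      apply hR
      by_contra hlt
      apply hx2
      refine ⟨hx1.1, ?_⟩
      simp; linarith
    rw [IntegrableOn, ← Measure.prod_restrict, Measure.restrict_univ] at h2
    exact h2
  refine ⟨?_, ?_⟩
  · simp only [intervalIntegral.integral_of_le hst]
    exact (integral_integral_swap hi).symm
  · rw [intervalIntegrable_iff_integrableOn_Ioc_of_le hst]
    exact hi.integral_prod_left

lemma Sol.cont [P : Par n γ] (hu : Sol γ ε lam u) : Continuous (fun p : ℝ × Rn n => u p.1 p.2) := hu.smooth.continuous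

lemma Sol.cont' [P : Par n γ] (hu : Sol γ ε lam u) :
    Continuous (fun p : ℝ × Rn n => (HH ε (u p.1) - (Complex.I * lam) • NN γ (u p.1)) p.2) := by
  have h1 : Continuous (fun p : ℝ × Rn n => fderiv ℝ (fun p : ℝ × Rn n => u p.1 p.2) p (1, 0)) :=
    (hu.smooth.continuous_fderiv (by simp)).clm_apply continuous_const
  convert h1 using 2 with p
  have h2 : HasFDerivAt (fun p : ℝ × Rn n => u p.1 p.2) _ (p.1, p.2) := (hu.smooth.differentiable (by simp) p).hasFDerivAt
  have h3 : HasDerivAt (fun s : ℝ => (s, p.2)) (1, 0) p.1 := (hasDerivAt_id p.1).prodMk (hasDerivAt_const _ _)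
  have h4 := h2.comp_hasDerivAt p.1 h3
  exact (hu.eq p.1 p.2).unique h4

lemma pairing [P : Par n γ] (hε : 0 < ε) (hu : Sol γ ε lam u) {Ψ Ψ' : ℝ → SR n} (hc : Continuous (fun q : ℝ × Rn n => Ψ q.1 q.2))
    (hc' : Continuous (fun q : ℝ × Rn n => Ψ' q.1 q.2)) (hd : ∀ t x, HasDerivAt (fun s => Ψ s x) (Ψ' t x) t) {s t : ℝ} (hst : s ≤ t)
    {B M : ℝ} (hB : ∀ τ ∈ Set.Icc s t, nrm (Ψ τ) ≤ B) (hBD : ∀ τ ∈ Set.Icc s t, ∀ j, nrm (Dop j (Ψ τ)) ≤ B)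
    (hBE : ∀ τ ∈ Set.Icc s t, nrm (Ψ' τ - HH ε (Ψ τ)) ≤ B)
    (hM : ∀ τ ∈ Set.Icc s t, nrm (u τ) ≤ M) (hN : ∀ τ ∈ Set.Icc s t, nrm (NN γ (u τ)) ≤ M) :
    IntervalIntegrable (fun τ => ip (Ψ' τ - HH ε (Ψ τ)) (u τ) - Complex.I * lam * ip (Ψ τ) (NN γ (u τ))) volume s t ∧
    ip (Ψ t) (u t) - ip (Ψ s) (u s) = ∫ τ in s..t, (ip (Ψ' τ - HH ε (Ψ τ)) (u τ) - Complex.I * lam * ip (Ψ τ) (NN γ (u τ))) := by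
  set W : ℝ → SR n := fun t => HH ε (u t) - (Complex.I * lam) • NN γ (u t) with hW
  set G : ℕ → ℝ → ℂ := fun k τ => ip (mK k (Ψ' τ)) (u τ) + ip (mK k (Ψ τ)) (W τ) with hG
  set F : ℝ → ℂ := fun τ => ip (Ψ' τ - HH ε (Ψ τ)) (u τ) - Complex.I * lam * ip (Ψ τ) (NN γ (u τ)) with hF
  have hcW : Continuous (fun q : ℝ × Rn n => W q.1 q.2) := hu.cont'
  have hcu := hu.cont
  have ii : ∀ φ ψ : SR n, Integrable (fun x => conj (φ x) * ψ x) := fun φ ψ => by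
    have h1 : MemLp ψ 2 volume := ψ.memLp 2 volume
    have h2 : MemLp (cj φ) 2 volume := (cj φ).memLp 2 volume
    exact h2.integrable_mul h1
  have step1 : ∀ k, IntervalIntegrable (G k) volume s t ∧ ip (mK k (Ψ t)) (u t) - ip (mK k (Ψ s)) (u s) = ∫ τ in s..t, G k τ := by
    intro k
    set g : ℝ → Rn n → ℂ := fun τ x => KK n k x * (conj (Ψ' τ x) * u τ x + conj (Ψ τ x) * W τ x) with hg
    have hgc : Continuous (fun q : ℝ × Rn n => g q.1 q.2) := by
      have : Continuous (fun q : ℝ × Rn n => KK n k q.2) := (KK n k).continuous.comp continuous_snd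
      exact this.mul (((Complex.continuous_conj.comp hc').mul hcu).add ((Complex.continuous_conj.comp hc).mul hcW))
    obtain ⟨h1, h2⟩ := swap_int hgc (R := 2 * ((k : ℝ) + 1)) (fun τ x hx => by simp [hg, KK_zero k x hx]) s t hst
    have e1 : ∀ τ, ∫ x, g τ x = G k τ := by
      intro τ
      simp only [hG, hg]
      rw [ip_eq, ip_eq, ← integral_add (ii _ _) (ii _ _)]
      congr 1; ext x; rw [mK_apply, mK_apply, map_mul, map_mul, KK_conj]; ring
    simp only [e1] at h1 h2
    refine ⟨h2, ?_⟩
    rw [← h1, mK_ip, mK_ip, ← integral_sub]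
    · congr 1; ext x
      rw [intervalIntegral.integral_eq_sub_of_hasDerivAt (f := fun τ => KK n k x * (conj (Ψ τ x) * u τ x))]
      · intro τ _
        have := (((hd τ x).star).mul (hu.eq τ x)).const_mul (KK n k x)
        exact this
      · refine Continuous.intervalIntegrable ?_ _ _
        exact hgc.comp (continuous_id.prodMk continuous_const)
    · have := ii (mK k (Ψ t)) (u t)
      refine this.congr (Eventually.of_forall fun x => ?_)
      simp only [mK_apply, map_mul, KK_conj]; ring
    · have := ii (mK k (Ψ s)) (u s)
      refine this.congr (Eventually.of_forall fun x => ?_)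
      simp only [mK_apply, map_mul, KK_conj]; ring
  obtain ⟨C, hC, hK⟩ := KK_comm n hε
  have hMn : 0 ≤ M := (nrm_nonneg _).trans (hM s ⟨le_rfl, hst⟩)
  have hBn : 0 ≤ B := (nrm_nonneg _).trans (hB s ⟨le_rfl, hst⟩)
  have eG : ∀ k τ, G k τ = ip (mK k (Ψ' τ - HH ε (Ψ τ))) (u τ) - Complex.I * lam * ip (mK k (Ψ τ)) (NN γ (u τ)) + ip (mK k (HH ε (Ψ τ)) - HH ε (mK k (Ψ τ))) (u τ) := by
    intro k τ
    simp only [hG, hW, mK]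
    rw [ip_sub_right, ip_smul_right, HH_anti, map_sub, ip_sub_left, ip_sub_left]; ring
  have bG : ∀ k, ∀ τ ∈ Set.Icc s t, ‖G k τ‖ ≤ B * M + |lam| * (B * M) + C * B * M := by
    intro k τ hτ
    rw [eG]
    have a1 : ‖ip (mK k (Ψ' τ - HH ε (Ψ τ))) (u τ)‖ ≤ B * M := (ip_le _ _).trans (by
      gcongr; · exact nrm_nonneg _
      · exact (mK_nrm _ _).trans (hBE τ hτ)
      · exact hM τ hτ)
    have a2 : ‖ip (mK k (Ψ τ)) (NN γ (u τ))‖ ≤ B * M := (ip_le _ _).trans (by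
      gcongr; · exact nrm_nonneg _
      · exact (mK_nrm _ _).trans (hB τ hτ)
      · exact hN τ hτ)
    have a3 : ‖ip (mK k (HH ε (Ψ τ)) - HH ε (mK k (Ψ τ))) (u τ)‖ ≤ (C * B * ((k : ℝ) + 1)⁻¹) * M := (ip_le _ _).trans (by
      gcongr; · exact nrm_nonneg _
      · exact hK k _ B (hB τ hτ) (hBD τ hτ)
      · exact hM τ hτ)
    have hk1 : ((k : ℝ) + 1)⁻¹ ≤ 1 := inv_le_one_of_one_le₀ (by linarith [Nat.cast_nonneg (α := ℝ) k])
    have a4 : (C * B * ((k : ℝ) + 1)⁻¹) * M ≤ C * B * 1 * M := by gcongr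
    refine (norm_add_le _ _).trans (add_le_add ((norm_sub_le _ _).trans (add_le_add a1 ?_)) (by linarith))
    rw [norm_mul, norm_mul, Complex.norm_I, one_mul, Complex.norm_real, Real.norm_eq_abs]
    gcongr
  have tG : ∀ τ ∈ Set.Icc s t, Tendsto (fun k => G k τ) atTop (𝓝 (F τ)) := by
    intro τ hτ
    simp only [eG]
    have a3 : Tendsto (fun k => ip (mK k (HH ε (Ψ τ)) - HH ε (mK k (Ψ τ))) (u τ)) atTop (𝓝 0) := by
      refine squeeze_zero_norm (a := fun k : ℕ => (C * B * ((k : ℝ) + 1)⁻¹) * M) (fun k => (ip_le _ _).trans (by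
        gcongr; · exact nrm_nonneg _
        · exact hK k _ B (hB τ hτ) (hBD τ hτ)
        · exact hM τ hτ)) ?_
      have h1 : Tendsto (fun k : ℕ => ((k : ℝ) + 1)⁻¹) atTop (𝓝 0) := by
        simpa using tendsto_one_div_add_atTop_nhds_zero_nat (𝕜 := ℝ)
      simpa using (h1.const_mul (C * B)).mul_const M
    have := ((mK_tendsto (Ψ' τ - HH ε (Ψ τ)) (u τ)).sub ((mK_tendsto (Ψ τ) (NN γ (u τ))).const_mul (Complex.I * lam))).add a3
    simpa [hF] using this
  have hae : ∀ᵐ τ ∂(volume : Measure ℝ), τ ∈ Set.uIoc s t → Tendsto (fun k => G k τ) atTop (𝓝 (F τ)) :=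
    Eventually.of_forall fun τ hτ => tG τ (by rw [Set.uIoc_of_le hst] at hτ; exact ⟨hτ.1.le, hτ.2⟩)
  have hbd : ∀ k, ∀ᵐ τ ∂(volume : Measure ℝ), τ ∈ Set.uIoc s t → ‖G k τ‖ ≤ B * M + |lam| * (B * M) + C * B * M :=
    fun k => Eventually.of_forall fun τ hτ => bG k τ (by rw [Set.uIoc_of_le hst] at hτ; exact ⟨hτ.1.le, hτ.2⟩)
  have hms : ∀ k, AEStronglyMeasurable (G k) (volume.restrict (Set.uIoc s t)) := fun k => by
    rw [Set.uIoc_of_le hst]; exact (step1 k).1.aestronglyMeasurable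
  refine ⟨?_, ?_⟩
  · rw [intervalIntegrable_iff]
    refine Integrable.mono' (g := fun _ => B * M + |lam| * (B * M) + C * B * M) (intervalIntegrable_iff.mp (intervalIntegrable_const : IntervalIntegrable (fun _ => B * M + |lam| * (B * M) + C * B * M) volume s t)) (aestronglyMeasurable_of_tendsto_ae atTop hms ((ae_restrict_iff' measurableSet_uIoc).mpr hae)) ?_
    refine (ae_restrict_iff' measurableSet_uIoc).mpr ?_
    refine Eventually.of_forall fun τ hτ => ?_
    have hτ' : τ ∈ Set.Icc s t := by rw [Set.uIoc_of_le hst] at hτ; exact ⟨hτ.1.le, hτ.2⟩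
    exact le_of_tendsto (tG τ hτ').norm (Eventually.of_forall fun k => bG k τ hτ')
  · have l1 : Tendsto (fun k => ip (mK k (Ψ t)) (u t) - ip (mK k (Ψ s)) (u s)) atTop (𝓝 (ip (Ψ t) (u t) - ip (Ψ s) (u s))) :=
      (mK_tendsto _ _).sub (mK_tendsto _ _)
    have l2 : Tendsto (fun k => ∫ τ in s..t, G k τ) atTop (𝓝 (∫ τ in s..t, F τ)) :=
      intervalIntegral.tendsto_integral_filter_of_dominated_convergence (fun _ => B * M + |lam| * (B * M) + C * B * M) (Eventually.of_forall hms)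
        (Eventually.of_forall hbd) (by simp) hae
    simp only [(step1 _).2] at l1
    exact tendsto_nhds_unique l1 l2

end

section
open SchwartzMap

variable {n : ℕ} {ε γ σ : ℝ}

lemma GS_ext (h : 0 < ε) {φ ψ : SR n} (H : ∀ p : Rn n, ip (GS ε p 0) φ = ip (GS ε p 0) ψ) : φ = ψ := by
  have h1 := Submodule.topologicalClosure_eq_top_iff.mp (GS_dense (n := n) h)
  have h2 : toL2 (φ - ψ) ∈ (Submodule.span ℂ (Set.range fun p : Rn n => toL2 (GS ε p 0)))ᗮ := by
    rw [Submodule.mem_orthogonal]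
    intro w hw
    induction hw using Submodule.span_induction with
    | mem x hx =>
      obtain ⟨p, rfl⟩ := hx
      have := H p
      rw [← sub_eq_zero, ← ip_sub_right] at this
      exact this
    | zero => simp
    | add x y _ _ hx hy => rw [inner_add_left, hx, hy, add_zero]
    | smul c x _ hx => rw [inner_smul_left, hx, mul_zero]
  rw [h1, Submodule.mem_bot] at h2
  have h3 : nrm (φ - ψ) = 0 := by rw [nrm, h2, norm_zero]
  exact sub_eq_zero.mp (SR_eq_of_nrm h3)

def spG (n : ℕ) (ε : ℝ) : Submodule ℂ (SR n) := Submodule.span ℂ (Set.range fun p : Rn n => GS ε p 0)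

lemma spG_dense (h : 0 < ε) (w : SR n) {δ : ℝ} (hδ : 0 < δ) : ∃ g ∈ spG n ε, nrm (w - g) < δ := by
  have h1 : toL2 w ∈ (Submodule.span ℂ (Set.range fun p : Rn n => toL2 (GS ε p 0))).topologicalClosure := by
    rw [GS_dense h]; trivial
  have h2 : Submodule.span ℂ (Set.range fun p : Rn n => toL2 (GS ε p 0)) = (spG n ε).map (toL2 (n := n)).toLinearMap := by
    rw [spG, Submodule.map_span, ← Set.range_comp]; rfl
  have h3 : toL2 w ∈ closure ((spG n ε).map (toL2 (n := n)).toLinearMap : Set (Lp ℂ 2 (volume : Measure (Rn n)))) := by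
    rw [← h2]; exact h1
  obtain ⟨y, ⟨g, hg, rfl⟩, hy⟩ := Metric.mem_closure_iff.mp h3 δ hδ
  refine ⟨g, hg, ?_⟩
  rw [nrm, map_sub, ← dist_eq_norm]; exact hy

lemma GS_le (h : 0 < ε) (p : Rn n) (t : ℝ) (x : Rn n) : ‖GS ε p t x‖ ≤ 1 := by
  rw [GS, smul_ap, norm_mul, mulS_apply (ph_tg (dp_tg _ _)), norm_mul, ph_norm, compSubConstCLM_apply, g0_apply h]
  rw [mul_comm Complex.I, Complex.norm_exp_ofReal_mul_I, one_mul, one_mul, Complex.norm_real, Real.norm_eq_abs, abs_of_pos (Real.exp_pos _)]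
  rw [Real.exp_le_one_iff]
  have : 0 ≤ (1 / (2 * ε)) * ‖x - sin t • p‖ ^ 2 := by positivity
  linarith

lemma GS_ip_cont (h : 0 < ε) (p : Rn n) (χ : SR n) : Continuous fun t => ip (GS ε p t) χ := by
  simp only [ip_eq]
  refine continuous_of_dominated (bound := fun x => ‖χ x‖) (fun t => ?_) (fun t => ?_) ?_ ?_
  · exact ((Complex.continuous_conj.comp (GS ε p t).continuous).mul χ.continuous).aestronglyMeasurable
  · refine Eventually.of_forall fun x => ?_
    rw [norm_mul, RCLike.norm_conj]
    exact mul_le_of_le_one_left (norm_nonneg _) (GS_le h p t x)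
  · exact χ.integrable.norm
  · refine Eventually.of_forall fun x => ?_
    have h2 : Continuous (fun t : ℝ => ((t, x) : ℝ × Rn n)) := Continuous.prodMk_left x
    have h3 := (GS_cont h p).comp h2
    have h4 := Complex.continuous_conj.comp h3
    exact h4.mul continuous_const

def kap (n : ℕ) (ε σ : ℝ) : ℂ := open Classical in if h : 0 < ε ∧ cos σ ≠ 0 then (SS_GS (n := n) h.1 h.2).choose else 1

lemma kap_norm : ‖kap n ε σ‖ = 1 := by
  unfold kap; split_ifs with h
  · exact (SS_GS (n := n) h.1 h.2).choose_spec.1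
  · simp
lemma kap_mul : conj (kap n ε σ) * kap n ε σ = 1 := by
  rw [mul_comm, Complex.mul_conj, Complex.normSq_eq_norm_sq, kap_norm]; norm_num
lemma kap_spec (h : 0 < ε) (hc : cos σ ≠ 0) (p : Rn n) : SS ε σ (GS ε p σ) = kap n ε σ • GS ε p 0 := by
  unfold kap; rw [dif_pos ⟨h, hc⟩]
  exact (SS_GS (n := n) h hc).choose_spec.2 p

/-- the frame map: inverse of the linear flow -/
def AA (ε σ : ℝ) (φ : SR n) : SR n := conj (kap n ε σ) • SS ε σ φ

lemma AA_add (hc : cos σ ≠ 0) (φ ψ : SR n) : AA ε σ (φ + ψ) = AA ε σ φ + AA ε σ ψ := by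
  rw [AA, SS_add hc, smul_add]; rfl
lemma AA_smul (hc : cos σ ≠ 0) (k : ℂ) (φ : SR n) : AA ε σ (k • φ) = k • AA ε σ φ := by
  rw [AA, SS_smul hc, smul_comm]; rfl
lemma AA_sub (hc : cos σ ≠ 0) (φ ψ : SR n) : AA ε σ (φ - ψ) = AA ε σ φ - AA ε σ ψ := by
  rw [AA, SS_sub hc, smul_sub]; rfl
lemma AA_ip (hc : cos σ ≠ 0) (φ ψ : SR n) : ip (AA ε σ φ) (AA ε σ ψ) = ip φ ψ := by
  rw [AA, AA, ip_smul_left, ip_smul_right, SS_ip hc, ← mul_assoc, Complex.conj_conj, mul_comm (kap n ε σ), kap_mul, one_mul]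
lemma AA_nrm (hc : cos σ ≠ 0) (φ : SR n) : nrm (AA ε σ φ) = nrm φ := nrm_of_ip (AA_ip hc φ φ)
lemma AA_GS (h : 0 < ε) (hc : cos σ ≠ 0) (p : Rn n) (φ : SR n) : ip (GS ε p 0) (AA ε σ φ) = ip (GS ε p σ) φ := by
  rw [← SS_ip (ε := ε) hc (GS ε p σ), kap_spec h hc, ip_smul_left, AA, ip_smul_right]
lemma AA_D (hc : cos σ ≠ 0) (j : Fin n) (φ : SR n) : Dop j (AA ε σ φ) =
    AA ε σ ((cos σ : ℂ) • Dop j φ + (Complex.I * (sin σ / ε : ℝ)) • Xop j φ) := by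
  rw [AA, map_smul, SS_D hc]; rfl
lemma AA_X (hε : ε ≠ 0) (hc : cos σ ≠ 0) (j : Fin n) (φ : SR n) : Xop j (AA ε σ φ) =
    AA ε σ ((cos σ : ℂ) • Xop j φ + (Complex.I * (ε * sin σ : ℝ)) • Dop j φ) := by
  rw [AA, map_smul, SS_X hε hc]; rfl
lemma hq_smul {c : ℂ} (hc : ‖c‖ = 1) (φ : SR n) : hq ε (c • φ) = hq ε φ := by
  simp only [hq, map_smul, nrm_smul, hc, one_mul]
lemma AA_hq (hε : ε ≠ 0) (hc : cos σ ≠ 0) (φ : SR n) : hq ε (AA ε σ φ) = hq ε φ := by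
  rw [AA, hq_smul (by rw [RCLike.norm_conj, kap_norm]), SS_hq hε hc]
lemma TE_smul [P : Par n γ] {c : ℂ} (hc : conj c * c = 1) (s : ℝ) (a b d : SR n) :
    TE γ s (c • a) (c • b) (c • d) = c • TE γ s a b d := by
  simp only [TE, E_smul, TT_smul1, TT_smul2, TT_smul3, smul_smul]
  congr 1
  rw [hc, mul_one]
lemma AA_TT [P : Par n γ] (hc : cos σ ≠ 0) (a b d : SR n) :
    AA ε σ (TT γ a b d) = ((|cos σ| ^ (-γ) : ℝ) : ℂ) • TE γ (ε * tan σ / 2) (AA ε σ a) (AA ε σ b) (AA ε σ d) := by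
  rw [AA, AA, AA, AA, TE_smul (by rw [Complex.conj_conj, mul_comm, kap_mul]), SS_TT hc, smul_comm]
lemma AA_zero (h : 0 < ε) (φ : SR n) : AA ε 0 φ = φ :=
  GS_ext h fun p => AA_GS h (by simp) p φ
lemma AA_nS (h0 : 0 < ε) (h1 : ε ≤ 1) (hc : cos σ ≠ 0) (φ : SR n) :
    nS (AA ε σ φ) ≤ (2 * n + 1) * (1 + √(2 * n)) / ε * nS φ := by
  have := nS_le_hq h0 h1 (AA ε σ φ)
  rw [AA_hq h0.ne' hc, AA_nrm hc] at this
  have h2 : √(hq ε φ) ≤ √(2 * n) * nS φ := by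
    rw [← Real.sqrt_sq (nS_nonneg φ), ← Real.sqrt_mul (by positivity)]
    exact Real.sqrt_le_sqrt (hq_le_nS h0 h1 φ)
  have h3 := nrm_le_nS φ
  calc _ ≤ _ := this
    _ ≤ (2 * n + 1) * ((nS φ + √(2 * n) * nS φ) / ε) := by gcongr
    _ = _ := by ring

lemma AA_weak (h : 0 < ε) (ψ χ : SR n) : Tendsto (fun σ => ip ψ (AA ε σ χ)) (𝓝 0) (𝓝 (ip ψ χ)) := by
  have hcos : ∀ᶠ σ : ℝ in 𝓝 0, cos σ ≠ 0 :=
    continuous_cos.continuousAt.eventually_ne (by simp)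
  have step : ∀ g ∈ spG n ε, Tendsto (fun σ => ip g (AA ε σ χ)) (𝓝 0) (𝓝 (ip g χ)) := by
    intro g hg
    induction hg using Submodule.span_induction with
    | mem x hx =>
      obtain ⟨p, rfl⟩ := hx
      refine Tendsto.congr' ?_ (GS_ip_cont h p χ).continuousAt.tendsto
      filter_upwards [hcos] with σ hc
      rw [AA_GS h hc]
    | zero => simp [ip]
    | add x y _ _ hx hy => simp only [ip_add_left]; exact hx.add hy
    | smul c x _ hx => simp only [ip_smul_left]; exact hx.const_mul _
  rw [Metric.tendsto_nhds]
  intro δ hδ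
  have hn := nrm_nonneg χ
  obtain ⟨g, hg, hgw⟩ := spG_dense h ψ (δ := δ / (3 * (nrm χ + 1))) (by positivity)
  have hb : nrm (ψ - g) * nrm χ < δ / 3 := by
    rw [lt_div_iff₀ (by positivity)] at hgw ⊢
    nlinarith [nrm_nonneg (ψ - g)]
  filter_upwards [hcos, Metric.tendsto_nhds.mp (step g hg) (δ / 3) (by positivity)] with σ hc h3
  have e : ip ψ (AA ε σ χ) - ip ψ χ = ip (ψ - g) (AA ε σ χ) + (ip g (AA ε σ χ) - ip g χ) - ip (ψ - g) χ := by
    rw [ip_sub_left, ip_sub_left]; ring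
  rw [dist_eq_norm] at h3 ⊢
  rw [e]
  have i1 := ip_le (ψ - g) (AA ε σ χ)
  have i2 := ip_le (ψ - g) χ
  rw [AA_nrm hc] at i1
  have := norm_sub_le (ip (ψ - g) (AA ε σ χ) + (ip g (AA ε σ χ) - ip g χ)) (ip (ψ - g) χ)
  have := norm_add_le (ip (ψ - g) (AA ε σ χ)) (ip g (AA ε σ χ) - ip g χ)
  linarith

end

section
open SchwartzMap

variable {n : ℕ} {ε γ lam : ℝ} {u : ℝ → SR n}

lemma cos_ae (s0 : ℝ) : ∀ᵐ τ : ℝ, cos (τ - s0) ≠ 0 := by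
  have : (Set.range fun k : ℤ => (2 * (k : ℝ) + 1) * π / 2 + s0).Countable := Set.countable_range _
  refine measure_mono_null ?_ (this.measure_zero volume)
  intro τ hτ
  simp only [Set.mem_compl_iff, Set.mem_setOf_eq, not_not] at hτ
  obtain ⟨k, hk⟩ := Real.cos_eq_zero_iff.mp hτ
  exact ⟨k, by simp only; linarith⟩

def WeakInt (d : SR n) (R : ℝ → SR n) (s t : ℝ) : Prop :=
  ∀ φ : SR n, IntervalIntegrable (fun τ => ip φ (R τ)) volume s t ∧ ip φ d = ∫ τ in s..t, ip φ (R τ)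

lemma WeakInt.of_span (h : 0 < ε) {d : SR n} {R : ℝ → SR n} {s t K : ℝ} (hst : s ≤ t)
    (hK : ∀ᵐ τ : ℝ, τ ∈ Set.Ioc s t → nrm (R τ) ≤ K)
    (H : ∀ p : Rn n, IntervalIntegrable (fun τ => ip (GS ε p 0) (R τ)) volume s t ∧ ip (GS ε p 0) d = ∫ τ in s..t, ip (GS ε p 0) (R τ)) :
    WeakInt d R s t := by
  have step : ∀ g ∈ spG n ε, IntervalIntegrable (fun τ => ip g (R τ)) volume s t ∧ ip g d = ∫ τ in s..t, ip g (R τ) := by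
    intro g hg
    induction hg using Submodule.span_induction with
    | mem x hx => obtain ⟨p, rfl⟩ := hx; exact H p
    | zero => simp [ip]
    | add x y _ _ hx hy =>
      simp only [ip_add_left]
      exact ⟨hx.1.add hy.1, by rw [intervalIntegral.integral_add hx.1 hy.1, hx.2, hy.2]⟩
    | smul c x _ hx =>
      simp only [ip_smul_left]
      exact ⟨hx.1.const_mul _, by rw [intervalIntegral.integral_const_mul, hx.2]⟩
  intro φ
  have hg : ∀ k : ℕ, ∃ g ∈ spG n ε, nrm (φ - g) < 1 / ((k : ℝ) + 1) := fun k => spG_dense h φ (by positivity)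
  choose g hg hgn using hg
  have hlim : Tendsto (fun k => nrm (φ - g k)) atTop (𝓝 0) :=
    squeeze_zero (fun k => nrm_nonneg _) (fun k => (hgn k).le) tendsto_one_div_add_atTop_nhds_zero_nat
  have hip : ∀ ψ : SR n, Tendsto (fun k => ip (g k) ψ) atTop (𝓝 (ip φ ψ)) := by
    intro ψ
    rw [tendsto_iff_norm_sub_tendsto_zero]
    refine squeeze_zero (fun k => norm_nonneg _) (g := fun k => nrm (φ - g k) * nrm ψ) (fun k => ?_) (by simpa using hlim.mul_const (nrm ψ))
    rw [← ip_sub_left, ← nrm_sub_comm]; exact ip_le _ _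
  have hgb : ∀ k, nrm (g k) ≤ nrm φ + 1 := fun k => by
    have h1 : g k = φ - (φ - g k) := by abel
    have h2 := nrm_sub φ (φ - g k)
    rw [← h1] at h2
    have h3 : 1 / ((k : ℝ) + 1) ≤ 1 := by
      rw [div_le_one (by positivity)]; linarith [Nat.cast_nonneg (α := ℝ) k]
    linarith [hgn k]
  have hms : ∀ k, AEStronglyMeasurable (fun τ => ip (g k) (R τ)) (volume.restrict (Set.uIoc s t)) := fun k => by
    rw [Set.uIoc_of_le hst]; exact (step _ (hg k)).1.1.aestronglyMeasurable
  have hbd : ∀ k, ∀ᵐ τ : ℝ, τ ∈ Set.uIoc s t → ‖ip (g k) (R τ)‖ ≤ (nrm φ + 1) * K := fun k => by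
    filter_upwards [hK] with τ hτ hm
    rw [Set.uIoc_of_le hst] at hm
    refine (ip_le _ _).trans ?_
    have := hτ hm
    have := hgb k
    have := nrm_nonneg (R τ)
    have := nrm_nonneg φ
    gcongr
  have hts : ∀ᵐ τ : ℝ, τ ∈ Set.uIoc s t → Tendsto (fun k => ip (g k) (R τ)) atTop (𝓝 (ip φ (R τ))) :=
    Eventually.of_forall fun τ _ => hip _
  refine ⟨?_, ?_⟩
  · rw [intervalIntegrable_iff]
    refine Integrable.mono' (g := fun _ => (nrm φ + 1) * K) (intervalIntegrable_iff.mp (intervalIntegrable_const : IntervalIntegrable (fun _ => (nrm φ + 1) * K) volume s t))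
      (aestronglyMeasurable_of_tendsto_ae atTop hms ((ae_restrict_iff' measurableSet_uIoc).mpr hts)) ?_
    rw [ae_restrict_iff' measurableSet_uIoc]
    filter_upwards [ae_all_iff.mpr hbd] with τ hτ hm
    exact le_of_tendsto (hip (R τ)).norm (Eventually.of_forall fun k => hτ k hm)
  · have l2 : Tendsto (fun k => ∫ τ in s..t, ip (g k) (R τ)) atTop (𝓝 (∫ τ in s..t, ip φ (R τ))) :=
      intervalIntegral.tendsto_integral_filter_of_dominated_convergence (fun _ => (nrm φ + 1) * K) (Eventually.of_forall hms)
        (Eventually.of_forall hbd) (by simp) hts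
    simp only [← (step _ (hg _)).2] at l2
    exact tendsto_nhds_unique (hip d) l2

lemma nrm_dual (d : SR n) : ∃ w : SR n, ip w d = nrm d ∧ nrm w ≤ 1 := by
  refine ⟨(((nrm d)⁻¹ : ℝ) : ℂ) • d, ?_, ?_⟩
  · rw [ip_smul_left, ip_self, Complex.conj_ofReal, ← Complex.ofReal_mul]
    congr 1
    rcases eq_or_ne (nrm d) 0 with h | h
    · simp [h]
    · field_simp
  · rw [nrm_smul, Complex.norm_real, Real.norm_eq_abs, abs_of_nonneg (inv_nonneg.mpr (nrm_nonneg d))]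
    exact inv_mul_le_one

lemma nS_dual (d : SR n) : ∃ φ : SR n, ip φ d = nS d ∧ ∀ ψ, ‖ip φ ψ‖ ≤ nS ψ := by
  obtain ⟨w0, h0, h0'⟩ := nrm_dual d
  choose wX hX hX' using fun j => nrm_dual (Xop j d)
  choose wD hD hD' using fun j => nrm_dual (Dop j d)
  have key : ∀ ψ, ip (w0 + ∑ j, Xop j (wX j) + ∑ j, (-1 : ℂ) • Dop j (wD j)) ψ = ip w0 ψ + ∑ j, ip (wX j) (Xop j ψ) + ∑ j, ip (wD j) (Dop j ψ) := by
    intro ψ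
    rw [ip_add_left, ip_add_left, ip_sum_left, ip_sum_left]
    simp only [ip_smul_left, ip_X, ip_D, map_neg, map_one]
    congr 1
    exact Finset.sum_congr rfl fun j _ => by ring
  refine ⟨w0 + ∑ j, Xop j (wX j) + ∑ j, (-1 : ℂ) • Dop j (wD j), ?_, fun ψ => ?_⟩
  rotate_left
  · rw [key]
    have hh : ∀ w χ : SR n, nrm w ≤ 1 → ‖ip w χ‖ ≤ nrm χ := fun w χ hw =>
      (ip_le _ _).trans (mul_le_of_le_one_left (nrm_nonneg _) hw)
    unfold nS
    refine (norm_add₃_le).trans ?_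
    gcongr
    · exact hh _ _ h0'
    · exact (norm_sum_le _ _).trans (Finset.sum_le_sum fun j _ => hh _ _ (hX' j))
    · exact (norm_sum_le _ _).trans (Finset.sum_le_sum fun j _ => hh _ _ (hD' j))
  · rw [key, h0]
    simp only [hX, hD, nS]; push_cast; rfl

lemma WeakInt.nS_le {d : SR n} {R : ℝ → SR n} {s t : ℝ} (hst : s ≤ t) (hw : WeakInt d R s t) {b : ℝ → ℝ}
    (hb : IntervalIntegrable b volume s t) (hR : ∀ᵐ τ : ℝ, τ ∈ Set.Ioc s t → nS (R τ) ≤ b τ) : nS d ≤ ∫ τ in s..t, b τ := by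
  obtain ⟨φ, h1, h2⟩ := nS_dual d
  have h3 := (hw φ).2
  rw [h1] at h3
  have h4 : nS d = ‖((nS d : ℝ) : ℂ)‖ := by rw [Complex.norm_real, Real.norm_eq_abs, abs_of_nonneg (nS_nonneg d)]
  rw [h4, h3]
  refine intervalIntegral.norm_integral_le_of_norm_le hst ?_ hb
  filter_upwards [hR] with τ hτ hm
  exact (h2 _).trans (hτ hm)

lemma NN_nrm [P : Par n γ] {φ : SR n} {M : ℝ} (h : nS φ ≤ M) : nrm (NN γ φ) ≤ CV n γ * M ^ 3 := by
  have h2 := (nrm_le_nS φ).trans h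
  have h3 := (h1_le_nS φ).trans h
  have := CV_nonneg n γ
  have h4 := nrm_nonneg φ
  have : 0 ≤ M := h4.trans h2
  calc _ ≤ _ := TT_le1 φ φ φ
    _ ≤ CV n γ * (M * M * M) := by gcongr
    _ = _ := by ring

lemma duhamel [P : Par n γ] (hε : 0 < ε) (hu : Sol γ ε lam u) {s0 s t M : ℝ} (hst : s ≤ t)
    (hM : ∀ τ ∈ Set.Icc s t, nS (u τ) ≤ M) {d : SR n}
    (hd : ∀ p, ip (GS ε p 0) d = ip (GS ε p (t - s0)) (u t) - ip (GS ε p (s - s0)) (u s)) :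
    WeakInt d (fun τ => (-(Complex.I * lam)) • AA ε (τ - s0) (NN γ (u τ))) s t := by
  have hcv := CV_nonneg n γ
  have hM0 : 0 ≤ M := (nS_nonneg _).trans (hM s ⟨le_rfl, hst⟩)
  refine WeakInt.of_span hε hst (K := |lam| * (CV n γ * M ^ 3)) ?_ fun p => ?_
  · filter_upwards [cos_ae s0] with τ hc hτ
    rw [nrm_smul, AA_nrm hc, norm_neg, norm_mul, Complex.norm_I, one_mul, Complex.norm_real, Real.norm_eq_abs]
    gcongr
    exact NN_nrm (hM τ ⟨hτ.1.le, hτ.2⟩)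
  · choose CD hCD using GS_nrmD (n := n) hε p
    have hcs : ∑ j, |CD j| ≤ nrm (g0 ε : SR n) + ∑ j, |CD j| := by linarith [nrm_nonneg (g0 ε : SR n)]
    have sh : Continuous fun q : ℝ × Rn n => (q.1 - s0, q.2) := by fun_prop
    have c1 := (GS_cont hε p).comp sh
    have c2 := (GS_HH_cont hε p).comp sh
    have hp := pairing hε hu (Ψ := fun τ => GS ε p (τ - s0)) (Ψ' := fun τ => HH ε (GS ε p (τ - s0)))
      c1 c2
      (fun τ x => (GS_deriv hε p (τ - s0) x).comp_sub_const τ s0) hst (B := nrm (g0 ε : SR n) + ∑ j, |CD j|) (M := M + CV n γ * M ^ 3)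
      (fun τ _ => by rw [GS_nrm]; linarith [Finset.sum_nonneg fun j (_ : j ∈ Finset.univ) => abs_nonneg (CD j)])
      (fun τ _ j => ((hCD j _).trans ((le_abs_self _).trans (Finset.single_le_sum (f := fun j => |CD j|) (fun i _ => abs_nonneg _) (Finset.mem_univ j)))).trans hcs)
      (fun τ _ => by rw [sub_self, nrm_zero]; exact add_nonneg (nrm_nonneg _) (Finset.sum_nonneg fun i _ => abs_nonneg _))
      (fun τ hτ => by linarith [(nrm_le_nS _).trans (hM τ hτ), mul_nonneg hcv (pow_nonneg hM0 3)])
      (fun τ hτ => by linarith [NN_nrm (γ := γ) (hM τ hτ)])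
    have hae : ∀ᵐ τ : ℝ, τ ∈ Set.uIoc s t → ip (HH ε (GS ε p (τ - s0)) - HH ε (GS ε p (τ - s0))) (u τ) - Complex.I * lam * ip (GS ε p (τ - s0)) (NN γ (u τ))
        = ip (GS ε p 0) ((-(Complex.I * lam)) • AA ε (τ - s0) (NN γ (u τ))) := by
      filter_upwards [cos_ae s0] with τ hc _
      rw [ip_smul_right, AA_GS hε hc, sub_self, show ip (0 : SR n) (u τ) = 0 by simp [ip]]; ring
    refine ⟨hp.1.congr_ae ((ae_restrict_iff' measurableSet_uIoc).mpr hae), ?_⟩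
    rw [hd, hp.2, intervalIntegral.integral_congr_ae hae]

end

section
open SchwartzMap

variable {n : ℕ} {ε γ lam : ℝ} {u : ℝ → SR n}

lemma nrm_add_sq (x e : SR n) : nrm (x + e) ^ 2 = nrm x ^ 2 + 2 * (ip x e).re + nrm e ^ 2 := by
  simp only [nrm, map_add, ip]; exact norm_add_sq (𝕜 := ℂ) _ _

lemma hq_add_sq (ε : ℝ) (x e : SR n) : hq ε (x + e) = hq ε x + 2 * (hf ε x e).re + hq ε e := by
  simp only [hq, hf, map_add, nrm_add_sq, Complex.re_sum, Complex.add_re, Complex.re_ofReal_mul, Finset.mul_sum, ← Finset.sum_add_distrib]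
  exact Finset.sum_congr rfl fun j _ => by ring

lemma hf_le (h0 : 0 < ε) (h1 : ε ≤ 1) (x e : SR n) : ‖hf ε x e‖ ≤ 2 * n * (nS x * nS e) := by
  unfold hf
  refine (norm_sum_le _ _).trans ?_
  calc _ ≤ ∑ j : Fin n, (2 * (nS x * nS e)) := Finset.sum_le_sum fun j _ => ?_
    _ = _ := by simp; ring
  have a1 : ‖ip (Xop j x) (Xop j e)‖ ≤ nS x * nS e := (ip_le _ _).trans
    (mul_le_mul (nrmX_le_nS j x) (nrmX_le_nS j e) (nrm_nonneg _) (nS_nonneg _))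
  have a2 : ‖ip (Dop j x) (Dop j e)‖ ≤ nS x * nS e := (ip_le _ _).trans
    (mul_le_mul (nrmD_le_nS j x) (nrmD_le_nS j e) (nrm_nonneg _) (nS_nonneg _))
  have a3 : ε ^ 2 ≤ 1 := by nlinarith
  refine (norm_add_le _ _).trans ?_
  rw [norm_mul, Complex.norm_real, Real.norm_eq_abs, abs_of_nonneg (by positivity)]
  have : ε ^ 2 * ‖ip (Dop j x) (Dop j e)‖ ≤ 1 * ‖ip (Dop j x) (Dop j e)‖ := by gcongr
  linarith

lemma TT_adj [P : Par n γ] (φ ψ χ ω : SR n) : ip ω (TT γ φ ψ χ) = ip (TT γ ψ φ ω) χ := by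
  rw [ip_eq, ip_eq]
  congr 1; ext x
  rw [TT_apply, TT_apply, map_mul, VV_conj]; ring

/-- potential energy -/
def pE (γ : ℝ) [P : Par n γ] (φ : SR n) : ℝ := (ip φ (NN γ φ)).re

lemma ip_NN_real [P : Par n γ] (φ : SR n) : ip (NN γ φ) φ = ip φ (NN γ φ) := (TT_adj φ φ φ φ).symm

lemma mass [P : Par n γ] (hε : 0 < ε) (hu : Sol γ ε lam u) {s t M : ℝ} (hst : s ≤ t)
    (hM : ∀ τ ∈ Set.Icc s t, nS (u τ) ≤ M) : nrm (u t) = nrm (u s) := by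
  have hcv := CV_nonneg n γ
  have hM0 : 0 ≤ M := (nS_nonneg _).trans (hM s ⟨le_rfl, hst⟩)
  have hx : 0 ≤ CV n γ * M ^ 3 := by positivity
  have hx2 : 0 ≤ |lam| * (CV n γ * M ^ 3) := by positivity
  have e1 : ∀ τ, HH ε (u τ) - (Complex.I * lam) • NN γ (u τ) - HH ε (u τ) = (-(Complex.I * lam)) • NN γ (u τ) := fun τ => by
    rw [neg_smul]; abel
  have hp := (pairing hε hu (Ψ := u) (Ψ' := fun τ => HH ε (u τ) - (Complex.I * lam) • NN γ (u τ)) hu.cont hu.cont' hu.eq hst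
    (B := M + |lam| * (CV n γ * M ^ 3)) (M := M + CV n γ * M ^ 3)
    (fun τ hτ => by linarith [(nrm_le_nS _).trans (hM τ hτ)])
    (fun τ hτ j => by linarith [(nrmD_le_nS j _).trans (hM τ hτ)])
    (fun τ hτ => by
      rw [e1, nrm_smul, norm_neg, norm_mul, Complex.norm_I, one_mul, Complex.norm_real, Real.norm_eq_abs]
      have := mul_le_mul_of_nonneg_left (NN_nrm (γ := γ) (hM τ hτ)) (abs_nonneg lam)
      linarith)
    (fun τ hτ => by linarith [(nrm_le_nS _).trans (hM τ hτ)])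
    (fun τ hτ => by linarith [NN_nrm (γ := γ) (hM τ hτ)])).2
  simp only [e1, ip_smul_left, ip_NN_real, map_neg, map_mul, Complex.conj_I, Complex.conj_ofReal] at hp
  ring_nf at hp
  simp only [intervalIntegral.integral_zero] at hp
  rw [ip_self, ip_self] at hp
  have h2 : nrm (u t) ^ 2 = nrm (u s) ^ 2 := by
    have := congrArg Complex.re hp
    simp only [Complex.sub_re, Complex.ofReal_re, Complex.add_re, Complex.neg_re, Complex.zero_re] at this; linarith
  exact (pow_left_inj₀ (nrm_nonneg _) (nrm_nonneg _) two_ne_zero).mp h2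

lemma ip_zero_right (φ : SR n) : ip φ (0 : SR n) = 0 := by simp [ip]
lemma ip_zero_left (φ : SR n) : ip (0 : SR n) φ = 0 := by simp [ip]

lemma ip_neg_left' (φ ψ : SR n) : ip (-φ) ψ = - ip φ ψ := by simp [ip]

lemma const_pair [P : Par n γ] (hε : 0 < ε) (hu : Sol γ ε lam u) {s t M : ℝ} (hst : s ≤ t)
    (hM : ∀ τ ∈ Set.Icc s t, nS (u τ) ≤ M) (Ψ : SR n) :
    IntervalIntegrable (fun τ => -ip (HH ε Ψ) (u τ) - Complex.I * lam * ip Ψ (NN γ (u τ))) volume s t ∧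
    ip Ψ (u t) - ip Ψ (u s) = ∫ τ in s..t, (-ip (HH ε Ψ) (u τ) - Complex.I * lam * ip Ψ (NN γ (u τ))) := by
  have hcv := CV_nonneg n γ
  have hM0 : 0 ≤ M := (nS_nonneg _).trans (hM s ⟨le_rfl, hst⟩)
  have hx : 0 ≤ CV n γ * M ^ 3 := by positivity
  have c1 : Continuous fun q : ℝ × Rn n => Ψ q.2 := Ψ.continuous.comp continuous_snd
  have hp := (pairing hε hu (Ψ := fun _ => Ψ) (Ψ' := fun τ => 0) c1 continuous_const (fun t x => hasDerivAt_const _ _) hst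
    (B := nS Ψ + nrm (HH ε Ψ)) (M := M + CV n γ * M ^ 3)
    (fun τ hτ => by linarith [nrm_le_nS Ψ, nrm_nonneg (HH ε Ψ)])
    (fun τ hτ j => by linarith [nrmD_le_nS j Ψ, nrm_nonneg (HH ε Ψ)])
    (fun τ hτ => by
      rw [zero_sub, nrm_neg]; linarith [nS_nonneg Ψ])
    (fun τ hτ => by linarith [(nrm_le_nS _).trans (hM τ hτ)])
    (fun τ hτ => by linarith [NN_nrm (γ := γ) (hM τ hτ)]))
  simpa only [ip_sub_left, ip_zero_left, zero_sub, ip_neg_left'] using hp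

lemma const_pair_le [P : Par n γ] (hε : 0 < ε) (hu : Sol γ ε lam u) {s t M : ℝ} (hst : s ≤ t)
    (hM : ∀ τ ∈ Set.Icc s t, nS (u τ) ≤ M) (Ψ : SR n) :
    ‖ip Ψ (u t) - ip Ψ (u s)‖ ≤ (nrm (HH ε Ψ) * M + |lam| * (nrm Ψ * (CV n γ * M ^ 3))) * (t - s) := by
  rw [(const_pair hε hu hst hM Ψ).2]
  refine (intervalIntegral.norm_integral_le_of_norm_le_const (C := nrm (HH ε Ψ) * M + |lam| * (nrm Ψ * (CV n γ * M ^ 3))) fun τ hτ => ?_).trans_eq ?_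
  · rw [Set.uIoc_of_le hst] at hτ
    have hτ' : τ ∈ Set.Icc s t := ⟨hτ.1.le, hτ.2⟩
    refine (norm_sub_le _ _).trans ?_
    rw [norm_neg, norm_mul, norm_mul, Complex.norm_I, one_mul, Complex.norm_real, Real.norm_eq_abs]
    have b1 := (ip_le (HH ε Ψ) (u τ)).trans (mul_le_mul_of_nonneg_left ((nrm_le_nS _).trans (hM τ hτ')) (nrm_nonneg _))
    have b2 := (ip_le Ψ (NN γ (u τ))).trans (mul_le_mul_of_nonneg_left (NN_nrm (γ := γ) (hM τ hτ')) (nrm_nonneg _))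
    gcongr
  · rw [abs_of_nonneg (show 0 ≤ t - s by linarith)]

section onint
variable {a b M : ℝ}

lemma nrm_diff_le [P : Par n γ] (hε : 0 < ε) (hu : Sol γ ε lam u) (hM : ∀ τ ∈ Set.Icc a b, nS (u τ) ≤ M) {s : ℝ} (hs : s ∈ Set.Icc a b) :
    ∃ C, 0 ≤ C ∧ ∀ t ∈ Set.Icc a b, nrm (u t - u s) ^ 2 ≤ C * |t - s| ∧ nrm (u t - u s) ^ 2 = -2 * (ip (u s) (u t) - ip (u s) (u s)).re := by
  have hM0 : 0 ≤ M := (nS_nonneg _).trans (hM s hs)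
  have hcv := CV_nonneg n γ
  set C := nrm (HH ε (u s)) * M + |lam| * (nrm (u s) * (CV n γ * M ^ 3)) with hC
  have hn := nrm_nonneg (HH ε (u s))
  have hn' := nrm_nonneg (u s)
  have hC0 : 0 ≤ C := by positivity
  refine ⟨2 * C, by positivity, fun t ht => ?_⟩
  have hm : nrm (u t) = nrm (u s) := by
    rcases le_total s t with h | h
    · exact mass hε hu h fun τ hτ => hM τ ⟨hs.1.trans hτ.1, hτ.2.trans ht.2⟩
    · exact (mass hε hu h fun τ hτ => hM τ ⟨ht.1.trans hτ.1, hτ.2.trans hs.2⟩).symm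
  have hk : ‖ip (u s) (u t) - ip (u s) (u s)‖ ≤ C * |t - s| := by
    rcases le_total s t with h | h
    · rw [abs_of_nonneg (by linarith)]
      exact const_pair_le hε hu h (fun τ hτ => hM τ ⟨hs.1.trans hτ.1, hτ.2.trans ht.2⟩) _
    · rw [abs_of_nonpos (by linarith), neg_sub, norm_sub_rev]
      exact const_pair_le hε hu h (fun τ hτ => hM τ ⟨ht.1.trans hτ.1, hτ.2.trans hs.2⟩) _
  have h3 := nrm_add_sq (u s) (u t - u s)
  rw [add_sub_cancel, hm, ip_sub_right] at h3
  have h4 := Complex.abs_re_le_norm (ip (u s) (u t) - ip (u s) (u s))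
  have h5 := neg_abs_le (ip (u s) (u t) - ip (u s) (u s)).re
  constructor <;> nlinarith

lemma nrm_cont [P : Par n γ] (hε : 0 < ε) (hu : Sol γ ε lam u) (hM : ∀ τ ∈ Set.Icc a b, nS (u τ) ≤ M) {s : ℝ} (hs : s ∈ Set.Icc a b) :
    Tendsto (fun t => nrm (u t - u s)) (𝓝[Set.Icc a b] s) (𝓝 0) := by
  obtain ⟨C, hC, h⟩ := nrm_diff_le hε hu hM hs
  have h1 : Tendsto (fun t => √(C * |t - s|)) (𝓝[Set.Icc a b] s) (𝓝 0) := by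
    have : Continuous fun t => √(C * |t - s|) := by fun_prop
    have := this.tendsto s
    simp only [sub_self, abs_zero, mul_zero, Real.sqrt_zero] at this
    exact this.mono_left nhdsWithin_le_nhds
  refine squeeze_zero' (Eventually.of_forall fun t => nrm_nonneg _) ?_ h1
  filter_upwards [self_mem_nhdsWithin] with t ht
  exact Real.le_sqrt_of_sq_le (h t ht).1

lemma TT_near [P : Par n γ] {M δ : ℝ} {x a b c : SR n} (hx : nS x ≤ M) (hb : nS b ≤ M) (hc : nS c ≤ M)
    (ha' : nrm (a - x) ≤ δ) (hb' : nrm (b - x) ≤ δ) (hc' : nrm (c - x) ≤ δ) :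
    nrm (TT γ a b c - NN γ x) ≤ 3 * CV n γ * M ^ 2 * δ := by
  have hcv := CV_nonneg n γ
  have hM0 : 0 ≤ M := (nS_nonneg _).trans hx
  have hδ : 0 ≤ δ := (nrm_nonneg _).trans ha'
  rw [TT_diff]
  have t1 : nrm (TT γ (a - x) b c) ≤ CV n γ * (δ * M * M) := (TT_le2 _ _ _).trans (by
    have := h1_nonneg b; have := nrm_nonneg c
    gcongr
    · exact (h1_le_nS _).trans hb
    · exact (nrm_le_nS _).trans hc)
  have t2 : nrm (TT γ x (b - x) c) ≤ CV n γ * (M * δ * M) := (TT_le1 _ _ _).trans (by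
    have := nrm_nonneg (b - x); have := nrm_nonneg c
    gcongr
    · exact (h1_le_nS _).trans hx
    · exact (nrm_le_nS _).trans hc)
  have t3 : nrm (TT γ x x (c - x)) ≤ CV n γ * (M * M * δ) := (TT_le1 _ _ _).trans (by
    have := nrm_nonneg (c - x); have := nrm_nonneg x
    gcongr
    · exact (h1_le_nS _).trans hx
    · exact (nrm_le_nS _).trans hx)
  have := nrm_add (TT γ (a - x) b c + TT γ x (b - x) c) (TT γ x x (c - x))
  have := nrm_add (TT γ (a - x) b c) (TT γ x (b - x) c)
  nlinarith

lemma pE_exp [P : Par n γ] {M : ℝ} {x w : SR n} (hx : nS x ≤ M) (hw : nS w ≤ M) :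
    |pE γ w - pE γ x - 4 * (ip (NN γ x) (w - x)).re| ≤ 9 * CV n γ * M ^ 2 * nrm (w - x) ^ 2 := by
  set d := w - x with hd
  have e0 : ip w (NN γ w) - ip x (NN γ x) = ip d (NN γ x) + ip x (NN γ w - NN γ x) + ip d (NN γ w - NN γ x) := by
    rw [hd]; simp only [ip_sub_left, ip_sub_right]; ring
  have e1 : ip x (NN γ w - NN γ x) = ip (TT γ x w w) d + ip d (TT γ w x x) + ip (NN γ x) d := by
    rw [TT_diff, ip_add_right, ip_add_right, TT_swap _ w w x, TT_adj w x, TT_swap x _ w x, TT_adj x x _ x]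
  have e2 : ip w (NN γ w) - ip x (NN γ x) = ip d (NN γ x) + ip (NN γ x) d + ip d (NN γ x) + ip (NN γ x) d
      + ip (TT γ x w w - NN γ x) d + ip d (TT γ w x x - NN γ x) + ip d (NN γ w - NN γ x) := by
    rw [e0, e1]; simp only [ip_sub_left, ip_sub_right]; ring
  have hre : (ip d (NN γ x)).re = (ip (NN γ x) d).re := by rw [← ip_conj, Complex.conj_re]
  have e3 : pE γ w - pE γ x - 4 * (ip (NN γ x) d).re =
      (ip (TT γ x w w - NN γ x) d + ip d (TT γ w x x - NN γ x) + ip d (NN γ w - NN γ x)).re := by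
    have := congrArg Complex.re e2
    simp only [Complex.sub_re, Complex.add_re, hre] at this
    simp only [pE, Complex.add_re]; linarith
  rw [e3]
  refine (Complex.abs_re_le_norm _).trans (norm_add₃_le.trans ?_)
  have hz : nrm (x - x) ≤ nrm d := by rw [sub_self, nrm_zero]; exact nrm_nonneg _
  have hn := nrm_nonneg d
  have n1 := TT_near (γ := γ) hx hw hw hz le_rfl le_rfl
  have n2 := TT_near (γ := γ) hx hx hx (le_refl (nrm d)) hz hz
  have n3 := TT_near (γ := γ) (a := w) hx hw hw (le_refl (nrm d)) le_rfl le_rfl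
  have m1 := (ip_le (TT γ x w w - NN γ x) d).trans (mul_le_mul_of_nonneg_right n1 hn)
  have m2 := (ip_le d (TT γ w x x - NN γ x)).trans (mul_le_mul_of_nonneg_left n2 hn)
  have m3 := (ip_le d (NN γ w - NN γ x)).trans (mul_le_mul_of_nonneg_left n3 hn)
  nlinarith
end onint

end

section
open SchwartzMap

variable {n : ℕ} {ε γ lam : ℝ} {u : ℝ → SR n}

lemma ftc_right {F f : ℝ → ℂ} {s b : ℝ} (hsb : s < b)
    (hF : ∀ t ∈ Set.Icc s b, IntervalIntegrable f volume s t ∧ F t - F s = ∫ τ in s..t, f τ)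
    (hf : Tendsto f (𝓝[>] s) (𝓝 (f s))) : HasDerivWithinAt F (f s) (Set.Ici s) s := by
  have h1 : HasDerivWithinAt (fun t => ∫ τ in s..t, f τ) (f s) (Set.Ici s) s := by
    refine intervalIntegral.integral_hasDerivWithinAt_right (t := Set.Ioi s) (by simp) ?_ hf
    refine ⟨Set.Ioc s b, Ioc_mem_nhdsGT hsb, ?_⟩
    exact (hF b ⟨hsb.le, le_rfl⟩).1.1.aestronglyMeasurable
  have h2 : HasDerivWithinAt (fun t => (∫ τ in s..t, f τ) + F s) (f s) (Set.Ici s) s := h1.add_const _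
  refine h2.congr_of_eventuallyEq ?_ (by simp)
  filter_upwards [Icc_mem_nhdsGE hsb] with t ht
  rw [← (hF t ht).2]; ring

lemma dom_deriv0 {r g : ℝ → ℝ} {S : Set ℝ} {s C : ℝ} (hs : s ∈ S) (hg : HasDerivWithinAt g 0 S s) (hg0 : g s = 0)
    (hb : ∀ᶠ t in 𝓝[S] s, |r t| ≤ C * g t) : HasDerivWithinAt r 0 S s := by
  have hr0 : r s = 0 := by
    have := hb.self_of_nhdsWithin hs
    rw [hg0, mul_zero] at this
    exact abs_nonpos_iff.mp this
  rw [hasDerivWithinAt_iff_isLittleO] at hg ⊢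
  simp only [hg0, hr0, sub_zero, smul_zero] at hg ⊢
  refine Asymptotics.IsBigO.trans_isLittleO ?_ hg
  refine Asymptotics.IsBigO.of_bound |C| ?_
  filter_upwards [hb] with t ht
  rw [Real.norm_eq_abs, Real.norm_eq_abs, ← abs_mul]
  exact ht.trans (le_abs_self _)

lemma NN_nS [P : Par n γ] {φ : SR n} {M : ℝ} (h : nS φ ≤ M) : nS (NN γ φ) ≤ CS n γ * M ^ 3 := by
  have h1 := TE_nS' (γ := γ) 0 φ φ φ
  rw [TE_zero] at h1
  have := CS_nonneg n γ
  have h4 := nS_nonneg φ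
  have : 0 ≤ M := h4.trans h
  calc _ ≤ _ := h1
    _ ≤ CS n γ * (M * M * M) := by gcongr
    _ = _ := by ring

lemma cos_ne_of_lt {x : ℝ} (h : |x| ≤ 1) : cos x ≠ 0 := by
  have := Real.pi_gt_three
  exact (Real.cos_pos_of_mem_Ioo ⟨by linarith [(abs_le.mp h).1], by linarith [(abs_le.mp h).2]⟩).ne'

section onint
variable {a b M : ℝ}

def KL (n : ℕ) (ε γ lam M : ℝ) [P : Par n γ] : ℝ := |lam| * ((2 * n + 1) * (1 + √(2 * n)) / ε * (CS n γ * M ^ 3))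

lemma frame_lip [P : Par n γ] (h0 : 0 < ε) (h1 : ε ≤ 1) (hu : Sol γ ε lam u) (hM : ∀ τ ∈ Set.Icc a b, nS (u τ) ≤ M) {s t : ℝ}
    (hs : s ∈ Set.Icc a b) (ht : t ∈ Set.Icc a b) (hst : |t - s| ≤ 1) :
    nS (AA ε (t - s) (u t) - u s) ≤ KL n ε γ lam M * |t - s| := by
  have key : ∀ σ τ : ℝ, σ ≤ τ → (Set.Icc σ τ ⊆ Set.Icc a b) → ∀ d : SR n,
      WeakInt d (fun τ => (-(Complex.I * lam)) • AA ε (τ - s) (NN γ (u τ))) σ τ → nS d ≤ KL n ε γ lam M * (τ - σ) := by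
    intro σ τ h hsub d hw
    have := hw.nS_le h (b := fun _ => KL n ε γ lam M) (by simp) (by
      filter_upwards [cos_ae s] with ρ hc hρ
      have hρ' : ρ ∈ Set.Icc σ τ := ⟨hρ.1.le, hρ.2⟩
      rw [nS_smul, norm_neg, norm_mul, Complex.norm_I, one_mul, Complex.norm_real, Real.norm_eq_abs, KL]
      gcongr
      refine (AA_nS h0 h1 hc _).trans ?_
      gcongr
      exact NN_nS (hM ρ (hsub hρ')))
    simpa [mul_comm] using this
  have hc : cos (t - s) ≠ 0 := cos_ne_of_lt hst
  rcases le_total s t with h | h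
  · rw [abs_of_nonneg (by linarith)]
    have hsub : Set.Icc s t ⊆ Set.Icc a b := Set.Icc_subset_Icc hs.1 ht.2
    refine key s t h hsub _ (duhamel h0 hu h (fun τ hτ => hM τ (hsub hτ)) fun p => ?_)
    rw [ip_sub_right, AA_GS h0 hc, sub_self]
  · rw [abs_of_nonpos (by linarith), neg_sub, nS_sub_comm]
    have hsub : Set.Icc t s ⊆ Set.Icc a b := Set.Icc_subset_Icc ht.1 hs.2
    refine key t s h hsub _ (duhamel h0 hu h (fun τ hτ => hM τ (hsub hτ)) fun p => ?_)
    rw [ip_sub_right, AA_GS h0 hc, sub_self]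

lemma KL_nonneg (n : ℕ) {γ lam : ℝ} [P : Par n γ] (h0 : 0 < ε) (hM : 0 ≤ M) : 0 ≤ KL n ε γ lam M := by
  have := CS_nonneg n γ
  unfold KL; positivity

lemma hq_cont [P : Par n γ] (h0 : 0 < ε) (h1 : ε ≤ 1) (hu : Sol γ ε lam u) (hM : ∀ τ ∈ Set.Icc a b, nS (u τ) ≤ M) :
    ContinuousOn (fun t => hq ε (u t)) (Set.Icc a b) := by
  intro s hs
  have hM0 : 0 ≤ M := (nS_nonneg _).trans (hM s hs)
  have hK := KL_nonneg n (γ := γ) (lam := lam) h0 hM0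
  set K := KL n ε γ lam M
  have hb : ∀ᶠ t in 𝓝[Set.Icc a b] s, |hq ε (u t) - hq ε (u s)| ≤ 4 * n * (M * (K * |t - s|)) + 2 * n * (K * |t - s|) ^ 2 := by
    have : ∀ᶠ t in 𝓝[Set.Icc a b] s, |t - s| < 1 := by
      have h2 : ∀ᶠ t in 𝓝 s, dist t s < 1 := Metric.ball_mem_nhds s one_pos
      exact h2.filter_mono nhdsWithin_le_nhds
    filter_upwards [this, self_mem_nhdsWithin] with t ht htm
    have hl := frame_lip h0 h1 hu hM hs htm ht.le
    set e := AA ε (t - s) (u t) - u s with he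
    have h3 : hq ε (u t) = hq ε (u s) + 2 * (hf ε (u s) e).re + hq ε e := by
      rw [← hq_add_sq, he, add_sub_cancel, AA_hq h0.ne' (cos_ne_of_lt ht.le)]
    have h4 := hf_le h0 h1 (u s) e
    have h5 := Complex.abs_re_le_norm (hf ε (u s) e)
    have h6 := hq_le_nS h0 h1 e
    have h7 := hq_nonneg ε e
    have h8 : nS (u s) * nS e ≤ M * (K * |t - s|) := mul_le_mul (hM s hs) hl (nS_nonneg _) hM0
    have h9 : nS e ^ 2 ≤ (K * |t - s|) ^ 2 := by have := nS_nonneg e; gcongr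
    have hn : (0 : ℝ) ≤ n := Nat.cast_nonneg n
    have h10 : 2 * n * (nS (u s) * nS e) ≤ 2 * n * (M * (K * |t - s|)) := by gcongr
    have h11 : 2 * n * nS e ^ 2 ≤ 2 * n * (K * |t - s|) ^ 2 := by gcongr
    have h12 := abs_le.mp (h5.trans (h4.trans h10))
    rw [h3, abs_le]; constructor <;> linarith [h12.1, h12.2]
  rw [ContinuousWithinAt, tendsto_iff_norm_sub_tendsto_zero]
  refine squeeze_zero' (Eventually.of_forall fun _ => norm_nonneg _) hb ?_
  have hc : Continuous fun t => 4 * n * (M * (K * |t - s|)) + 2 * n * (K * |t - s|) ^ 2 := by fun_prop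
  have := hc.tendsto s
  simp only [sub_self, abs_zero, mul_zero, ne_eq, OfNat.ofNat_ne_zero, not_false_eq_true, zero_pow, add_zero] at this
  exact this.mono_left nhdsWithin_le_nhds

lemma pE_cont [P : Par n γ] (h0 : 0 < ε) (hu : Sol γ ε lam u) (hM : ∀ τ ∈ Set.Icc a b, nS (u τ) ≤ M) :
    ContinuousOn (fun t => pE γ (u t)) (Set.Icc a b) := by
  intro s hs
  have hb : ∀ᶠ t in 𝓝[Set.Icc a b] s, |pE γ (u t) - pE γ (u s)| ≤ 4 * (nrm (NN γ (u s)) * nrm (u t - u s)) + 9 * CV n γ * M ^ 2 * nrm (u t - u s) ^ 2 := by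
    filter_upwards [self_mem_nhdsWithin] with t htm
    have h1 := pE_exp (γ := γ) (hM s hs) (hM t htm)
    have h2 := (Complex.abs_re_le_norm _).trans (ip_le (NN γ (u s)) (u t - u s))
    rw [abs_le] at h1 h2 ⊢
    constructor <;> linarith [h1.1, h1.2, h2.1, h2.2]
  rw [ContinuousWithinAt, tendsto_iff_norm_sub_tendsto_zero]
  refine squeeze_zero' (Eventually.of_forall fun _ => norm_nonneg _) hb ?_
  have hn := nrm_cont h0 hu hM hs
  simpa using ((hn.const_mul (nrm (NN γ (u s)))).const_mul 4).add ((hn.pow 2).const_mul (9 * CV n γ * M ^ 2))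

lemma NN_tend [P : Par n γ] (h0 : 0 < ε) (hu : Sol γ ε lam u) (hM : ∀ τ ∈ Set.Icc a b, nS (u τ) ≤ M) {s : ℝ} (hs : s ∈ Set.Icc a b) :
    Tendsto (fun t => nrm (NN γ (u t) - NN γ (u s))) (𝓝[Set.Icc a b] s) (𝓝 0) := by
  have hn := nrm_cont h0 hu hM hs
  refine squeeze_zero' (g := fun t => 3 * CV n γ * M ^ 2 * nrm (u t - u s)) (Eventually.of_forall fun _ => nrm_nonneg _) ?_ (by simpa using hn.const_mul (3 * CV n γ * M ^ 2))
  filter_upwards [self_mem_nhdsWithin] with t ht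
  exact TT_near (hM s hs) (hM t ht) (hM t ht) le_rfl le_rfl le_rfl

lemma ip_tend {w : ℝ → SR n} {w0 : SR n} {l : Filter ℝ} (h : Tendsto (fun t => nrm (w t - w0)) l (𝓝 0)) (φ : SR n) :
    Tendsto (fun t => ip φ (w t)) l (𝓝 (ip φ w0)) := by
  rw [tendsto_iff_norm_sub_tendsto_zero]
  refine squeeze_zero (fun _ => norm_nonneg _) (g := fun t => nrm φ * nrm (w t - w0)) (fun t => ?_) (by simpa using h.const_mul (nrm φ))
  rw [← ip_sub_right]; exact ip_le _ _

lemma gt_le_Icc {s : ℝ} (hs : s ∈ Set.Ico a b) : 𝓝[>] s ≤ 𝓝[Set.Icc a b] s :=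
  nhdsWithin_le_of_mem (mem_of_superset (Ioc_mem_nhdsGT hs.2) fun _ h => ⟨hs.1.trans h.1.le, h.2⟩)

lemma ip_right [P : Par n γ] (h0 : 0 < ε) (hu : Sol γ ε lam u) (hM : ∀ τ ∈ Set.Icc a b, nS (u τ) ≤ M) {s : ℝ} (hs : s ∈ Set.Ico a b) (Ψ : SR n) :
    HasDerivWithinAt (fun t => ip Ψ (u t)) (-ip (HH ε Ψ) (u s) - Complex.I * lam * ip Ψ (NN γ (u s))) (Set.Ici s) s := by
  have hs' : s ∈ Set.Icc a b := ⟨hs.1, hs.2.le⟩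
  refine ftc_right (f := fun τ => -ip (HH ε Ψ) (u τ) - Complex.I * lam * ip Ψ (NN γ (u τ))) hs.2 (fun t ht => ?_) ?_
  · exact const_pair h0 hu ht.1 (fun τ hτ => hM τ ⟨hs.1.trans hτ.1, hτ.2.trans ht.2⟩) Ψ
  · have t1 := (ip_tend (nrm_cont h0 hu hM hs') (HH ε Ψ)).mono_left (gt_le_Icc hs)
    have t2 := (ip_tend (NN_tend h0 hu hM hs') Ψ).mono_left (gt_le_Icc hs)
    exact t1.neg.sub (t2.const_mul _)

lemma pE_right [P : Par n γ] (h0 : 0 < ε) (hu : Sol γ ε lam u) (hM : ∀ τ ∈ Set.Icc a b, nS (u τ) ≤ M) {s : ℝ} (hs : s ∈ Set.Ico a b) :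
    HasDerivWithinAt (fun t => pE γ (u t)) (4 * (ip (HH ε (u s)) (NN γ (u s))).re) (Set.Ici s) s := by
  have hs' : s ∈ Set.Icc a b := ⟨hs.1, hs.2.le⟩
  have hmem : Set.Icc s b ∈ 𝓝[≥] s := Icc_mem_nhdsGE hs.2
  have hself : (ip (u s) (HH ε (u s))).re = 0 := by
    have h1 := HH_anti (ε := ε) (u s) (u s)
    rw [← ip_conj (u s) (HH ε (u s))] at h1
    have := congrArg Complex.re h1
    simp at this; linarith
  have hre : ∀ {F : ℝ → ℂ} {F' : ℂ}, HasDerivWithinAt F F' (Set.Ici s) s → HasDerivWithinAt (fun t => (F t).re) F'.re (Set.Ici s) s :=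
    fun h => Complex.reCLM.hasFDerivAt.comp_hasDerivWithinAt s h
  obtain ⟨C, _, hC⟩ := nrm_diff_le h0 hu hM hs'
  have hd2 : HasDerivWithinAt (fun t => nrm (u t - u s) ^ 2) 0 (Set.Ici s) s := by
    have h1 := (hre ((ip_right h0 hu hM hs (u s)).sub_const (ip (u s) (u s)))).const_mul (-2)
    have h2 : -2 * (-ip (HH ε (u s)) (u s) - Complex.I * lam * ip (u s) (NN γ (u s))).re = 0 := by
      have im0 : (ip (u s) (NN γ (u s))).im = 0 := by
        have := ip_NN_real (γ := γ) (u s)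
        rw [← ip_conj] at this
        exact Complex.conj_eq_iff_im.mp this
      rw [← HH_anti, Complex.sub_re, hself, mul_assoc, Complex.I_mul_re, Complex.im_ofReal_mul, im0]; simp
    rw [h2] at h1
    refine h1.congr_of_eventuallyEq ?_ (by simp [nrm_zero])
    filter_upwards [hmem] with t ht
    exact (hC t ⟨hs.1.trans ht.1, ht.2⟩).2
  have hr : HasDerivWithinAt (fun t => pE γ (u t) - pE γ (u s) - 4 * (ip (NN γ (u s)) (u t - u s)).re) 0 (Set.Ici s) s := by
    refine dom_deriv0 (C := 9 * CV n γ * M ^ 2) (by simp) hd2 (by simp [nrm_zero]) ?_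
    filter_upwards [hmem] with t ht
    exact pE_exp (hM s hs') (hM t ⟨hs.1.trans ht.1, ht.2⟩)
  have h3 := (hre ((ip_right h0 hu hM hs (NN γ (u s))).sub_const (ip (NN γ (u s)) (u s)))).const_mul 4
  have h4 := (hr.add h3).add_const (pE γ (u s))
  have e5 : 0 + 4 * (-ip (HH ε (NN γ (u s))) (u s) - Complex.I * lam * ip (NN γ (u s)) (NN γ (u s))).re = 4 * (ip (HH ε (u s)) (NN γ (u s))).re := by
    rw [← HH_anti, ip_self, Complex.sub_re, ← ip_conj (HH ε (u s)), Complex.conj_re, mul_assoc, Complex.I_mul_re, ← Complex.ofReal_mul, Complex.ofReal_im]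
    ring
  rw [e5] at h4
  refine h4.congr_of_eventuallyEq (Eventually.of_forall fun t => ?_) ?_
  · simp only [Pi.add_apply, ip_sub_right]; ring
  · simp only [Pi.add_apply, ip_sub_right]; ring

lemma hq_right [P : Par n γ] (h0 : 0 < ε) (h1 : ε ≤ 1) (hu : Sol γ ε lam u) (hM : ∀ τ ∈ Set.Icc a b, nS (u τ) ≤ M) {s : ℝ} (hs : s ∈ Set.Ico a b) :
    HasDerivWithinAt (fun t => hq ε (u t)) (-4 * ε * lam * (ip (HH ε (u s)) (NN γ (u s))).re) (Set.Ici s) s := by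
  have hs' : s ∈ Set.Icc a b := ⟨hs.1, hs.2.le⟩
  have hM0 : 0 ≤ M := (nS_nonneg _).trans (hM s hs')
  set b' := min b (s + 1) with hb'
  have hsb : s < b' := lt_min hs.2 (by linarith)
  have hin : ∀ t ∈ Set.Icc s b', t ∈ Set.Icc a b ∧ |t - s| ≤ 1 := fun t ht =>
    ⟨⟨hs.1.trans ht.1, ht.2.trans (min_le_left _ _)⟩, by rw [abs_of_nonneg (by linarith [ht.1])]; linarith [ht.2.trans (min_le_right b (s + 1))]⟩
  set G := HH ε (u s)
  have hF : HasDerivWithinAt (fun t => ip G (AA ε (t - s) (u t))) (ip G ((-(Complex.I * lam)) • AA ε (s - s) (NN γ (u s)))) (Set.Ici s) s := by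
    refine ftc_right (f := fun τ => ip G ((-(Complex.I * lam)) • AA ε (τ - s) (NN γ (u τ)))) hsb (fun t ht => ?_) ?_
    · have hw := duhamel h0 hu (s0 := s) ht.1 (fun τ hτ => hM τ (hin τ ⟨hτ.1, hτ.2.trans ht.2⟩).1) (d := AA ε (t - s) (u t) - u s) (fun p => by
        rw [ip_sub_right, AA_GS h0 (cos_ne_of_lt (hin t ht).2), sub_self]) G
      refine ⟨hw.1, ?_⟩
      simp only [sub_self, AA_zero h0]
      rw [← ip_sub_right]; exact hw.2
    · simp only [ip_smul_right, sub_self, AA_zero h0]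
      refine Tendsto.const_mul _ ?_
      have t1 : Tendsto (fun τ => ip G (AA ε (τ - s) (NN γ (u s)))) (𝓝[>] s) (𝓝 (ip G (NN γ (u s)))) := by
        refine (AA_weak h0 G (NN γ (u s))).comp ?_
        have : Continuous fun τ : ℝ => τ - s := by fun_prop
        have := this.tendsto s
        rw [sub_self] at this
        exact this.mono_left nhdsWithin_le_nhds
      have t2 : Tendsto (fun τ => ip G (AA ε (τ - s) (NN γ (u τ) - NN γ (u s)))) (𝓝[>] s) (𝓝 0) := by
        have t3 := (NN_tend h0 hu hM hs').mono_left (gt_le_Icc hs)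
        refine squeeze_zero_norm' (a := fun τ => nrm G * nrm (NN γ (u τ) - NN γ (u s))) ?_ (by simpa using t3.const_mul (nrm G))
        filter_upwards [Ioc_mem_nhdsGT hsb] with τ hτ
        refine (ip_le _ _).trans_eq ?_
        rw [AA_nrm (cos_ne_of_lt (hin τ ⟨hτ.1.le, hτ.2⟩).2)]
      have t4 := t1.add t2
      rw [add_zero] at t4
      refine t4.congr' ?_
      filter_upwards [Ioc_mem_nhdsGT hsb] with τ hτ
      rw [AA_sub (cos_ne_of_lt (hin τ ⟨hτ.1.le, hτ.2⟩).2), ip_sub_right]; ring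
  have he : HasDerivWithinAt (fun t => hq ε (AA ε (t - s) (u t) - u s)) 0 (Set.Ici s) s := by
    have hg : HasDerivWithinAt (fun t : ℝ => (t - s) ^ 2) 0 (Set.Ici s) s := by
      have := (((hasDerivAt_id' s).sub_const s).fun_pow 2).hasDerivWithinAt (s := Set.Ici s)
      refine this.congr_deriv ?_
      simp
    refine dom_deriv0 (C := 2 * n * KL n ε γ lam M ^ 2) (by simp) hg (by simp) ?_
    filter_upwards [Icc_mem_nhdsGE hsb] with t ht
    have hl := frame_lip h0 h1 hu hM hs' (hin t ht).1 (hin t ht).2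
    rw [abs_of_nonneg (hq_nonneg _ _)]
    refine (hq_le_nS h0 h1 _).trans ?_
    rw [mul_assoc (2 * (n : ℝ)), ← sq_abs (t - s), ← mul_pow]
    have := nS_nonneg (AA ε (t - s) (u t) - u s)
    gcongr
  have hre : HasDerivWithinAt (fun t => (-2 * Complex.I * ε * (ip G (AA ε (t - s) (u t)) - ip G (u s))).re) _ (Set.Ici s) s :=
    Complex.reCLM.hasFDerivAt.comp_hasDerivWithinAt s ((hF.sub_const (ip G (u s))).const_mul (-2 * Complex.I * ε))
  have hfin := ((hre.const_mul 2).add he).const_add (hq ε (u s))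
  have hval : (2 * Complex.reCLM (-2 * Complex.I * ε * ip G ((-(Complex.I * lam)) • AA ε (s - s) (NN γ (u s)))) + 0) = -4 * ε * lam * (ip G (NN γ (u s))).re := by
    rw [sub_self, AA_zero h0, ip_smul_right, Complex.reCLM_apply,
      show -2 * Complex.I * ε * (-(Complex.I * lam) * ip G (NN γ (u s))) = ((-2 * ε * lam : ℝ) : ℂ) * ip G (NN γ (u s)) by
        push_cast; linear_combination 2 * (ε : ℂ) * lam * ip G (NN γ (u s)) * Complex.I_sq, Complex.re_ofReal_mul]
    ring
  rw [hval] at hfin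
  have heq : ∀ t ∈ Set.Icc s b', hq ε (u t) = hq ε (u s) + (2 * (-2 * Complex.I * ε * (ip G (AA ε (t - s) (u t)) - ip G (u s))).re + hq ε (AA ε (t - s) (u t) - u s)) := by
    intro t ht
    have h3 := hq_add_sq ε (u s) (AA ε (t - s) (u t) - u s)
    rw [add_sub_cancel, AA_hq h0.ne' (cos_ne_of_lt (hin t ht).2), hf_HH h0, HH_anti, ip_sub_right] at h3
    rw [h3, show 2 * Complex.I * ↑ε * -(ip (HH ε (u s)) (AA ε (t - s) (u t)) - ip (HH ε (u s)) (u s)) = -2 * Complex.I * ε * (ip G (AA ε (t - s) (u t)) - ip G (u s)) by ring]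
    ring
  refine hfin.congr_of_eventuallyEq ?_ ?_
  · filter_upwards [Icc_mem_nhdsGE hsb] with t ht
    simpa using heq t ht
  · simpa using heq s ⟨le_rfl, hsb.le⟩

lemma energy [P : Par n γ] (h0 : 0 < ε) (h1 : ε ≤ 1) (hu : Sol γ ε lam u) (hM : ∀ τ ∈ Set.Icc a b, nS (u τ) ≤ M) :
    ∀ t ∈ Set.Icc a b, hq ε (u t) + lam * ε * pE γ (u t) = hq ε (u a) + lam * ε * pE γ (u a) := by
  refine constant_of_has_deriv_right_zero (f := fun t => hq ε (u t) + lam * ε * pE γ (u t))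
    ((hq_cont h0 h1 hu hM).add ((pE_cont h0 hu hM).const_smul (lam * ε))) fun s hs => ?_
  have := (hq_right h0 h1 hu hM hs).fun_add ((pE_right h0 hu hM hs).const_mul (lam * ε))
  convert this using 1
  rw [eq_comm]; ring
end onint

end

section
open SchwartzMap
variable {n : ℕ} {ε γ lam : ℝ} {u : ℝ → SR n}

lemma hartree_nonneg (γ : ℝ) (φ : Rn n → ℂ) (x : Rn n) : 0 ≤ hartree γ φ x := by
  unfold hartree conv
  exact integral_nonneg fun y => mul_nonneg (Real.rpow_nonneg (norm_nonneg _) _) (Complex.normSq_nonneg _)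

lemma pE_nonneg [P : Par n γ] (φ : SR n) : 0 ≤ pE γ φ := by
  have e : ip φ (NN γ φ) = ((∫ x, hartree γ (⇑φ) x * Complex.normSq (φ x) : ℝ) : ℂ) := by
    rw [ip_eq, ← integral_complex_ofReal]
    refine integral_congr_ae (Eventually.of_forall fun x => ?_)
    simp only [NN, TT_apply, ← hartree_eq, Complex.ofReal_mul, Complex.normSq_eq_conj_mul_self]
    ring
  rw [pE, e, Complex.ofReal_re]
  exact integral_nonneg fun x => mul_nonneg (hartree_nonneg _ _ _) (Complex.normSq_nonneg _)

lemma pE_le [P : Par n γ] {φ : SR n} {m : ℝ} (h : nS φ ≤ m) : pE γ φ ≤ CV n γ * m ^ 4 := by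
  have hm : 0 ≤ m := (nS_nonneg _).trans h
  have h1 : pE γ φ ≤ nrm φ * nrm (NN γ φ) := (Complex.re_le_norm _).trans (ip_le _ _)
  have h2 := NN_nrm (γ := γ) h
  have h3 : nrm φ ≤ m := (nrm_le_nS _).trans h
  have := mul_le_mul h3 h2 (nrm_nonneg _) hm
  nlinarith

def PhiB (n : ℕ) (ε γ lam m : ℝ) [P : Par n γ] : ℝ := (2 * n + 1) * ((m + √ (2 * n * m ^ 2 + lam * ε * (CV n γ * m ^ 4))) / ε)

lemma PhiB_mono [P : Par n γ] (h0 : 0 < ε) (hl : 0 ≤ lam) {m m' : ℝ} (hm : 0 ≤ m) (h : m ≤ m') : PhiB n ε γ lam m ≤ PhiB n ε γ lam m' := by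
  have := CV_nonneg n γ
  unfold PhiB
  gcongr

lemma en_bd0 [P : Par n γ] (h0 : 0 < ε) (h1 : ε ≤ 1) (hl : 0 ≤ lam) {φ ψ : SR n} {m : ℝ} (hψ : nS ψ ≤ m)
    (hm : nrm φ = nrm ψ) (he : hq ε φ + lam * ε * pE γ φ = hq ε ψ + lam * ε * pE γ ψ) : nS φ ≤ PhiB n ε γ lam m := by
  have hm0 : 0 ≤ m := (nS_nonneg _).trans hψ
  have hcv := CV_nonneg n γ
  have e1 : hq ε φ ≤ 2 * n * m ^ 2 + lam * ε * (CV n γ * m ^ 4) := by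
    have a1 := hq_le_nS h0 h1 ψ
    have a2 : lam * ε * pE γ ψ ≤ lam * ε * (CV n γ * m ^ 4) := mul_le_mul_of_nonneg_left (pE_le hψ) (by positivity)
    have a3 : 0 ≤ lam * ε * pE γ φ := mul_nonneg (by positivity) (pE_nonneg _)
    have a4 : 2 * (n : ℝ) * nS ψ ^ 2 ≤ 2 * n * m ^ 2 := by
      have := nS_nonneg ψ
      gcongr
    linarith
  refine (nS_le_hq h0 h1 φ).trans ?_
  unfold PhiB
  have : nrm φ ≤ m := hm ▸ (nrm_le_nS _).trans hψ
  gcongr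

lemma energy_bd [P : Par n γ] (h0 : 0 < ε) (h1 : ε ≤ 1) (hl : 0 ≤ lam) (hu : Sol γ ε lam u) {s t M : ℝ}
    (hM : ∀ τ ∈ Set.uIcc s t, nS (u τ) ≤ M) : nS (u t) ≤ PhiB n ε γ lam (nS (u s)) := by
  rcases le_total s t with h | h
  · rw [Set.uIcc_of_le h] at hM
    exact en_bd0 h0 h1 hl le_rfl (mass h0 hu h hM) (energy h0 h1 hu hM t ⟨h, le_rfl⟩)
  · rw [Set.uIcc_of_ge h] at hM
    exact en_bd0 h0 h1 hl le_rfl (mass h0 hu h hM).symm (energy h0 h1 hu hM s ⟨h, le_rfl⟩).symm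

lemma ipK_cont {w : ℝ → SR n} (hw : Continuous (fun p : ℝ × Rn n => w p.1 p.2)) (k : ℕ) (φ : SR n) :
    Continuous fun t => ip (mK k φ) (w t) := by
  have e : (fun t => ip (mK k φ) (w t)) = fun t => ∫ x in Metric.closedBall (0 : Rn n) (2 * ((k : ℝ) + 1)), KK n k x * (conj (φ x) * w t x) := by
    funext t
    rw [mK_ip, setIntegral_eq_integral_of_forall_compl_eq_zero]
    intro x hx
    rw [KK_zero, zero_mul]
    simpa using (not_le.1 (by simpa using hx)).le
  rw [e]
  have c1 : Continuous fun x : Rn n => mK k φ x := (mK k φ).continuous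
  have c2 : Continuous (Function.uncurry fun (t : ℝ) (x : Rn n) => KK n k x * (conj (φ x) * w t x)) := by
    have c3 : Continuous fun p : ℝ × Rn n => KK n k p.2 * conj (φ p.2) := by
      have : Continuous fun x : Rn n => KK n k x * conj (φ x) := by
        have := (mK k (cj φ)).continuous
        have e2 : (fun x : Rn n => KK n k x * conj (φ x)) = ⇑(mK k (cj φ)) := by
          funext x
          rw [mK_apply]; rfl
        rw [e2]; exact this
      exact this.comp continuous_snd
    have e3 : (Function.uncurry fun (t : ℝ) (x : Rn n) => KK n k x * (conj (φ x) * w t x)) = fun p : ℝ × Rn n => KK n k p.2 * conj (φ p.2) * w p.1 p.2 := by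
      funext p
      simp only [Function.uncurry]; ring
    rw [e3]; exact c3.mul hw
  exact continuous_parametric_integral_of_continuous c2 (isCompact_closedBall _ _)

lemma lsc {w : ℝ → SR n} (hw : Continuous (fun p : ℝ × Rn n => w p.1 p.2)) {c : ℝ} (hc : 0 ≤ c) : IsClosed {t | nrm (w t) ≤ c} := by
  have e : {t | nrm (w t) ≤ c} = ⋂ φ : SR n, ⋂ k : ℕ, {t | ‖ip (mK k φ) (w t)‖ ≤ c * nrm φ} := by
    ext t
    simp only [Set.mem_setOf_eq, Set.mem_iInter]
    constructor
    · intro h φ k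
      have h2 := mul_le_mul (mK_nrm k φ) h (nrm_nonneg _) (nrm_nonneg _)
      have := ip_le (mK k φ) (w t)
      linarith
    · intro h
      obtain ⟨w1, h1, h2⟩ := nrm_dual (w t)
      have h3 : ‖ip w1 (w t)‖ ≤ c * nrm w1 := le_of_tendsto (mK_tendsto w1 (w t)).norm (Eventually.of_forall fun k => h w1 k)
      rw [h1, Complex.norm_real, Real.norm_of_nonneg (nrm_nonneg _)] at h3
      have := nrm_nonneg (w t)
      have := nrm_nonneg w1
      nlinarith
  rw [e]
  exact isClosed_iInter fun φ => isClosed_iInter fun k => isClosed_le (ipK_cont hw k φ).norm continuous_const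

lemma Sol.contD [P : Par n γ] (hu : Sol γ ε lam u) (j : Fin n) : Continuous (fun p : ℝ × Rn n => Dop j (u p.1) p.2) := by
  have h1 : Continuous (fun p : ℝ × Rn n => fderiv ℝ (fun p : ℝ × Rn n => u p.1 p.2) p (0, ej j)) :=
    (hu.smooth.continuous_fderiv (by simp)).clm_apply continuous_const
  have e : (fun p : ℝ × Rn n => Dop j (u p.1) p.2) = fun p : ℝ × Rn n => fderiv ℝ (fun p : ℝ × Rn n => u p.1 p.2) p (0, ej j) := by
    funext p
    have h2 : HasFDerivAt (fun p : ℝ × Rn n => u p.1 p.2) _ (p.1, p.2) := (hu.smooth.differentiable (by simp) p).hasFDerivAt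
    have h3 : HasFDerivAt (fun x : Rn n => (p.1, x)) _ p.2 := (hasFDerivAt_const (𝕜 := ℝ) p.1 p.2).prodMk (hasFDerivAt_id p.2)
    have h4 := h2.comp p.2 h3
    rw [Dop_apply]
    have h5 : fderiv ℝ (⇑(u p.1)) p.2 = _ := h4.fderiv
    rw [h5]
    simp
  rw [e]; exact h1

lemma Sol.contX [P : Par n γ] (hu : Sol γ ε lam u) (j : Fin n) : Continuous (fun p : ℝ × Rn n => Xop j (u p.1) p.2) := by
  simp only [Xop_apply]
  have h := hu.cont
  fun_prop

def FB (u : ℝ → SR n) (k : ℕ) : Set ℝ :=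
  {t | nrm (u t) ≤ k} ∩ ((⋂ j, {t | nrm (Xop j (u t)) ≤ k}) ∩ ⋂ j, {t | nrm (Dop j (u t)) ≤ k})

lemma FB_closed [P : Par n γ] (hu : Sol γ ε lam u) (k : ℕ) : IsClosed (FB u k) :=
  (lsc hu.cont (Nat.cast_nonneg k)).inter ((isClosed_iInter fun j => lsc (hu.contX j) (Nat.cast_nonneg k)).inter
    (isClosed_iInter fun j => lsc (hu.contD j) (Nat.cast_nonneg k)))

lemma FB_nS {k : ℕ} {t : ℝ} (h : t ∈ FB u k) : nS (u t) ≤ (2 * n + 1) * k := by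
  obtain ⟨h1, h2, h3⟩ := h
  simp only [Set.mem_iInter, Set.mem_setOf_eq] at h1 h2 h3
  exact nS_le h1 h2 h3

lemma FB_ex (u : ℝ → SR n) (t : ℝ) : ∃ k, t ∈ FB u k := by
  obtain ⟨k, hk⟩ := exists_nat_ge (nS (u t))
  refine ⟨k, (nrm_le_nS _).trans hk, ?_, ?_⟩ <;> simp only [Set.mem_iInter, Set.mem_setOf_eq] <;> intro j
  · exact (nrmX_le_nS j _).trans hk
  · exact (nrmD_le_nS j _).trans hk

def GB (u : ℝ → SR n) : Set ℝ := {t | ∃ M, ∀ᶠ s in 𝓝 t, nS (u s) ≤ M}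

lemma GB_open (u : ℝ → SR n) : IsOpen (GB u) := by
  rw [isOpen_iff_mem_nhds]
  rintro t ⟨M, hM⟩
  filter_upwards [hM.eventually_nhds] with s hs using ⟨M, hs⟩

lemma GB_cpt {K : Set ℝ} (hK : IsCompact K) (h : K ⊆ GB u) : ∃ M, ∀ s ∈ K, nS (u s) ≤ M := by
  refine hK.induction_on (p := fun K => ∃ M, ∀ s ∈ K, nS (u s) ≤ M) ⟨0, by simp⟩ ?_ ?_ ?_
  · rintro s t hst ⟨M, hM⟩; exact ⟨M, fun x hx => hM x (hst hx)⟩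
  · rintro s t ⟨M, hM⟩ ⟨M', hM'⟩
    refine ⟨max M M', fun x hx => ?_⟩
    rcases hx with hx | hx
    · exact (hM x hx).trans (le_max_left _ _)
    · exact (hM' x hx).trans (le_max_right _ _)
  · intro x hx
    obtain ⟨M, hM⟩ := h hx
    exact ⟨{s | nS (u s) ≤ M}, mem_nhdsWithin_of_mem_nhds hM, M, fun s hs => hs⟩

lemma bd_seg [P : Par n γ] (h0 : 0 < ε) (h1 : ε ≤ 1) (hl : 0 ≤ lam) (hu : Sol γ ε lam u) {c t : ℝ}
    (h : ∀ s ∈ Set.uIcc c t, s ≠ c → s ∈ GB u) : nS (u t) ≤ PhiB n ε γ lam (nS (u c)) := by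
  refine energy_bd (M := max (nS (u c)) (PhiB n ε γ lam (nS (u t)))) h0 h1 hl hu fun s hs => ?_
  by_cases hsc : s = c
  · rw [hsc]; exact le_max_left _ _
  refine le_trans ?_ (le_max_right _ _)
  have hsub : Set.uIcc t s ⊆ GB u := by
    intro r hr
    have h2 : r ∈ Set.uIcc c t := Set.uIcc_subset_uIcc Set.right_mem_uIcc hs hr
    refine h r h2 ?_
    rintro rfl
    apply hsc
    rw [Set.mem_uIcc] at hs hr
    rcases hs with hs | hs <;> rcases hr with hr | hr <;> linarith [hs.1, hs.2, hr.1, hr.2]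
  obtain ⟨M, hM⟩ := GB_cpt isCompact_uIcc hsub
  exact energy_bd h0 h1 hl hu hM

lemma baire_aux {E : Set ℝ} (hE : IsClosed E) (hEn : E.Nonempty) {F : ℕ → Set ℝ} (hF : ∀ k, IsClosed (F k)) (hc : ∀ t, ∃ k, t ∈ F k) :
    ∃ t0 ∈ E, ∃ k, ∃ δ > 0, ∀ s ∈ E, |s - t0| < δ → s ∈ F k := by
  have : CompleteSpace E := hE.completeSpace_coe
  have : Nonempty E := hEn.to_subtype
  obtain ⟨k, hk⟩ := nonempty_interior_of_iUnion_of_closed (X := E) (f := fun k : ℕ => Subtype.val ⁻¹' (F k))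
    (fun k => (hF k).preimage continuous_subtype_val)
    (Set.eq_univ_of_forall fun t => Set.mem_iUnion.2 (hc t.1))
  obtain ⟨⟨t0, ht0⟩, hi⟩ := hk
  rw [mem_interior_iff_mem_nhds, Metric.mem_nhds_iff] at hi
  obtain ⟨δ, hδ, hb⟩ := hi
  refine ⟨t0, ht0, k, δ, hδ, fun s hs hd => ?_⟩
  have h : (⟨s, hs⟩ : E) ∈ Metric.ball (⟨t0, ht0⟩ : E) δ := by
    simpa [Real.dist_eq, Subtype.dist_eq] using hd
  exact hb h

lemma GB_univ [P : Par n γ] (h0 : 0 < ε) (h1 : ε ≤ 1) (hl : 0 ≤ lam) (hu : Sol γ ε lam u) : GB u = Set.univ := by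
  by_contra hne
  have hE : IsClosed (GB u)ᶜ := (GB_open u).isClosed_compl
  have hEn : ((GB u)ᶜ).Nonempty := Set.nonempty_compl.2 hne
  obtain ⟨t0, ht0, k, δ, hδ, hb⟩ := baire_aux hE hEn (fun k => FB_closed hu k) (FB_ex u)
  have hEb : ∀ s, s ∉ GB u → |s - t0| < δ → nS (u s) ≤ (2 * n + 1) * k := fun s hs hd => FB_nS (hb s hs hd)
  apply ht0
  refine ⟨max ((2 * n + 1) * k) (PhiB n ε γ lam ((2 * n + 1) * k)), ?_⟩
  filter_upwards [Metric.ball_mem_nhds t0 hδ] with t ht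
  rw [Metric.mem_ball, Real.dist_eq] at ht
  by_cases htG : t ∈ GB u
  · refine le_trans ?_ (le_max_right _ _)
    have hcp : IsCompact (Set.uIcc t0 t ∩ (GB u)ᶜ) := isCompact_uIcc.inter_right hE
    obtain ⟨c, ⟨hc1, hc2⟩, hcm⟩ := hcp.exists_isMinOn ⟨t0, Set.left_mem_uIcc, ht0⟩ (f := fun s => |s - t|) (by fun_prop)
    have hcd : |c - t0| < δ := by
      refine lt_of_le_of_lt ?_ ht
      exact Set.abs_sub_left_of_mem_uIcc hc1
    refine (bd_seg (c := c) h0 h1 hl hu ?_).trans (PhiB_mono h0 hl (nS_nonneg _) (hEb c hc2 hcd))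
    intro s hs hsc
    by_contra hsG
    have h2 : s ∈ Set.uIcc t0 t := Set.uIcc_subset_uIcc hc1 Set.right_mem_uIcc hs
    have h3 : |c - t| ≤ |s - t| := hcm ⟨h2, hsG⟩
    apply hsc
    rw [Set.mem_uIcc] at hs
    rcases hs with hs | hs
    · rw [abs_of_nonpos (by linarith [hs.1, hs.2]), abs_of_nonpos (by linarith [hs.1, hs.2])] at h3
      linarith [hs.1]
    · rw [abs_of_nonneg (by linarith [hs.1, hs.2]), abs_of_nonneg (by linarith [hs.1, hs.2])] at h3
      linarith [hs.2]
  · exact (hEb t htG ht).trans (le_max_left _ _)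

/-- global-in-time bounds -/
lemma Sol.bdd [P : Par n γ] (h0 : 0 < ε) (h1 : ε ≤ 1) (hl : 0 ≤ lam) (hu : Sol γ ε lam u) (s t : ℝ) :
    ∃ M, ∀ τ ∈ Set.Icc s t, nS (u τ) ≤ M :=
  GB_cpt isCompact_Icc (by rw [GB_univ h0 h1 hl hu]; exact Set.subset_univ _)

end

section
open SchwartzMap
variable {n : ℕ} {ε γ lam : ℝ} {u w : ℝ → SR n}

lemma lin_pair [P : Par n γ] (hε : 0 < ε) (h1 : ε ≤ 1) (hw : Sol γ ε 0 w) {s t : ℝ} (hst : s ≤ t) (p : Rn n) :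
    ip (GS ε p t) (w t) = ip (GS ε p s) (w s) := by
  have hcv := CV_nonneg n γ
  obtain ⟨M, hM⟩ := hw.bdd hε h1 le_rfl s t
  have hM0 : 0 ≤ M := (nS_nonneg _).trans (hM s ⟨le_rfl, hst⟩)
  choose CD hCD using GS_nrmD (n := n) hε p
  have hcs : ∑ j, |CD j| ≤ nrm (g0 ε : SR n) + ∑ j, |CD j| := by linarith [nrm_nonneg (g0 ε : SR n)]
  have hp := pairing hε hw (Ψ := fun τ => GS ε p τ) (Ψ' := fun τ => HH ε (GS ε p τ))
      (GS_cont hε p) (GS_HH_cont hε p)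
      (fun τ x => GS_deriv hε p τ x) hst (B := nrm (g0 ε : SR n) + ∑ j, |CD j|) (M := M + CV n γ * M ^ 3)
      (fun τ _ => by rw [GS_nrm]; linarith [Finset.sum_nonneg fun j (_ : j ∈ Finset.univ) => abs_nonneg (CD j)])
      (fun τ _ j => ((hCD j _).trans ((le_abs_self _).trans (Finset.single_le_sum (f := fun j => |CD j|) (fun i _ => abs_nonneg _) (Finset.mem_univ j)))).trans hcs)
      (fun τ _ => by rw [sub_self, nrm_zero]; exact add_nonneg (nrm_nonneg _) (Finset.sum_nonneg fun i _ => abs_nonneg _))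
      (fun τ hτ => by linarith [(nrm_le_nS _).trans (hM τ hτ), mul_nonneg hcv (pow_nonneg hM0 3)])
      (fun τ hτ => by linarith [NN_nrm (γ := γ) (hM τ hτ)])
  have h2 := hp.2
  simp only [sub_self, Complex.ofReal_zero, mul_zero, zero_mul, ip_zero_left, intervalIntegral.integral_zero] at h2
  exact sub_eq_zero.1 h2

/-- the profile a(t), abstractly -/
structure Prof (γ ε : ℝ) [P : Par n γ] (u : ℝ → SR n) (a : ℝ → SR n) : Prop where
  e0 : 0 < ε
  e1 : ε ≤ 1
  sol : Sol γ ε 1 u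
  lin : ∀ t ∈ Set.Icc 0 π, ∃ w : ℝ → SR n, Sol γ ε 0 w ∧ w t = u t ∧ a t = w 0

section
variable {a : ℝ → SR n}
lemma Prof.pair [P : Par n γ] (h : Prof γ ε u a) {t : ℝ} (ht : t ∈ Set.Icc 0 π) (p : Rn n) :
    ip (GS ε p 0) (a t) = ip (GS ε p t) (u t) := by
  obtain ⟨w, hw, h1, h2⟩ := h.lin t ht
  rw [h2, ← h1, lin_pair h.e0 h.e1 hw ht.1]

lemma Prof.zero [P : Par n γ] (h : Prof γ ε u a) : a 0 = u 0 :=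
  GS_ext h.e0 fun p => h.pair ⟨le_rfl, Real.pi_pos.le⟩ p

lemma Prof.AA [P : Par n γ] (h : Prof γ ε u a) {t : ℝ} (ht : t ∈ Set.Icc 0 π) (hc : cos t ≠ 0) : AA ε t (u t) = a t :=
  GS_ext h.e0 fun p => by rw [AA_GS h.e0 hc, h.pair ht]

lemma WeakInt.congr {d : SR n} {R R' : ℝ → SR n} {s t : ℝ} (h : WeakInt d R s t) (hst : s ≤ t)
    (hR : ∀ᵐ τ : ℝ, τ ∈ Set.Ioc s t → R τ = R' τ) : WeakInt d R' s t := fun φ => by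
  have hae : ∀ᵐ τ : ℝ, τ ∈ Set.uIoc s t → ip φ (R τ) = ip φ (R' τ) := by
    filter_upwards [hR] with τ h1 h2
    rw [h1 (by rwa [Set.uIoc_of_le hst] at h2)]
  exact ⟨(h φ).1.congr_ae ((ae_restrict_iff' measurableSet_uIoc).mpr hae), by
    rw [(h φ).2, intervalIntegral.integral_congr_ae hae]⟩

lemma WeakInt.sub {d d' : SR n} {R R' : ℝ → SR n} {s t : ℝ} (h : WeakInt d R s t) (h' : WeakInt d' R' s t) :
    WeakInt (d - d') (fun τ => R τ - R' τ) s t := fun φ => by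
  simp only [ip_sub_right]
  exact ⟨(h φ).1.sub (h' φ).1, by rw [(h φ).2, (h' φ).2, intervalIntegral.integral_sub (h φ).1 (h' φ).1]⟩

lemma Prof.weak [P : Par n γ] (h : Prof γ ε u a) {s t : ℝ} (hs : 0 ≤ s) (hst : s ≤ t) (ht : t ≤ π) :
    WeakInt (a t - a s) (fun τ => (-Complex.I * (|cos τ| ^ (-γ) : ℝ)) • TE γ (ε * tan τ / 2) (a τ) (a τ) (a τ)) s t := by
  obtain ⟨M, hM⟩ := h.sol.bdd h.e0 h.e1 zero_le_one s t
  have := duhamel h.e0 h.sol (s0 := 0) hst hM (d := a t - a s) fun p => by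
    rw [ip_sub_right, h.pair ⟨hs.trans hst, ht⟩, h.pair ⟨hs, hst.trans ht⟩, sub_zero, sub_zero]
  refine this.congr hst ?_
  filter_upwards [cos_ae 0] with τ hc hτ
  rw [sub_zero] at hc ⊢
  rw [NN, AA_TT hc, h.AA ⟨hs.trans hτ.1.le, hτ.2.trans ht⟩ hc, smul_smul]
  simp

lemma Prof.crude [P : Par n γ] (h : Prof γ ε u a) {t : ℝ} (ht : t ∈ Set.Icc 0 π) :
    nS (a t) ≤ PhiB n ε γ 0 (PhiB n ε γ 1 (nS (u 0))) := by
  obtain ⟨w, hw, h1, h2⟩ := h.lin t ht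
  obtain ⟨M, hM⟩ := h.sol.bdd h.e0 h.e1 zero_le_one 0 t
  obtain ⟨M', hM'⟩ := hw.bdd h.e0 h.e1 le_rfl 0 t
  rw [h2]
  have e1 := energy_bd (s := 0) (t := t) h.e0 h.e1 zero_le_one h.sol (M := M) (by rwa [Set.uIcc_of_le ht.1])
  have e2 := energy_bd (s := t) (t := 0) h.e0 h.e1 le_rfl hw (M := M') (by rwa [Set.uIcc_of_ge ht.1])
  rw [h1] at e2
  exact e2.trans (PhiB_mono h.e0 le_rfl (nS_nonneg _) e1)
end

lemma PhiB_eps [P : Par n γ] (hl : 0 ≤ lam) {e0 m : ℝ} (he0 : 0 < e0) (he : e0 ≤ ε) (h1 : ε ≤ 1) (hm : 0 ≤ m) :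
    PhiB n ε γ lam m ≤ (2 * n + 1) * ((m + √ (2 * n * m ^ 2 + lam * 1 * (CV n γ * m ^ 4))) / e0) := by
  have := CV_nonneg n γ
  unfold PhiB
  gcongr

end

section
open SchwartzMap

lemma cos_int {p : ℝ} (h0 : 0 ≤ p) (h1 : p < 1) : IntervalIntegrable (fun τ => |cos τ| ^ (-p)) volume 0 π := by
  have hb : ∀ τ : ℝ, τ ∈ Set.Icc 0 π → τ ≠ π / 2 → |cos τ| ^ (-p) ≤ (2 / π) ^ (-p) * |τ - π / 2| ^ (-p) := by
    intro τ hτ hne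
    have hpi := Real.pi_pos
    have e1 : |cos τ| = |sin (τ - π / 2)| := by rw [Real.sin_sub_pi_div_two, abs_neg]
    have e2 := Real.mul_abs_le_abs_sin (x := τ - π / 2) (by rw [abs_le]; constructor <;> linarith [hτ.1, hτ.2])
    have h3 : 0 < |τ - π / 2| := abs_pos.2 (sub_ne_zero.2 hne)
    rw [← Real.mul_rpow (by positivity) h3.le, e1]
    exact Real.rpow_le_rpow_of_nonpos (by positivity) e2 (by linarith)
  have hm : Measurable fun τ : ℝ => |cos τ| ^ (-p) := by fun_prop
  have a1 : IntervalIntegrable (fun τ : ℝ => (2 / π) ^ (-p) * (π / 2 - τ) ^ (-p)) volume 0 (π / 2) := by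
    have := ((intervalIntegral.intervalIntegrable_rpow' (a := π / 2) (b := 0) (r := -p) (by linarith)).comp_sub_left (π / 2)).const_mul ((2 / π) ^ (-p))
    simpa using this
  have a2 : IntervalIntegrable (fun τ : ℝ => (2 / π) ^ (-p) * (τ - π / 2) ^ (-p)) volume (π / 2) π := by
    have := ((intervalIntegral.intervalIntegrable_rpow' (a := 0) (b := π / 2) (r := -p) (by linarith)).comp_sub_right (π / 2)).const_mul ((2 / π) ^ (-p))
    simpa using this
  have hpi := Real.pi_pos
  have hne : ∀ᵐ τ : ℝ, τ ≠ π / 2 := by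
    have : volume ({π / 2} : Set ℝ) = 0 := by simp
    filter_upwards [compl_mem_ae_iff.2 this] with τ h using h
  refine IntervalIntegrable.trans (b := π / 2) (a1.mono_fun' hm.aestronglyMeasurable ?_) (a2.mono_fun' hm.aestronglyMeasurable ?_)
  · rw [Set.uIoc_of_le (by linarith), EventuallyLE, ae_restrict_iff' measurableSet_Ioc]
    filter_upwards [hne] with τ h1 h2
    have := hb τ ⟨h2.1.le, by linarith [h2.2]⟩ h1
    rw [abs_of_nonpos (a := τ - π / 2) (by linarith [h2.2]), neg_sub] at this
    rwa [Real.norm_of_nonneg (by positivity)]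
  · rw [Set.uIoc_of_le (by linarith), EventuallyLE, ae_restrict_iff' measurableSet_Ioc]
    filter_upwards [hne] with τ h1 h2
    have := hb τ ⟨by linarith [h2.1], h2.2⟩ h1
    rw [abs_of_nonneg (a := τ - π / 2) (by linarith [h2.1])] at this
    rwa [Real.norm_of_nonneg (by positivity)]

lemma cos_int' {p s t : ℝ} (h0 : 0 ≤ p) (h1 : p < 1) (hs : 0 ≤ s) (hst : s ≤ t) (ht : t ≤ π) :
    IntervalIntegrable (fun τ => |cos τ| ^ (-p)) volume s t := by
  refine (cos_int h0 h1).mono_set ?_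
  rw [Set.uIcc_of_le hst, Set.uIcc_of_le Real.pi_pos.le]
  exact Set.Icc_subset_Icc hs ht

def thC (γ t : ℝ) : ℝ := ∫ τ in (0 : ℝ)..t, |cos τ| ^ (-γ)

lemma thC_zero (γ : ℝ) : thC γ 0 = 0 := by simp [thC]

section
variable {γ : ℝ}

lemma thC_sub (g0 : 0 ≤ γ) (g1 : γ < 1) {s t : ℝ} (hs : 0 ≤ s) (hst : s ≤ t) (ht : t ≤ π) :
    thC γ t - thC γ s = ∫ τ in s..t, |cos τ| ^ (-γ) := by
  have := intervalIntegral.integral_add_adjacent_intervals (cos_int' g0 g1 le_rfl hs (hst.trans ht)) (cos_int' g0 g1 hs hst ht)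
  unfold thC; linarith

lemma thC_mono (g0 : 0 ≤ γ) (g1 : γ < 1) {s t : ℝ} (hs : 0 ≤ s) (hst : s ≤ t) (ht : t ≤ π) : thC γ s ≤ thC γ t := by
  have h := thC_sub g0 g1 hs hst ht
  have : 0 ≤ ∫ τ in s..t, |cos τ| ^ (-γ) := intervalIntegral.integral_nonneg hst fun τ _ => by positivity
  linarith

lemma thC_cont (g0 : 0 ≤ γ) (g1 : γ < 1) : ContinuousOn (thC γ) (Set.Icc 0 π) := by
  have := intervalIntegral.continuousOn_primitive_interval (f := fun τ => |cos τ| ^ (-γ)) (a := 0) (b := π) (μ := volume)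
    (by
      have := cos_int g0 g1
      rwa [intervalIntegrable_iff_integrableOn_Icc_of_le Real.pi_pos.le, ← Set.uIcc_of_le Real.pi_pos.le] at this)
  rwa [Set.uIcc_of_le Real.pi_pos.le] at this

lemma thC_deriv (g0 : 0 ≤ γ) (g1 : γ < 1) {t : ℝ} (h : t ∈ Set.Ioo 0 π \ {π / 2}) : HasDerivAt (thC γ) (|cos t| ^ (-γ)) t := by
  obtain ⟨⟨h1, h2⟩, h3⟩ := h
  have hc : cos t ≠ 0 := by
    intro h0
    apply h3
    rw [← Real.cos_pi_div_two] at h0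
    exact Real.injOn_cos ⟨h1.le, h2.le⟩ ⟨by linarith [Real.pi_pos], by linarith [Real.pi_pos]⟩ h0
  have hm : Measurable fun τ : ℝ => |cos τ| ^ (-γ) := by fun_prop
  refine intervalIntegral.integral_hasDerivAt_right (cos_int' g0 g1 le_rfl h1.le h2.le) (hm.stronglyMeasurable.stronglyMeasurableAtFilter) ?_
  exact (Real.continuous_cos.abs.continuousAt).rpow_const (Or.inl (abs_ne_zero.2 hc))

lemma chain_ftc {E : Type*} [NormedAddCommGroup E] [NormedSpace ℝ E] [CompleteSpace E] (g0 : 0 ≤ γ) (g1 : γ < 1) {F F' : ℝ → E}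
    (hF : ∀ x, HasDerivAt F (F' x) x) (hc : Continuous F') {s t : ℝ} (hs : 0 ≤ s) (hst : s ≤ t) (ht : t ≤ π) :
    IntervalIntegrable (fun τ => |cos τ| ^ (-γ) • F' (thC γ τ)) volume s t ∧
      ∫ τ in s..t, |cos τ| ^ (-γ) • F' (thC γ τ) = F (thC γ t) - F (thC γ s) := by
  have hsub : Set.Icc s t ⊆ Set.Icc 0 π := Set.Icc_subset_Icc hs ht
  have hi : IntervalIntegrable (fun τ => |cos τ| ^ (-γ) • F' (thC γ τ)) volume s t := by
    refine (cos_int' g0 g1 hs hst ht).smul_continuousOn ?_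
    rw [Set.uIcc_of_le hst]
    exact hc.comp_continuousOn ((thC_cont g0 g1).mono hsub)
  refine ⟨hi, ?_⟩
  refine integral_eq_of_hasDerivAt_off_countable_of_le (fun t => F (thC γ t)) _ hst (s := {π / 2}) (Set.countable_singleton _) ?_ ?_ hi
  · have : Continuous F := continuous_iff_continuousAt.2 fun x => (hF x).continuousAt
    exact this.comp_continuousOn ((thC_cont g0 g1).mono hsub)
  · intro x hx
    exact (hF _).scomp x (thC_deriv g0 g1 ⟨⟨lt_of_le_of_lt hs hx.1.1, lt_of_lt_of_le hx.1.2 ht⟩, hx.2⟩)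
end

end

section
open SchwartzMap
variable {n : ℕ} {ε γ lam : ℝ}

lemma aH_deriv [P : Par n γ] (f G φ : SR n) (θ : ℝ) :
    HasDerivAt (fun θ => ip φ (aH γ θ f G)) (-Complex.I * ip φ (aH γ θ f (mulS (VV γ f f) G))) θ := by
  have e1 : ∀ H : SR n, ∀ θ, ip φ (aH γ θ f H) = ∫ x, conj (φ x) * (Complex.exp (Complex.I * (((-θ) * VR γ f x : ℝ) : ℂ)) * H x) := fun H θ => by
    rw [ip_eq]
    simp only [aH, mulS_apply (aH_tg θ f), ph]
  have e2 : -Complex.I * ip φ (aH γ θ f (mulS (VV γ f f) G)) =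
      ∫ x, conj (φ x) * (Complex.exp (Complex.I * (((-θ) * VR γ f x : ℝ) : ℂ)) * (Complex.I * ((-1 : ℝ) * VR γ f x : ℝ)) * G x) := by
    rw [e1, ← integral_const_mul]
    refine integral_congr_ae (Eventually.of_forall fun x => ?_)
    simp only [mulS_apply (VV_tg γ f f), ← VR_eq]
    push_cast; ring
  have ii : ∀ φ ψ : SR n, Integrable (fun x => conj (φ x) * ψ x) := fun φ ψ => by
    have h1 : MemLp ψ 2 volume := ψ.memLp 2 volume
    have h2 : MemLp (cj φ) 2 volume := (cj φ).memLp 2 volume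
    exact h2.integrable_mul h1
  have i1 : ∀ θ (H : SR n), Integrable fun x => conj (φ x) * (Complex.exp (Complex.I * (((-θ) * VR γ f x : ℝ) : ℂ)) * H x) := fun θ H => by
    have := ii φ (aH γ θ f H)
    simpa only [aH, mulS_apply (aH_tg θ f), ph] using this
  rw [e2]
  simp only [e1]
  have i2 : Integrable fun x => conj (φ x) * (Complex.exp (Complex.I * (((-θ) * VR γ f x : ℝ) : ℂ)) * (Complex.I * ((-1 : ℝ) * VR γ f x : ℝ)) * G x) := by
    have := (i1 θ (mulS (VV γ f f) G)).const_mul (-Complex.I)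
    refine this.congr (Eventually.of_forall fun x => ?_)
    simp only [mulS_apply (VV_tg γ f f), ← VR_eq]
    push_cast; ring
  refine (hasDerivAt_integral_of_dominated_loc_of_deriv_le (μ := volume) (s := Set.univ) (bound := fun x => ‖conj (φ x) * (mulS (VV γ f f) G) x‖)
    (F := fun (θ : ℝ) (x : Rn n) => conj (φ x) * (Complex.exp (Complex.I * (((-θ) * VR γ f x : ℝ) : ℂ)) * G x))
    (F' := fun (θ : ℝ) (x : Rn n) => conj (φ x) * (Complex.exp (Complex.I * (((-θ) * VR γ f x : ℝ) : ℂ)) * (Complex.I * ((-1 : ℝ) * VR γ f x : ℝ)) * G x))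
    univ_mem (Eventually.of_forall fun θ => (i1 θ G).aestronglyMeasurable) (i1 θ G) i2.aestronglyMeasurable ?_ (ii φ _).norm ?_).2
  · refine Eventually.of_forall fun x θ _ => ?_
    simp only [mulS_apply (VV_tg γ f f), ← VR_eq]
    have : ‖Complex.exp (Complex.I * (((-θ) * VR γ f x : ℝ) : ℂ))‖ = 1 := by
      rw [mul_comm]; exact Complex.norm_exp_ofReal_mul_I _
    rw [norm_mul, norm_mul, norm_mul, norm_mul, this, norm_mul, norm_mul]
    simp
  · refine Eventually.of_forall fun x θ _ => ?_
    refine HasDerivAt.const_mul _ (HasDerivAt.mul_const ?_ _)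
    have h1 : HasDerivAt (fun θ : ℝ => -θ * VR γ f x) ((-1 : ℝ) * VR γ f x) θ := (hasDerivAt_id θ).neg.mul_const _
    exact (h1.ofReal_comp.const_mul Complex.I).cexp

lemma NN_aH [P : Par n γ] (f : SR n) (θ : ℝ) : NN γ (aH γ θ f f) = aH γ θ f (mulS (VV γ f f) f) := by
  have hh : ∀ x, hartree γ (⇑(aH γ θ f f)) x = hartree γ (⇑f) x := fun x => by
    unfold hartree
    congr 1
    funext y
    rw [aH, mulS_apply (aH_tg θ f), map_mul, Complex.normSq_eq_norm_sq (ph _ y), ph_norm]; simp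
  ext x
  simp only [NN, TT_apply]
  rw [← hartree_eq, hh, hartree_eq]
  simp only [aH, mulS_apply (aH_tg θ f), mulS_apply (VV_tg γ f f)]
  ring

lemma aH_weak [P : Par n γ] (f : SR n) {s t : ℝ} (hs : 0 ≤ s) (hst : s ≤ t) (ht : t ≤ π) :
    WeakInt (aH γ (thC γ t) f f - aH γ (thC γ s) f f) (fun τ => (-Complex.I * (|cos τ| ^ (-γ) : ℝ)) • NN γ (aH γ (thC γ τ) f f)) s t := by
  intro φ
  have hc : Continuous fun θ => -Complex.I * ip φ (aH γ θ f (mulS (VV γ f f) f)) :=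
    continuous_const.mul (continuous_iff_continuousAt.2 fun θ => (aH_deriv f _ φ θ).continuousAt)
  have h := chain_ftc P.h0.le P.h1 (fun θ => aH_deriv (γ := γ) f f φ θ) hc hs hst ht
  have e : (fun τ => |cos τ| ^ (-γ) • (-Complex.I * ip φ (aH γ (thC γ τ) f (mulS (VV γ f f) f)))) =
      fun τ => ip φ ((-Complex.I * (|cos τ| ^ (-γ) : ℝ)) • NN γ (aH γ (thC γ τ) f f)) := by
    funext τ
    rw [ip_smul_right, NN_aH, Complex.real_smul]; ring
  rw [e] at h
  exact ⟨h.1, by rw [h.2, ip_sub_right]⟩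

lemma aH_zero [P : Par n γ] (f F : SR n) : aH γ 0 f F = F := by
  ext x
  rw [aH, mulS_apply (aH_tg 0 f)]
  simp [ph]

lemma aH_inv [P : Par n γ] (f F : SR n) (θ : ℝ) : aH γ (-θ) f (aH γ θ f F) = F := by
  ext x
  simp only [aH, mulS_apply (aH_tg (-θ) f), mulS_apply (aH_tg θ f)]
  rw [← mul_assoc, ph, ph, ← Complex.exp_add]
  push_cast
  ring_nf
  simp

lemma aH_sub [P : Par n γ] (f F G : SR n) (θ : ℝ) : aH γ θ f (F - G) = aH γ θ f F - aH γ θ f G := by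
  rw [aH, map_sub]; rfl

lemma aH_nS [P : Par n γ] (f : SR n) {Θ : ℝ} (hΘ : 0 ≤ Θ) : ∃ C, 0 ≤ C ∧ ∀ θ, |θ| ≤ Θ → ∀ F, nS (aH γ θ f F) ≤ C * nS F := by
  have hcv := CV_nonneg n γ
  set k : Fin n → ℝ := fun j => CV n γ * (h1 (Dop j f) * nrm f) + CV n γ * (h1 f * nrm (Dop j f)) with hk
  have hk0 : ∀ j, 0 ≤ k j := fun j => by
    have := h1_nonneg f
    have := h1_nonneg (Dop j f)
    have := nrm_nonneg f
    have := nrm_nonneg (Dop j f)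
    simp only [hk]; positivity
  have hK : 0 ≤ ∑ j, k j := Finset.sum_nonneg fun j _ => hk0 j
  refine ⟨(2 * n + 1) * (1 + Θ * ∑ j, k j), by positivity, fun θ hθ F => ?_⟩
  have hF := nS_nonneg F
  have hx : 0 ≤ Θ * (∑ j, k j) * nS F := by positivity
  rw [mul_assoc]
  refine nS_le ?_ (fun j => ?_) (fun j => ?_)
  · rw [aH_nrm]; nlinarith [nrm_le_nS F]
  · rw [aH_X, aH_nrm]; nlinarith [nrmX_le_nS j F]
  · rw [aH_D]
    refine (nrm_add _ _).trans ?_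
    rw [nrm_smul, aH_nrm, aH_nrm]
    have e : mulS (VD γ f j) F = TT γ (Dop j f) f F + TT γ f (Dop j f) F := by
      ext x
      rw [mulS_apply (VD_tg f j), add_ap, TT_apply, TT_apply, VD]; ring
    have b1 : nrm (mulS (VD γ f j) F) ≤ k j * nrm F := by
      rw [e]
      refine (nrm_add _ _).trans ?_
      have a1 := TT_le1 (γ := γ) (Dop j f) f F
      have a2 := TT_le1 (γ := γ) f (Dop j f) F
      simp only [hk]
      nlinarith
    have b2 : k j ≤ ∑ j, k j := Finset.single_le_sum (fun i _ => hk0 i) (Finset.mem_univ j)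
    have b3 : ‖-(θ * Complex.I)‖ = |θ| := by simp
    rw [b3]
    have b4 : |θ| * nrm (mulS (VD γ f j) F) ≤ Θ * ((∑ j, k j) * nS F) := by
      refine mul_le_mul hθ (b1.trans (mul_le_mul b2 (nrm_le_nS F) (nrm_nonneg _) hK)) (nrm_nonneg _) hΘ
    nlinarith [nrmD_le_nS j F]

end

section
open SchwartzMap
variable {n : ℕ} {ε γ q : ℝ}

lemma cont_of_dom {y θ : ℝ → ℝ} {S : Set ℝ} {K : ℝ} (hθ : ContinuousOn θ S) (h : ∀ s ∈ S, ∀ t ∈ S, |y t - y s| ≤ K * |θ t - θ s|) :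
    ContinuousOn y S := by
  intro s hs
  have h1 : Tendsto (fun t => K * |θ t - θ s|) (𝓝[S] s) (𝓝 0) := by
    have : Tendsto (fun t => K * |θ t - θ s|) (𝓝[S] s) (𝓝 (K * |θ s - θ s|)) := (Tendsto.abs (Tendsto.sub (hθ s hs) tendsto_const_nhds)).const_mul K
    rwa [sub_self, abs_zero, mul_zero] at this
  have h2 : Tendsto (fun t => |y t - y s|) (𝓝[S] s) (𝓝 0) :=
    squeeze_zero' (Eventually.of_forall fun t => abs_nonneg _) (by filter_upwards [self_mem_nhdsWithin] with t ht using h s hs t ht) h1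
  rw [ContinuousWithinAt, tendsto_iff_dist_tendsto_zero]
  simpa [Real.dist_eq] using h2

lemma cons_pow [P : Par n γ] (f : SR n) (Θ : ℝ) (hq0 : 0 < q) (hq1 : q ≤ 1) : ∃ M C : ℝ, 0 < M ∧ 0 ≤ C ∧ ∀ θ, |θ| ≤ Θ → nS (aH γ θ f f) ≤ M ∧
    ∀ s, nS (TE γ s (aH γ θ f f) (aH γ θ f f) (aH γ θ f f) - NN γ (aH γ θ f f)) ≤ C * |s| ^ q := by
  obtain ⟨C0, h0, h⟩ := aH_cons (γ := γ) f Θ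
  have hcs := CS_nonneg n γ
  have hB : 0 ≤ 2 * (CS n γ * C0 ^ 3) := by positivity
  refine ⟨C0 + 1, C0 + 2 * (CS n γ * C0 ^ 3), by linarith, by positivity, fun θ hθ => ⟨by linarith [(h θ hθ).1], fun s => ?_⟩⟩
  obtain ⟨h1, h2⟩ := h θ hθ
  rcases le_total |s| 1 with hs | hs
  · have e1 : |s| ≤ |s| ^ q := by
      have := Real.rpow_le_rpow_of_exponent_ge' (abs_nonneg s) hs hq0.le hq1
      simpa using this
    have : 0 ≤ |s| ^ q := by positivity
    calc _ ≤ C0 * |s| := h2 s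
      _ ≤ C0 * |s| ^ q := by gcongr
      _ ≤ _ := by gcongr; linarith
  · have e1 : 1 ≤ |s| ^ q := Real.one_le_rpow hs hq0.le
    have a1 := TE_nS' (γ := γ) s (aH γ θ f f) (aH γ θ f f) (aH γ θ f f)
    have a2 := NN_nS (γ := γ) h1
    have a3 := nS_nonneg (aH γ θ f f)
    have a4 : nS (aH γ θ f f) * nS (aH γ θ f f) * nS (aH γ θ f f) ≤ C0 ^ 3 := by
      calc _ = nS (aH γ θ f f) ^ 3 := by ring
        _ ≤ _ := by gcongr
    have a5 := mul_le_mul_of_nonneg_left a4 hcs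
    calc _ ≤ _ := nS_sub _ _
      _ ≤ (C0 + 2 * (CS n γ * C0 ^ 3)) * 1 := by linarith
      _ ≤ _ := by gcongr

lemma tan_pow (h0 : 0 < ε) (hq0 : 0 < q) {τ : ℝ} (hc : cos τ ≠ 0) :
    |cos τ| ^ (-γ) * |ε * tan τ / 2| ^ q ≤ ε ^ q * |cos τ| ^ (-(γ + q)) := by
  have hc' : 0 < |cos τ| := abs_pos.2 hc
  have e1 : |ε * tan τ / 2| ≤ ε * |cos τ|⁻¹ := by
    rw [Real.tan_eq_sin_div_cos, abs_div, abs_mul, abs_div, abs_of_pos h0, abs_of_pos (two_pos : (0 : ℝ) < 2)]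
    have := Real.abs_sin_le_one τ
    have h3 : |sin τ| / |cos τ| ≤ |cos τ|⁻¹ := by rw [div_eq_mul_inv]; exact mul_le_of_le_one_left (by positivity) this
    have h4 := mul_le_mul_of_nonneg_left h3 h0.le
    have h5 : 0 ≤ ε * (|sin τ| / |cos τ|) := by positivity
    linarith
  have e2 : |ε * tan τ / 2| ^ q ≤ ε ^ q * |cos τ| ^ (-q) := by
    refine (Real.rpow_le_rpow (abs_nonneg _) e1 hq0.le).trans_eq ?_
    rw [Real.mul_rpow h0.le (by positivity), Real.inv_rpow hc'.le, Real.rpow_neg hc'.le]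
  calc _ ≤ |cos τ| ^ (-γ) * (ε ^ q * |cos τ| ^ (-q)) := by gcongr
    _ = ε ^ q * (|cos τ| ^ (-γ) * |cos τ| ^ (-q)) := by ring
    _ = _ := by rw [← Real.rpow_add hc', neg_add]

lemma rhs_bd [P : Par n γ] {a b : SR n} {h s : ℝ} (hh : 0 ≤ h) :
    nS ((-Complex.I * (h : ℝ)) • TE γ s a a a - (-Complex.I * (h : ℝ)) • NN γ b) = h * nS (TE γ s a a a - NN γ b) := by
  rw [← smul_sub, nS_smul]
  simp [abs_of_nonneg hh]

lemma prof_weak [P : Par n γ] (f : SR n) {u a : ℝ → SR n} (hp : Prof γ ε u a) {s t : ℝ} (hs : 0 ≤ s) (hst : s ≤ t) (ht : t ≤ π) {b : ℝ → ℝ}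
    (hb : IntervalIntegrable b volume s t) (hR : ∀ᵐ τ : ℝ, τ ∈ Set.Ioc s t →
      |cos τ| ^ (-γ) * nS (TE γ (ε * tan τ / 2) (a τ) (a τ) (a τ) - NN γ (aH γ (thC γ τ) f f)) ≤ b τ) :
    nS ((a t - aH γ (thC γ t) f f) - (a s - aH γ (thC γ s) f f)) ≤ ∫ τ in s..t, b τ := by
  have h := (hp.weak hs hst ht).sub (aH_weak (γ := γ) f hs hst ht)
  have e : (a t - aH γ (thC γ t) f f) - (a s - aH γ (thC γ s) f f) = (a t - a s) - (aH γ (thC γ t) f f - aH γ (thC γ s) f f) := by abel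
  rw [e]
  refine h.nS_le hst hb ?_
  filter_upwards [hR] with τ h1 h2
  rw [rhs_bd (by positivity)]
  exact h1 h2

lemma prof_cont [P : Par n γ] (f : SR n) {u a : ℝ → SR n} (hp : Prof γ ε u a) {M : ℝ}
    (hM : ∀ τ ∈ Set.Icc 0 π, nS (aH γ (thC γ τ) f f) ≤ M) :
    ContinuousOn (fun t => nS (a t - aH γ (thC γ t) f f)) (Set.Icc 0 π) := by
  have g0 := P.h0
  have g1 := P.h1
  obtain ⟨Mc, hMc⟩ : ∃ Mc, ∀ τ ∈ Set.Icc 0 π, nS (a τ) ≤ Mc := ⟨_, fun τ hτ => hp.crude hτ⟩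
  have hcs := CS_nonneg n γ
  set K : ℝ := CS n γ * Mc ^ 3 + CS n γ * M ^ 3 with hK
  have key : ∀ s ∈ Set.Icc 0 π, ∀ t ∈ Set.Icc 0 π, s ≤ t →
      |nS (a t - aH γ (thC γ t) f f) - nS (a s - aH γ (thC γ s) f f)| ≤ K * |thC γ t - thC γ s| := by
    intro s hs t ht hst
    have h1 := prof_weak (γ := γ) f hp hs.1 hst ht.2 ((cos_int' g0.le g1 hs.1 hst ht.2).const_mul K) (Eventually.of_forall fun τ hτ => by
      have hτ' : τ ∈ Set.Icc 0 π := ⟨hs.1.trans hτ.1.le, hτ.2.trans ht.2⟩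
      rw [mul_comm]
      refine mul_le_mul_of_nonneg_right ?_ (by positivity)
      have a1 := TE_nS' (γ := γ) (ε * tan τ / 2) (a τ) (a τ) (a τ)
      have a2 := NN_nS (γ := γ) (hM τ hτ')
      have a3 := nS_nonneg (a τ)
      have a4 : nS (a τ) * nS (a τ) * nS (a τ) ≤ Mc ^ 3 := by
        calc _ = nS (a τ) ^ 3 := by ring
          _ ≤ _ := by gcongr; exact hMc τ hτ'
      have a5 := mul_le_mul_of_nonneg_left a4 hcs
      exact (nS_sub _ _).trans (by linarith))
    rw [intervalIntegral.integral_const_mul, ← thC_sub g0.le g1 hs.1 hst ht.2] at h1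
    rw [abs_of_nonneg (a := thC γ t - thC γ s) (by linarith [thC_mono g0.le g1 hs.1 hst ht.2])]
    refine le_trans ?_ h1
    rw [abs_sub_le_iff]
    constructor
    · have := nS_add ((a t - aH γ (thC γ t) f f) - (a s - aH γ (thC γ s) f f)) (a s - aH γ (thC γ s) f f)
      rw [sub_add_cancel] at this
      linarith
    · rw [nS_sub_comm (a t - aH γ (thC γ t) f f)]
      have := nS_add ((a s - aH γ (thC γ s) f f) - (a t - aH γ (thC γ t) f f)) (a t - aH γ (thC γ t) f f)
      rw [sub_add_cancel] at this
      linarith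
  refine cont_of_dom (K := K) (thC_cont g0.le g1) fun s hs t ht => ?_
  rcases le_total s t with h | h
  · exact key s hs t ht h
  · rw [abs_sub_comm, abs_sub_comm (thC γ t)]; exact key t ht s hs h

lemma exp_int {L : ℝ} (hL : 0 < L) (g0 : 0 ≤ γ) (g1 : γ < 1) {t : ℝ} (ht : t ∈ Set.Icc 0 π) :
    IntervalIntegrable (fun τ => |cos τ| ^ (-γ) * exp (2 * L * thC γ τ)) volume 0 t ∧
    ∫ τ in (0 : ℝ)..t, |cos τ| ^ (-γ) * exp (2 * L * thC γ τ) = (exp (2 * L * thC γ t) - 1) / (2 * L) := by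
  have h1 : ∀ x : ℝ, HasDerivAt (fun x => exp (2 * L * x) / (2 * L)) (exp (2 * L * x)) x := fun x => by
    have := ((hasDerivAt_id x).const_mul (2 * L)).exp.div_const (2 * L)
    rw [mul_one, mul_div_assoc, div_self (by positivity), mul_one] at this
    exact this
  have h := chain_ftc (γ := γ) g0 g1 h1 (by fun_prop) le_rfl ht.1 ht.2
  simp only [smul_eq_mul] at h
  refine ⟨h.1, ?_⟩
  rw [h.2, thC_zero]
  simp; ring

lemma boot [P : Par n γ] (f : SR n) (hq0 : 0 < q) (hq1 : γ + q < 1) {u a : ℝ → SR n} (hp : Prof γ ε u a) (hu0 : u 0 = f)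
    {M C2 L A : ℝ} (hM : 0 < M) (hC2 : 0 ≤ C2)
    (hcons : ∀ τ ∈ Set.Icc 0 π, nS (aH γ (thC γ τ) f f) ≤ M ∧ ∀ s, nS (TE γ s (aH γ (thC γ τ) f f) (aH γ (thC γ τ) f f) (aH γ (thC γ τ) f f)
      - NN γ (aH γ (thC γ τ) f f)) ≤ C2 * |s| ^ q)
    (hL : L = 3 * CS n γ * (2 * M) ^ 2 + 1) (hA : A = 1 + C2 * ∫ τ in (0 : ℝ)..π, |cos τ| ^ (-(γ + q)))
    (hs : 2 * A * ε ^ q * exp (2 * L * thC γ π) ≤ M) :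
    ∀ t ∈ Set.Icc 0 π, nS (a t - aH γ (thC γ t) f f) ≤ 2 * A * ε ^ q * exp (2 * L * thC γ t) := by
  have g0 := P.h0
  have g1 := P.h1
  have hpi := Real.pi_pos
  have hε := hp.e0
  have hη : 0 < ε ^ q := Real.rpow_pos_of_pos hε _
  have hcs := CS_nonneg n γ
  have hL0 : 0 < L := by rw [hL]; positivity
  have hJ0 : 0 ≤ ∫ τ in (0 : ℝ)..π, |cos τ| ^ (-(γ + q)) := intervalIntegral.integral_nonneg hpi.le fun τ _ => by positivity
  have hA0 : 0 < A := by rw [hA]; positivity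
  set Y : ℝ → ℝ := fun t => 2 * A * ε ^ q * exp (2 * L * thC γ t) with hY
  set y : ℝ → ℝ := fun t => nS (a t - aH γ (thC γ t) f f) with hy
  have hyc : ContinuousOn y (Set.Icc 0 π) := prof_cont f hp fun τ hτ => (hcons τ hτ).1
  have hYc : ContinuousOn Y (Set.Icc 0 π) := by
    have := thC_cont (γ := γ) g0.le g1
    fun_prop
  have hYM : ∀ t ∈ Set.Icc 0 π, Y t ≤ M := fun t ht => by
    refine le_trans ?_ hs
    have := thC_mono g0.le g1 ht.1 ht.2 le_rfl
    simp only [hY]; gcongr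
  by_contra hcon
  push Not at hcon
  obtain ⟨t1, ht1, ht1'⟩ := hcon
  have hBc : IsCompact (Set.Icc 0 π ∩ (fun t => y t - Y t) ⁻¹' Set.Ici 0) :=
    isCompact_Icc.of_isClosed_subset ((hyc.sub hYc).preimage_isClosed_of_isClosed isClosed_Icc isClosed_Ici) Set.inter_subset_left
  obtain ⟨t, ⟨ht, htB⟩, hmin⟩ := hBc.exists_isLeast ⟨t1, ht1, by simp only [Set.mem_preimage, Set.mem_Ici, hy, hY]; linarith⟩
  have htB' : Y t ≤ y t := by simpa using htB
  have hlt : ∀ τ, 0 ≤ τ → τ < t → y τ < Y τ := fun τ h1 h2 => by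
    by_contra h3
    push Not at h3
    have := hmin ⟨⟨h1, h2.le.trans ht.2⟩, by simpa using h3⟩
    linarith
  have i1 := exp_int (γ := γ) hL0 g0.le g1 ht
  have i2 := cos_int' (p := γ + q) (by linarith) hq1 le_rfl ht.1 ht.2
  have hne : ∀ᵐ τ : ℝ, τ ≠ t := by
    have : volume ({t} : Set ℝ) = 0 := by simp
    filter_upwards [compl_mem_ae_iff.2 this] with τ h using h
  have hw := prof_weak (γ := γ) f hp le_rfl ht.1 ht.2 (b := fun τ => L * (2 * A * ε ^ q) * (|cos τ| ^ (-γ) * exp (2 * L * thC γ τ)) +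
      C2 * ε ^ q * |cos τ| ^ (-(γ + q))) ((i1.1.const_mul _).add (i2.const_mul _)) (by
    filter_upwards [hne, cos_ae 0] with τ hne hc hτ
    rw [sub_zero] at hc
    have hτ' : τ ∈ Set.Icc 0 π := ⟨hτ.1.le, hτ.2.trans ht.2⟩
    have hyY : y τ ≤ Y τ := (hlt τ hτ.1.le (lt_of_le_of_ne hτ.2 hne)).le
    obtain ⟨c1, c2⟩ := hcons τ hτ'
    have c3 : nS (a τ) ≤ 2 * M := by
      have := nS_add (a τ - aH γ (thC γ τ) f f) (aH γ (thC γ τ) f f)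
      rw [sub_add_cancel] at this
      have h2 := hyY.trans (hYM τ hτ')
      simp only [hy] at h2
      linarith
    have c4 := TE_lip (γ := γ) (ε * tan τ / 2) c3 (show nS (aH γ (thC γ τ) f f) ≤ 2 * M by linarith)
    have c5 : nS (TE γ (ε * tan τ / 2) (a τ) (a τ) (a τ) - NN γ (aH γ (thC γ τ) f f)) ≤ L * Y τ + C2 * |ε * tan τ / 2| ^ q := by
      have := nS_add (TE γ (ε * tan τ / 2) (a τ) (a τ) (a τ) - TE γ (ε * tan τ / 2) (aH γ (thC γ τ) f f) (aH γ (thC γ τ) f f) (aH γ (thC γ τ) f f))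
        (TE γ (ε * tan τ / 2) (aH γ (thC γ τ) f f) (aH γ (thC γ τ) f f) (aH γ (thC γ τ) f f) - NN γ (aH γ (thC γ τ) f f))
      rw [sub_add_sub_cancel] at this
      have d1 : 3 * CS n γ * (2 * M) ^ 2 * y τ ≤ L * Y τ := by
        have := nS_nonneg (a τ - aH γ (thC γ τ) f f)
        refine mul_le_mul (by linarith) hyY this hL0.le
      have d2 := c2 (ε * tan τ / 2)
      simp only [hy] at d1
      linarith
    have c6 := tan_pow (γ := γ) hε hq0 hc
    calc _ ≤ |cos τ| ^ (-γ) * (L * Y τ + C2 * |ε * tan τ / 2| ^ q) := by gcongr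
      _ = L * (2 * A * ε ^ q) * (|cos τ| ^ (-γ) * exp (2 * L * thC γ τ)) + C2 * (|cos τ| ^ (-γ) * |ε * tan τ / 2| ^ q) := by simp only [hY]; ring
      _ ≤ L * (2 * A * ε ^ q) * (|cos τ| ^ (-γ) * exp (2 * L * thC γ τ)) + C2 * (ε ^ q * |cos τ| ^ (-(γ + q))) := by gcongr
      _ = _ := by ring)
  rw [intervalIntegral.integral_add (i1.1.const_mul _) (i2.const_mul _), intervalIntegral.integral_const_mul, intervalIntegral.integral_const_mul, i1.2,
    hp.zero, hu0, thC_zero, aH_zero, sub_self, sub_zero] at hw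
  have hJ : ∫ τ in (0 : ℝ)..t, |cos τ| ^ (-(γ + q)) ≤ ∫ τ in (0 : ℝ)..π, |cos τ| ^ (-(γ + q)) := by
    have := intervalIntegral.integral_add_adjacent_intervals i2 (cos_int' (p := γ + q) (by linarith) hq1 ht.1 ht.2 le_rfl)
    have h2 : 0 ≤ ∫ τ in t..π, |cos τ| ^ (-(γ + q)) := intervalIntegral.integral_nonneg ht.2 fun τ _ => by positivity
    linarith
  have k1 : C2 * ε ^ q * ∫ τ in (0 : ℝ)..t, |cos τ| ^ (-(γ + q)) ≤ (A - 1) * ε ^ q := by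
    calc _ ≤ C2 * ε ^ q * ∫ τ in (0 : ℝ)..π, |cos τ| ^ (-(γ + q)) := by gcongr
      _ = _ := by rw [hA]; ring
  have k2 : L * (2 * A * ε ^ q) * ((exp (2 * L * thC γ t) - 1) / (2 * L)) = A * ε ^ q * exp (2 * L * thC γ t) - A * ε ^ q := by
    field_simp
  have k3 : 0 < A * ε ^ q * exp (2 * L * thC γ t) := by positivity
  rw [k2] at hw
  simp only [hy, hY] at htB'
  nlinarith

lemma main_bd [P : Par n γ] (f : SR n) (hq0 : 0 < q) (hq1 : γ + q < 1) : ∃ C, 0 ≤ C ∧ ∀ ε u a, Prof γ ε u a → u 0 = f →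
    ∀ t ∈ Set.Icc 0 π, nS (a t - aH γ (thC γ t) f f) ≤ C * ε ^ q := by
  have g0 := P.h0
  have g1 := P.h1
  have hpi := Real.pi_pos
  have hth : ∀ t ∈ Set.Icc 0 π, 0 ≤ thC γ t ∧ thC γ t ≤ thC γ π := fun t ht =>
    ⟨by have := thC_mono g0.le g1 le_rfl ht.1 ht.2; rwa [thC_zero] at this, thC_mono g0.le g1 ht.1 ht.2 le_rfl⟩
  have habs : ∀ t ∈ Set.Icc 0 π, |thC γ t| ≤ thC γ π := fun t ht => by rw [abs_of_nonneg (hth t ht).1]; exact (hth t ht).2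
  obtain ⟨M, C2, hM, hC2, hcons⟩ := cons_pow (γ := γ) (q := q) f (thC γ π) hq0 (by linarith)
  have hcs := CS_nonneg n γ
  set L : ℝ := 3 * CS n γ * (2 * M) ^ 2 + 1 with hL
  have hL0 : 0 < L := by positivity
  set J : ℝ := ∫ τ in (0 : ℝ)..π, |cos τ| ^ (-(γ + q)) with hJ
  have hJ0 : 0 ≤ J := intervalIntegral.integral_nonneg hpi.le fun τ _ => by positivity
  set A : ℝ := 1 + C2 * J with hA
  have hA0 : 0 < A := by positivity
  set E : ℝ := exp (2 * L * thC γ π) with hE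
  have hE0 : 0 < E := Real.exp_pos _
  set c : ℝ := M / (2 * A * E) with hc
  have hc0 : 0 < c := by positivity
  set e0 : ℝ := c ^ (1 / q) with he0
  have he00 : 0 < e0 := Real.rpow_pos_of_pos hc0 _
  set Q1 : ℝ := (2 * n + 1) * ((nS f + √ (2 * n * nS f ^ 2 + 1 * 1 * (CV n γ * nS f ^ 4))) / e0) with hQ1
  set Q2 : ℝ := (2 * n + 1) * ((Q1 + √ (2 * n * Q1 ^ 2 + 0 * 1 * (CV n γ * Q1 ^ 4))) / e0) with hQ2
  have hQ10 : 0 ≤ Q1 := by have := nS_nonneg f; positivity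
  have hQ20 : 0 ≤ Q2 := by positivity
  refine ⟨2 * A * E + (Q2 + M) / c, by positivity, fun ε u a hp hu0 t ht => ?_⟩
  have hε := hp.e0
  have hη : 0 < ε ^ q := Real.rpow_pos_of_pos hε _
  rcases lt_or_ge c (ε ^ q) with hcase | hcase
  · have hee : e0 ≤ ε := by
      have := Real.rpow_le_rpow hc0.le hcase.le (by positivity : (0 : ℝ) ≤ 1 / q)
      rwa [← Real.rpow_mul hε.le, mul_one_div_cancel hq0.ne', Real.rpow_one] at this
    have b1 := hp.crude ht
    rw [hu0] at b1
    have b2 := PhiB_eps (n := n) (γ := γ) zero_le_one he00 hee hp.e1 (nS_nonneg f)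
    have b3 := PhiB_mono (n := n) (γ := γ) (lam := 0) hε le_rfl (m := PhiB n ε γ 1 (nS f)) (by
      have := CV_nonneg n γ
      have := nS_nonneg f
      unfold PhiB; positivity) b2
    have b4 := PhiB_eps (n := n) (γ := γ) (lam := 0) le_rfl he00 hee hp.e1 hQ10
    have b5 : nS (a t - aH γ (thC γ t) f f) ≤ Q2 + M := (nS_sub _ _).trans (add_le_add (b1.trans (b3.trans b4)) (hcons _ (habs t ht)).1)
    have b6 : Q2 + M ≤ (Q2 + M) / c * ε ^ q := by
      rw [div_mul_eq_mul_div, le_div_iff₀ hc0]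
      exact mul_le_mul_of_nonneg_left hcase.le (by positivity)
    have b7 : 0 ≤ 2 * A * E * ε ^ q := by positivity
    linarith
  · have hs : 2 * A * ε ^ q * E ≤ M := by
      rw [hc, le_div_iff₀ (by positivity)] at hcase
      linarith
    have b1 := boot f hq0 hq1 hp hu0 hM hC2 (fun τ hτ => hcons _ (habs τ hτ)) hL hA hs t ht
    have b2 : exp (2 * L * thC γ t) ≤ E := Real.exp_le_exp.2 (mul_le_mul_of_nonneg_left (hth t ht).2 (by positivity))
    have b3 : 0 ≤ (Q2 + M) / c * ε ^ q := by positivity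
    have b4 : 2 * A * ε ^ q * exp (2 * L * thC γ t) ≤ 2 * A * ε ^ q * E := by gcongr
    linarith

end

section
open SchwartzMap
variable {n : ℕ} {ε γ : ℝ}

lemma eLp_sum_le {E : Type*} [NormedAddCommGroup E] {g : Rn n → E} {F : Fin n → SR n} (h : ∀ x, ‖g x‖ ≤ ∑ j, ‖F j x‖) :
    eLpNorm g 2 volume ≤ ENNReal.ofReal (∑ j, nrm (F j)) := by
  have h1 : eLpNorm g 2 volume ≤ eLpNorm (∑ j, fun x => ‖F j x‖) 2 volume := by
    refine eLpNorm_mono_real fun x => ?_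
    simpa using h x
  refine h1.trans ((eLpNorm_sum_le (fun j _ => (F j).continuous.norm.aestronglyMeasurable) (by norm_num)).trans ?_)
  rw [ENNReal.ofReal_sum_of_nonneg fun j _ => nrm_nonneg _]
  refine Finset.sum_le_sum fun j _ => ?_
  rw [eLpNorm_norm, eLp_eq]

lemma euc_le {𝕜 : Type*} [RCLike 𝕜] (x : EuclideanSpace 𝕜 (Fin n)) : ‖x‖ ≤ ∑ j, ‖x j‖ := by
  rw [EuclideanSpace.norm_eq]
  refine Real.sqrt_le_iff.2 ⟨Finset.sum_nonneg fun j _ => norm_nonneg _, ?_⟩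
  exact Finset.sum_sq_le_sq_sum_of_nonneg fun j _ => norm_nonneg _

lemma sigma_le (φ : SR n) : SigmaNorm (⇑φ) ≤ ENNReal.ofReal (nS φ) := by
  have hX : eLpNorm (fun x : Rn n => (‖x‖ : ℂ) * φ x) 2 volume ≤ ENNReal.ofReal (∑ j, nrm (Xop j φ)) := by
    refine eLp_sum_le (F := fun j => Xop j φ) fun x => ?_
    simp only [Xop_apply, norm_mul]
    rw [← Finset.sum_mul]
    refine mul_le_mul_of_nonneg_right ?_ (norm_nonneg _)
    have := euc_le x
    simpa using this
  have hD : eLpNorm (gradE (⇑φ)) 2 volume ≤ ENNReal.ofReal (∑ j, nrm (Dop j φ)) := by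
    refine eLp_sum_le (F := fun j => Dop j φ) fun x => ?_
    refine (euc_le _).trans_eq (Finset.sum_congr rfl fun j _ => ?_)
    rw [Dop_apply]; rfl
  have h1 : 0 ≤ ∑ j, nrm (Xop j φ) := Finset.sum_nonneg fun j _ => nrm_nonneg _
  have h2 : 0 ≤ ∑ j, nrm (Dop j φ) := Finset.sum_nonneg fun j _ => nrm_nonneg _
  unfold SigmaNorm
  rw [eLp_eq, nS, ENNReal.ofReal_add (add_nonneg (nrm_nonneg _) h1) h2, ENNReal.ofReal_add (nrm_nonneg _) h1]
  gcongr

lemma smooth_deriv {u : ℝ → Rn n → ℂ} (hs : ContDiff ℝ (⊤ : ℕ∞) (fun p : ℝ × Rn n => u p.1 p.2)) (t : ℝ) (x : Rn n) :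
    HasDerivAt (fun s => u s x) (deriv (fun s => u s x) t) t := by
  have h2 : HasFDerivAt (fun p : ℝ × Rn n => u p.1 p.2) _ (t, x) := (hs.differentiable (by simp) _).hasFDerivAt
  have h3 : HasDerivAt (fun s : ℝ => (s, x)) (1, 0) t := (hasDerivAt_id t).prodMk (hasDerivAt_const _ _)
  have h4 := h2.comp_hasDerivAt t h3
  have h5 : DifferentiableAt ℝ (fun s => u s x) t := h4.differentiableAt
  exact h5.hasDerivAt

lemma HH_eq (φ : SR n) (x : Rn n) : HH ε φ x = Complex.I * ε / 2 * lap (⇑φ) x - Complex.I / (2 * ε) * ((‖x‖ ^ 2 : ℝ) * φ x) := by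
  have e : (∑ j, Xop j (Xop j φ)) x = ((‖x‖ ^ 2 : ℝ) : ℂ) * φ x := by
    rw [sum_ap, EuclideanSpace.norm_sq_eq]
    push_cast
    rw [Finset.sum_mul]
    refine Finset.sum_congr rfl fun j _ => ?_
    rw [Xop_apply, Xop_apply, ← Complex.ofReal_pow, Real.norm_eq_abs, sq_abs]
    push_cast; ring
  rw [HH, sub_ap, smul_ap, smul_ap, e, lap_eq]

lemma mkSol [P : Par n γ] (h0 : 0 < ε) {u : ℝ → Rn n → ℂ} {f : Rn n → ℂ} (h : IsSolutionH n 1 γ ε f u) :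
    ∃ U : ℝ → SR n, Sol γ ε 1 U ∧ ∀ t, u t = ⇑(U t) := by
  choose U hU using h.schwartz
  refine ⟨U, ⟨?_, fun t x => ?_⟩, hU⟩
  · have := h.smooth
    simpa only [hU] using this
  · have h1 := smooth_deriv h.smooth t x
    have h2 := h.eq t x
    simp only [hU] at h1 h2
    convert h1 using 1
    rw [sub_ap, smul_ap, HH_eq, NN, TT_apply, ← hartree_eq]
    rw [Real.rpow_one] at h2
    have he : (ε : ℂ) ≠ 0 := by exact_mod_cast h0.ne'
    have h3 : Complex.I * Complex.I = -1 := Complex.I_mul_I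
    push_cast at h2 ⊢
    generalize deriv (fun s => (U s) x) t = D at *
    field_simp
    linear_combination (2 * Complex.I) * h2 - (2 * ε * D) * h3

lemma mkLin [P : Par n γ] (h0 : 0 < ε) {u : ℝ → Rn n → ℂ} (h : IsLinSol n ε u) :
    ∃ U : ℝ → SR n, Sol γ ε 0 U ∧ ∀ t, u t = ⇑(U t) := by
  choose U hU using h.schwartz
  refine ⟨U, ⟨?_, fun t x => ?_⟩, hU⟩
  · have := h.smooth
    simpa only [hU] using this
  · have h1 := smooth_deriv h.smooth t x
    have h2 := h.eq t x
    simp only [hU] at h1 h2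
    convert h1 using 1
    rw [sub_ap, smul_ap, HH_eq]
    have he : (ε : ℂ) ≠ 0 := by exact_mod_cast h0.ne'
    have h3 : Complex.I * Complex.I = -1 := Complex.I_mul_I
    push_cast at h2 ⊢
    generalize deriv (fun s => (U s) x) t = D at *
    field_simp
    linear_combination (2 * Complex.I) * h2 - (2 * ε * D) * h3

end

/-- in the case α = 1, 0 < γ < 1, the modified profile
b^ε(t) = (U^ε(−t)u^ε(t)) e^{−ig(t,·)} stays close to f in Σ, uniformly on [0,π]:
sup_{0≤t≤π} ‖b^ε(t) − f‖_Σ ≤ C_δ ε^{1−γ−δ}. Here U^ε(−t)u^ε(t) is encoded as v^{ε,t}(0),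
where v^{ε,t} solves the linear harmonic Schrödinger equation with v^{ε,t}(t) = u^ε(t). -/
theorem stmt11 (n : ℕ) (hn : 2 ≤ n) (γ : ℝ) (hγ0 : 0 < γ) (hγ1 : γ < 1)
    (f : SchwartzMap (Rn n) ℂ) (u : ℝ → ℝ → Rn n → ℂ)
    (hu : ∀ ε ∈ Set.Ioc (0 : ℝ) 1, IsSolutionH n 1 γ ε (⇑f) (u ε))
    (v : ℝ → ℝ → ℝ → Rn n → ℂ)
    (hv : ∀ ε ∈ Set.Ioc (0 : ℝ) 1, ∀ t ∈ Set.Icc (0 : ℝ) π,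
      IsLinSol n ε (v ε t) ∧ v ε t t = u ε t) :
    ∀ δ : ℝ, 0 < δ → ∃ C : ℝ, ∀ ε ∈ Set.Ioc (0 : ℝ) 1, ∀ t ∈ Set.Icc (0 : ℝ) π,
      SigmaNorm (fun x =>
          v ε t 0 x * Complex.exp (-Complex.I * ((gphase γ (⇑f) t x : ℝ) : ℂ)) - f x)
        ≤ ENNReal.ofReal (C * ε ^ (1 - γ - δ)) := by
  intro δ hδ
  have P : Par n γ := ⟨hn, hγ0, hγ1⟩
  set q : ℝ := 1 - γ - min δ ((1 - γ) / 2) with hq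
  have hm1 : min δ ((1 - γ) / 2) ≤ δ := min_le_left _ _
  have hm2 : min δ ((1 - γ) / 2) ≤ (1 - γ) / 2 := min_le_right _ _
  have hm0 : 0 < min δ ((1 - γ) / 2) := lt_min hδ (by linarith)
  obtain ⟨C, hC0, hC⟩ := main_bd (γ := γ) (q := q) f (by linarith) (by linarith)
  have hΘ : 0 ≤ thC γ π := by
    have := thC_mono hγ0.le hγ1 le_rfl Real.pi_pos.le le_rfl
    rwa [thC_zero] at this
  obtain ⟨C', hC'0, hC'⟩ := aH_nS (γ := γ) f hΘ
  refine ⟨C' * C, fun ε hε t ht => ?_⟩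
  obtain ⟨U, hUs, hU⟩ := mkSol (γ := γ) hε.1 (hu ε hε)
  have key : ∀ t, ∃ A : SR n, t ∈ Set.Icc (0 : ℝ) π →
      (∃ w, Sol γ ε 0 w ∧ w t = U t ∧ A = w 0) ∧ v ε t 0 = ⇑A := fun t => by
    by_cases h : t ∈ Set.Icc (0 : ℝ) π
    · obtain ⟨h1, h2⟩ := hv ε hε t h
      obtain ⟨w, hw, hwv⟩ := mkLin (γ := γ) hε.1 h1
      refine ⟨w 0, fun _ => ⟨⟨w, hw, ?_, rfl⟩, hwv 0⟩⟩
      apply DFunLike.coe_injective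
      rw [← hwv t, h2, hU t]
    · exact ⟨0, fun h' => absurd h' h⟩
  choose a ha using key
  have hP : Prof γ ε U a := ⟨hε.1, hε.2, hUs, fun t ht => (ha t ht).1⟩
  have hU0 : U 0 = f := by
    apply DFunLike.coe_injective
    obtain ⟨_, _, h3, _⟩ := hu ε hε
    rw [← hU 0, h3]
  have hb := hC ε U a hP hU0 t ht
  have hθ0 : 0 ≤ thC γ t := by
    have := thC_mono hγ0.le hγ1 le_rfl ht.1 ht.2
    rwa [thC_zero] at this
  have hθ1 : thC γ t ≤ thC γ π := thC_mono hγ0.le hγ1 ht.1 ht.2 le_rfl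
  have hb2 := hC' (-(thC γ t)) (by rwa [abs_neg, abs_of_nonneg hθ0]) (a t - aH γ (thC γ t) f f)
  have hfun : (fun x => v ε t 0 x * Complex.exp (-Complex.I * ((gphase γ (⇑f) t x : ℝ) : ℂ)) - f x)
      = ⇑(aH γ (-(thC γ t)) f (a t - aH γ (thC γ t) f f)) := by
    funext x
    rw [aH_sub, aH_inv, sub_ap, (ha t ht).2, aH, mulS_apply (aH_tg (-(thC γ t)) f), ph]
    have e : gphase γ (⇑f) t x = -(VR γ f x) * thC γ t := rfl
    rw [e]
    push_cast
    ring_nf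
  rw [hfun]
  refine (sigma_le _).trans (ENNReal.ofReal_le_ofReal (hb2.trans ?_))
  have hε2 : ε ^ q ≤ ε ^ (1 - γ - δ) :=
    Real.rpow_le_rpow_of_exponent_ge hε.1 hε.2 (by linarith)
  calc C' * nS (a t - aH γ (thC γ t) f f) ≤ C' * (C * ε ^ (1 - γ - δ)) :=
        mul_le_mul_of_nonneg_left (hb.trans (mul_le_mul_of_nonneg_left hε2 hC0)) hC'0
    _ = C' * C * ε ^ (1 - γ - δ) := by ring

end
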